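/- arXiv:2312.06650 — 2 statements merged into one kernel-verified Lean document; each statement's English description precedes it below -/
import Mathlib

section
/- Let d ≥ 1 be an integer and s ∈ ℕ with d ≥ 2s + 15, and let δ > 0. There exist a threshold p_0, a real constant c > 0 and an integer D', all depending only on δ and d, such that for every prime p ≥ p_0 the following holds. Let M : 𝔽_p^d → 𝔽_p be a non-degenerate quadratic form, H ⊆ 𝔽_p^d, and ξ : H → HP_d(s) a map whose M-energy is at least δ·p^{3d}. Then there exists H' ⊆ H with |H'| ≥ c·p^d such that #dd(ξ̃(H') ⊕ ξ̃(H')) ≤ D', where ξ̃(H') ⊕ ξ̃(H') := {(h + h', span{h, h'}, ξ(h) + ξ(h')) : h, h' ∈ H'}. -/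
noncomputable section

open MvPolynomial

/-- The quadratic polynomial `n ↦ (nA)·n`. -/
def quadPoly (p d : ℕ) (A : Matrix (Fin d) (Fin d) (ZMod p)) :
    MvPolynomial (Fin d) (ZMod p) :=
  ∑ i : Fin d, ∑ j : Fin d, MvPolynomial.C (A i j) * (MvPolynomial.X i * MvPolynomial.X j)

/-- The linear polynomial `n ↦ (hA)·n`. -/
def linPoly (p d : ℕ) (A : Matrix (Fin d) (Fin d) (ZMod p)) (h : Fin d → ZMod p) :
    MvPolynomial (Fin d) (ZMod p) :=
  ∑ j : Fin d, MvPolynomial.C (∑ i : Fin d, h i * A i j) * MvPolynomial.X j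

/-- The ideal `J^M_V` attached to the quadratic form with associated matrix `A` and the
set of vectors `V`: it is generated by `n ↦ (nA)·n` and `n ↦ (hA)·n` for `h ∈ V`. -/
def JM (p d : ℕ) (A : Matrix (Fin d) (Fin d) (ZMod p)) (V : Set (Fin d → ZMod p)) :
    Ideal (MvPolynomial (Fin d) (ZMod p)) :=
  Ideal.span ({quadPoly p d A} ∪ (linPoly p d A '' V))

/-- `M` is the quadratic form `n ↦ (nA)·n + n·u + v` with `A` symmetric. -/
def IsQuadFormWith (p d : ℕ) (M : (Fin d → ZMod p) → ZMod p)
    (A : Matrix (Fin d) (Fin d) (ZMod p)) (u : Fin d → ZMod p) (v : ZMod p) : Prop :=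
  A.IsSymm ∧ ∀ n : Fin d → ZMod p,
    M n = (∑ j : Fin d, (∑ i : Fin d, n i * A i j) * n j) + (∑ i : Fin d, n i * u i) + v

/-- The `M`-energy of `(ξ₁, ξ₂, ξ₃, ξ₄)` on `H`: the number of quadruples
`(h₁,h₂,h₃,h₄) ∈ H⁴` with `h₁ + h₂ = h₃ + h₄` and
`ξ₁(h₁) + ξ₂(h₂) - ξ₃(h₃) - ξ₄(h₄) ∈ J^M_{h₁,h₂,h₃,h₄}`. -/
def Menergy (p d : ℕ) (A : Matrix (Fin d) (Fin d) (ZMod p)) (H : Finset (Fin d → ZMod p))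
    (ξ₁ ξ₂ ξ₃ ξ₄ : (Fin d → ZMod p) → MvPolynomial (Fin d) (ZMod p)) : ℕ :=
  Set.ncard {q : ((Fin d → ZMod p) × (Fin d → ZMod p)) ×
      ((Fin d → ZMod p) × (Fin d → ZMod p)) |
    q.1.1 ∈ H ∧ q.1.2 ∈ H ∧ q.2.1 ∈ H ∧ q.2.2 ∈ H ∧ q.1.1 + q.1.2 = q.2.1 + q.2.2 ∧
    ξ₁ q.1.1 + ξ₂ q.1.2 - ξ₃ q.2.1 - ξ₄ q.2.2 ∈
      JM p d A
        (Submodule.span (ZMod p) {q.1.1, q.1.2, q.2.1, q.2.2} : Set (Fin d → ZMod p))}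

/-- Elements of `Γ^s(M)`: triples `(h, V, f)` with `h ∈ 𝔽_p^d`, `V` a subspace and `f`
a polynomial. -/
abbrev Trip (p d : ℕ) :=
  (Fin d → ZMod p) × Submodule (ZMod p) (Fin d → ZMod p) × MvPolynomial (Fin d) (ZMod p)

/-- The relation `(h,V,f) ∼ (h',V',f')`: `h = h'` and `f - f' ∈ J^M_V + J^M_{V'}`. -/
def TripRel (p d : ℕ) (A : Matrix (Fin d) (Fin d) (ZMod p)) (x y : Trip p d) : Prop :=
  x.1 = y.1 ∧ x.2.2 - y.2.2 ∈
    JM p d A (x.2.1 : Set (Fin d → ZMod p)) + JM p d A (y.2.1 : Set (Fin d → ZMod p))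

/-- Membership in `Γ^s_k(M)`. -/
def memGamma (p d s k : ℕ) (x : Trip p d) : Prop :=
  x.1 ∈ x.2.1 ∧ (x.2.2).IsHomogeneous s ∧
    (x.1 ≠ 0 → Module.finrank (ZMod p) x.2.1 ≤ k) ∧
    (x.1 = 0 → Module.finrank (ZMod p) x.2.1 ≤ k - 1)

/-- The operation `⊖` on triples. -/
def tripSub (p d : ℕ) (x y : Trip p d) : Trip p d :=
  (x.1 - y.1, x.2.1 ⊔ y.2.1, x.2.2 - y.2.2)

/-- The operation `⊕` on triples. -/
def tripAdd (p d : ℕ) (x y : Trip p d) : Trip p d :=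
  (x.1 + y.1, x.2.1 ⊔ y.2.1, x.2.2 + y.2.2)

/-- The density dependence number of `X` is at most `C`: every fiber of `π` admits a
`C⁻¹`-dense auxiliary bipartite graph. -/
def DDle (p d : ℕ) (A : Matrix (Fin d) (Fin d) (ZMod p)) (X : Set (Trip p d)) (C : ℕ) :
    Prop :=
  ∀ h : Fin d → ZMod p,
    ∃ (Y : Finset ℕ) (E : Trip p d → ℕ → Prop), Y.Nonempty ∧
      (∀ x ∈ X, x.1 = h → Y.card ≤ C * Set.ncard {y : ℕ | y ∈ Y ∧ E x y}) ∧
      (∀ x ∈ X, ∀ x' ∈ X, x.1 = h → x'.1 = h →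
        ∀ y ∈ Y, E x y → E x' y → TripRel p d A x x')

/-- The clique cover number of `X` (with `π` constant on `X`) is at most `C`: `X` can be
partitioned into at most `C` classes of pairwise `∼`-equivalent elements. -/
def CCle (p d : ℕ) (A : Matrix (Fin d) (Fin d) (ZMod p)) (X : Set (Trip p d)) (C : ℕ) :
    Prop :=
  ∃ κ : Trip p d → ℕ, (∀ x ∈ X, κ x < C) ∧
    ∀ x ∈ X, ∀ x' ∈ X, κ x = κ x' → TripRel p d A x x'

namespace BSG

section alg
variable {p d : ℕ} [Fact p.Prime] {A : Matrix (Fin d) (Fin d) (ZMod p)}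

/-- ideal attached to a subspace -/
def J (A : Matrix (Fin d) (Fin d) (ZMod p)) (U : Submodule (ZMod p) (Fin d → ZMod p)) :
    Ideal (MvPolynomial (Fin d) (ZMod p)) := JM p d A (U : Set (Fin d → ZMod p))

/-- ideal of linear forms -/
def L (A : Matrix (Fin d) (Fin d) (ZMod p)) (U : Submodule (ZMod p) (Fin d → ZMod p)) :
    Ideal (MvPolynomial (Fin d) (ZMod p)) :=
  Ideal.span (linPoly p d A '' (U : Set (Fin d → ZMod p)))

/-- linear form to polynomial -/
def lin (l : (Fin d → ZMod p) →ₗ[ZMod p] ZMod p) : MvPolynomial (Fin d) (ZMod p) :=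
  ∑ j : Fin d, C (l (Pi.single j 1)) * X j

/-- the bilinear form -/
def B (A : Matrix (Fin d) (Fin d) (ZMod p)) : LinearMap.BilinForm (ZMod p) (Fin d → ZMod p) :=
  Matrix.toBilin' A

lemma linPoly_eq (h : Fin d → ZMod p) : linPoly p d A h = lin (B A h) := by
  unfold linPoly lin B
  refine Finset.sum_congr rfl fun j _ => ?_
  congr 2
  simp [Matrix.toBilin'_apply, Pi.single_apply]

lemma eval_lin (l : (Fin d → ZMod p) →ₗ[ZMod p] ZMod p) (n : Fin d → ZMod p) :
    eval n (lin l) = l n := by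
  rw [LinearMap.pi_apply_eq_sum_univ l n]
  simp only [lin, map_sum, map_mul, eval_C, eval_X, smul_eq_mul]
  refine Finset.sum_congr rfl fun j _ => ?_
  rw [mul_comm]
  congr 2
  ext i
  simp [Pi.single_apply, eq_comm]

lemma eval_quad (n : Fin d → ZMod p) : eval n (quadPoly p d A) = B A n n := by
  simp only [quadPoly, B, Matrix.toBilin'_apply, map_sum, map_mul, eval_C, eval_X]
  refine Finset.sum_congr rfl fun i _ => Finset.sum_congr rfl fun j _ => by ring

lemma lin_add (l l' : (Fin d → ZMod p) →ₗ[ZMod p] ZMod p) : lin (l + l') = lin l + lin l' := by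
  simp [lin, add_mul, Finset.sum_add_distrib]

lemma lin_smul (c : ZMod p) (l : (Fin d → ZMod p) →ₗ[ZMod p] ZMod p) :
    lin (c • l) = C c * lin l := by
  simp [lin, Finset.mul_sum, mul_assoc]

lemma lin_zero : lin (0 : (Fin d → ZMod p) →ₗ[ZMod p] ZMod p) = 0 := by
  simp [lin]

lemma linPoly_add (h h' : Fin d → ZMod p) :
    linPoly p d A (h + h') = linPoly p d A h + linPoly p d A h' := by
  simp [linPoly_eq, lin_add]

lemma linPoly_smul (c : ZMod p) (h : Fin d → ZMod p) :
    linPoly p d A (c • h) = C c * linPoly p d A h := by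
  simp [linPoly_eq, lin_smul]

lemma J_eq (U : Submodule (ZMod p) (Fin d → ZMod p)) :
    J A U = Ideal.span {quadPoly p d A} ⊔ L A U := by
  unfold J JM L
  exact Ideal.span_union _ _

lemma L_mono {U U' : Submodule (ZMod p) (Fin d → ZMod p)} (h : U ≤ U') : L A U ≤ L A U' :=
  Ideal.span_mono (Set.image_mono h)

lemma J_mono {U U' : Submodule (ZMod p) (Fin d → ZMod p)} (h : U ≤ U') : J A U ≤ J A U' := by
  rw [J_eq, J_eq]; exact sup_le_sup_left (L_mono h) _

lemma L_sup (U U' : Submodule (ZMod p) (Fin d → ZMod p)) : L A (U ⊔ U') = L A U ⊔ L A U' := by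
  apply le_antisymm
  · refine Ideal.span_le.2 ?_
    rintro _ ⟨x, hx, rfl⟩
    obtain ⟨y, hy, z, hz, rfl⟩ := Submodule.mem_sup.1 hx
    rw [linPoly_add]
    exact add_mem (Ideal.mem_sup_left (Ideal.subset_span ⟨y, hy, rfl⟩))
      (Ideal.mem_sup_right (Ideal.subset_span ⟨z, hz, rfl⟩))
  · exact sup_le (L_mono le_sup_left) (L_mono le_sup_right)

lemma L_span (k : Fin d → ZMod p) : L A (Submodule.span (ZMod p) {k}) =
    Ideal.span {linPoly p d A k} := by
  apply le_antisymm
  · refine Ideal.span_le.2 ?_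
    rintro _ ⟨x, hx, rfl⟩
    obtain ⟨c, rfl⟩ := Submodule.mem_span_singleton.1 hx
    rw [linPoly_smul]
    exact Ideal.mul_mem_left _ _ (Ideal.subset_span rfl)
  · refine Ideal.span_le.2 ?_
    rintro _ rfl
    exact Ideal.subset_span ⟨k, Submodule.mem_span_singleton_self k, rfl⟩

lemma J_sup (U U' : Submodule (ZMod p) (Fin d → ZMod p)) : J A (U ⊔ U') = J A U ⊔ J A U' := by
  rw [J_eq, J_eq, J_eq, L_sup]
  rw [sup_sup_sup_comm, sup_idem]

lemma J_sup_span (U : Submodule (ZMod p) (Fin d → ZMod p)) (k : Fin d → ZMod p) :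
    J A (U ⊔ Submodule.span (ZMod p) {k}) = J A U ⊔ Ideal.span {linPoly p d A k} := by
  rw [J_eq, J_eq, L_sup, L_span, sup_assoc]

/-- standing assumptions on the matrix -/
structure Good (A : Matrix (Fin d) (Fin d) (ZMod p)) : Prop where
  symm : A.IsSymm
  det : A.det ≠ 0
  two : p ≠ 2
  dim : 15 ≤ d

lemma Good.nondeg (hA : Good A) : (B A).Nondegenerate :=
  LinearMap.BilinForm.nondegenerate_toBilin'_of_det_ne_zero' A hA.det

lemma Good.isSymm (hA : Good A) (x y : Fin d → ZMod p) : B A x y = B A y x := by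
  simp only [B, Matrix.toBilin'_apply]
  rw [Finset.sum_comm]
  refine Finset.sum_congr rfl fun i _ => Finset.sum_congr rfl fun j _ => ?_
  rw [hA.symm.apply i j]; ring

lemma Good.refl (hA : Good A) : (B A).IsRefl := fun x y h => by rw [hA.isSymm]; exact h

lemma eval_L {U : Submodule (ZMod p) (Fin d → ZMod p)} {n : Fin d → ZMod p}
    (hn : n ∈ (B A).orthogonal U) {f} (hf : f ∈ L A U) : eval n f = 0 := by
  have : L A U ≤ RingHom.ker (eval n) := by
    refine Ideal.span_le.2 ?_
    rintro _ ⟨x, hx, rfl⟩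
    simp only [SetLike.mem_coe, RingHom.mem_ker, linPoly_eq, eval_lin]
    exact hn x hx
  exact this hf

lemma linPoly_notMem (hA : Good A) {U : Submodule (ZMod p) (Fin d → ZMod p)} {k : Fin d → ZMod p}
    (hk : k ∉ U) : linPoly p d A k ∉ L A U := by
  intro h
  apply hk
  rw [← LinearMap.BilinForm.orthogonal_orthogonal hA.nondeg hA.refl U]
  intro n hn
  have := eval_L hn h
  rw [linPoly_eq, eval_lin] at this
  show B A n k = 0
  rw [hA.isSymm, this]

lemma quad_notMem (hA : Good A) {U : Submodule (ZMod p) (Fin d → ZMod p)}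
    (hU : Module.finrank (ZMod p) U ≤ 7) : quadPoly p d A ∉ L A U := by
  intro h
  set T := (B A).orthogonal U with hT
  have h1 : Module.finrank (ZMod p) T = d - Module.finrank (ZMod p) U := by
    rw [hT, LinearMap.BilinForm.finrank_orthogonal hA.nondeg]; simp
  have h2 : Module.finrank (ZMod p) ((B A).orthogonal T) = d - Module.finrank (ZMod p) T := by
    rw [LinearMap.BilinForm.finrank_orthogonal hA.nondeg]; simp
  have hq : ∀ n ∈ T, B A n n = 0 := fun n hn => by
    rw [← eval_quad]; exact eval_L hn h
  have h3 : T ≤ (B A).orthogonal T := by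
    intro x hx y hy
    show B A y x = 0
    have e := hq (y + x) (add_mem hy hx)
    simp only [map_add, LinearMap.add_apply, hq x hx, hq y hy, hA.isSymm x y] at e
    have h2 : (2 : ZMod p) ≠ 0 := by
      have := hA.two
      intro h0
      have h0' : ((2 : ℕ) : ZMod p) = 0 := by exact_mod_cast h0
      rw [ZMod.natCast_eq_zero_iff] at h0'
      exact this ((Nat.prime_dvd_prime_iff_eq Fact.out Nat.prime_two).1 h0')
    have : 2 * B A y x = 0 := by linear_combination e
    exact (mul_eq_zero.1 this).resolve_left h2
  have h4 := Submodule.finrank_mono h3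
  have := hA.dim
  omega

lemma L_prime (hA : Good A) (U : Submodule (ZMod p) (Fin d → ZMod p)) : (L A U).IsPrime := by
  set T := (B A).orthogonal U with hT
  obtain ⟨q, hq⟩ := T.subtype.exists_leftInverse_of_injective (by simp)
  set P : (Fin d → ZMod p) →ₗ[ZMod p] (Fin d → ZMod p) := T.subtype ∘ₗ q with hP
  have hPT : ∀ n, P n ∈ T := fun n => (q n).2
  have hPid : ∀ n ∈ T, P n = n := fun n hn => by
    have := LinearMap.congr_fun hq ⟨n, hn⟩
    simp only [LinearMap.comp_apply, Submodule.subtype_apply, LinearMap.id_apply] at this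
    simp [hP, this]
  let φ : MvPolynomial (Fin d) (ZMod p) →ₐ[ZMod p] MvPolynomial (Fin d) (ZMod p) :=
    aeval (fun i => lin (LinearMap.proj i ∘ₗ P))
  have hφ : ∀ l, φ (lin l) = lin (l ∘ₗ P) := by
    intro l
    have e : l ∘ₗ P = ∑ j, l (Pi.single j 1) • (LinearMap.proj j ∘ₗ P) := by
      ext i
      simp only [LinearMap.comp_apply]
      rw [LinearMap.pi_apply_eq_sum_univ l]
      simp only [LinearMap.sum_apply, LinearMap.smul_apply, LinearMap.comp_apply,
        LinearMap.proj_apply, smul_eq_mul]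
      refine Finset.sum_congr rfl fun j _ => ?_
      rw [mul_comm]
      congr 2
      ext i
      simp [Pi.single_apply, eq_comm]
    have hs : ∀ s : Finset (Fin d), lin (∑ j ∈ s, l (Pi.single j 1) • (LinearMap.proj j ∘ₗ P))
        = ∑ j ∈ s, C (l (Pi.single j 1)) * lin (LinearMap.proj j ∘ₗ P) := by
      intro s
      induction s using Finset.induction_on with
      | empty => simp [lin_zero]
      | insert a s ha ih => rw [Finset.sum_insert ha, Finset.sum_insert ha, lin_add, ih, lin_smul]
    rw [e, hs]
    simp only [lin, map_sum, map_mul, φ, aeval_X, algHom_C]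
    rfl
  have hX : ∀ i, (X i : MvPolynomial (Fin d) (ZMod p)) - φ (X i) ∈ L A U := by
    intro i
    have h0 : (X i : MvPolynomial (Fin d) (ZMod p)) = lin (LinearMap.proj i) := by
      simp only [lin, LinearMap.proj_apply]
      rw [Finset.sum_eq_single i]
      · simp
      · intro j _ hj; simp [Pi.single_apply, hj.symm]
      · simp
    set g : Module.Dual (ZMod p) (Fin d → ZMod p) := LinearMap.proj i - LinearMap.proj i ∘ₗ P with hg
    set h := ((B A).toDual hA.nondeg).symm g with hh
    have hB : B A h = g := by
      refine LinearMap.ext fun v => ?_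
      simp [hh]
    have hgl : (X i : MvPolynomial (Fin d) (ZMod p)) - φ (X i) = linPoly p d A h := by
      rw [linPoly_eq, hB, sub_eq_iff_eq_add]
      have : φ (X i) = lin (LinearMap.proj i ∘ₗ P) := by simp [φ]
      rw [this, ← lin_add, hg, sub_add_cancel, h0]
    rw [hgl]
    refine Ideal.subset_span ⟨h, ?_, rfl⟩
    rw [SetLike.mem_coe, ← LinearMap.BilinForm.orthogonal_orthogonal hA.nondeg hA.refl U]
    intro n hn
    show B A n h = 0
    rw [hA.isSymm, hB]
    simp [hg, hPid n hn]
  have hdiff : ∀ f, f - φ f ∈ L A U := by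
    intro f
    have : (Ideal.Quotient.mkₐ (ZMod p) (L A U)) = (Ideal.Quotient.mkₐ (ZMod p) (L A U)).comp φ := by
      apply MvPolynomial.algHom_ext
      intro i
      exact (Ideal.Quotient.mk_eq_mk_iff_sub_mem _ _).2 (hX i)
    exact (Ideal.Quotient.mk_eq_mk_iff_sub_mem _ _).1 (AlgHom.congr_fun this f)
  have hker : L A U = RingHom.ker φ := by
    apply le_antisymm
    · refine Ideal.span_le.2 ?_
      rintro _ ⟨x, hx, rfl⟩
      simp only [SetLike.mem_coe, RingHom.mem_ker, linPoly_eq, hφ]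
      rw [show (B A) x ∘ₗ P = 0 from LinearMap.ext fun n => (hPT n) x hx, lin_zero]
    · intro f hf
      have h1 := hdiff f
      rwa [(RingHom.mem_ker).1 hf, sub_zero] at h1
  rw [hker]
  exact RingHom.ker_isPrime _

lemma regular (hA : Good A) {U : Submodule (ZMod p) (Fin d → ZMod p)} {k : Fin d → ZMod p}
    (hk : k ∉ U) (hU : Module.finrank (ZMod p) ↥(U ⊔ Submodule.span (ZMod p) {k}) ≤ 7)
    {g : MvPolynomial (Fin d) (ZMod p)} (hg : g * linPoly p d A k ∈ J A U) : g ∈ J A U := by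
  rw [J_eq] at hg ⊢
  obtain ⟨x, hx, u, hu, he⟩ := Submodule.mem_sup.1 hg
  obtain ⟨a, rfl⟩ := Ideal.mem_span_singleton'.1 hx
  have h1 : a * quadPoly p d A ∈ L A (U ⊔ Submodule.span (ZMod p) {k}) := by
    rw [L_sup, L_span]
    have : a * quadPoly p d A = -u + g * linPoly p d A k := by rw [← he]; ring
    rw [this]
    exact add_mem (Ideal.mem_sup_left (neg_mem hu))
      (Ideal.mem_sup_right (Ideal.mul_mem_left _ _ (Ideal.mem_span_singleton_self _)))
  have h2 := ((L_prime hA _).mem_or_mem h1).resolve_right (quad_notMem hA hU)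
  rw [L_sup, L_span] at h2
  obtain ⟨u', hu', y, hy, rfl⟩ := Submodule.mem_sup.1 h2
  obtain ⟨a', rfl⟩ := Ideal.mem_span_singleton'.1 hy
  have h3 : (g - a' * quadPoly p d A) * linPoly p d A k ∈ L A U := by
    have : (g - a' * quadPoly p d A) * linPoly p d A k = u + quadPoly p d A * u' := by
      linear_combination -he
    rw [this]
    exact add_mem hu (Ideal.mul_mem_left _ _ hu')
  have h4 := ((L_prime hA _).mem_or_mem h3).resolve_right (linPoly_notMem hA hk)
  have : g = a' * quadPoly p d A + (g - a' * quadPoly p d A) := by ring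
  rw [this]
  exact add_mem (Ideal.mem_sup_left (Ideal.mul_mem_left _ _ (Ideal.mem_span_singleton_self _)))
    (Ideal.mem_sup_right h4)

lemma finrank_sup_span_le (U : Submodule (ZMod p) (Fin d → ZMod p)) (k : Fin d → ZMod p) :
    Module.finrank (ZMod p) ↥(U ⊔ Submodule.span (ZMod p) {k}) ≤ Module.finrank (ZMod p) U + 1 := by
  refine (Submodule.finrank_add_le_finrank_add_finrank _ _).trans ?_
  gcongr
  exact (finrank_span_le_card _).trans (by simp)

lemma div_lemma (hA : Good A) {ι : Type*} {U : Submodule (ZMod p) (Fin d → ZMod p)}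
    (hU : Module.finrank (ZMod p) U ≤ 5) (t : ι → Fin d → ZMod p) (s : Finset ι)
    (ht : ∀ i ∈ s, ∀ j ∈ s, i ≠ j → t j ∉ U ⊔ Submodule.span (ZMod p) {t i})
    (f : MvPolynomial (Fin d) (ZMod p))
    (hf : ∀ i ∈ s, f ∈ J A (U ⊔ Submodule.span (ZMod p) {t i})) :
    f ∈ J A U ⊔ Ideal.span {∏ i ∈ s, linPoly p d A (t i)} := by
  classical
  induction s using Finset.induction_on with
  | empty => simp
  | insert a s ha ih =>
    have h1 := ih (fun i hi j hj => ht i (Finset.mem_insert_of_mem hi) j (Finset.mem_insert_of_mem hj))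
      (fun i hi => hf i (Finset.mem_insert_of_mem hi))
    obtain ⟨j, hj, y, hy, rfl⟩ := Submodule.mem_sup.1 h1
    obtain ⟨c, rfl⟩ := Ideal.mem_span_singleton'.1 hy
    have h2 := hf a (Finset.mem_insert_self _ _)
    have h3 : c * ∏ i ∈ s, linPoly p d A (t i) ∈ J A (U ⊔ Submodule.span (ZMod p) {t a}) := by
      have := sub_mem h2 (J_mono (A := A) (le_sup_left : U ≤ U ⊔ Submodule.span (ZMod p) {t a}) hj)
      simpa using this
    have h4 : ∀ s' ⊆ s, ∀ c, c * ∏ i ∈ s', linPoly p d A (t i) ∈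
        J A (U ⊔ Submodule.span (ZMod p) {t a}) → c ∈ J A (U ⊔ Submodule.span (ZMod p) {t a}) := by
      intro s'
      induction s' using Finset.induction_on with
      | empty => simp
      | insert b s' hb ih' =>
        intro hs c hc
        rw [Finset.prod_insert hb, ← mul_assoc] at hc
        have := ih' (fun x hx => hs (Finset.mem_insert_of_mem hx)) _ hc
        have hbs := hs (Finset.mem_insert_self _ _)
        refine regular hA (ht a (Finset.mem_insert_self _ _) b (Finset.mem_insert_of_mem hbs)
          (by rintro rfl; exact ha hbs)) ?_ this
        have e1 := finrank_sup_span_le (U ⊔ Submodule.span (ZMod p) {t a}) (t b)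
        have e2 := finrank_sup_span_le U (t a)
        omega
    have h5 := h4 s subset_rfl c h3
    rw [J_sup_span] at h5
    obtain ⟨j', hj', y', hy', rfl⟩ := Submodule.mem_sup.1 h5
    obtain ⟨c', rfl⟩ := Ideal.mem_span_singleton'.1 hy'
    rw [Finset.prod_insert ha]
    have : j + (j' + c' * linPoly p d A (t a)) * ∏ i ∈ s, linPoly p d A (t i) =
      (j + (∏ i ∈ s, linPoly p d A (t i)) * j') +
        c' * (linPoly p d A (t a) * ∏ i ∈ s, linPoly p d A (t i)) := by ring
    rw [this]
    exact add_mem (Ideal.mem_sup_left (add_mem hj (Ideal.mul_mem_left _ _ hj')))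
      (Ideal.mem_sup_right (Ideal.mul_mem_left _ _ (Ideal.mem_span_singleton_self _)))

lemma linPoly_hom (h : Fin d → ZMod p) : (linPoly p d A h).IsHomogeneous 1 := by
  unfold linPoly
  refine MvPolynomial.IsHomogeneous.sum _ _ _ fun j _ => ?_
  exact (isHomogeneous_X (ZMod p) j).C_mul _

lemma quad_hom : (quadPoly p d A).IsHomogeneous 2 := by
  unfold quadPoly
  refine MvPolynomial.IsHomogeneous.sum _ _ _ fun i _ =>
    MvPolynomial.IsHomogeneous.sum _ _ _ fun j _ => ?_
  exact ((isHomogeneous_X (ZMod p) i).mul (isHomogeneous_X (ZMod p) j)).C_mul _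

lemma comp_mem_gen {σ R : Type*} [CommRing R] (T : Set (MvPolynomial σ R))
    (hT : ∀ x ∈ T, ∃ n : ℕ, x.IsHomogeneous n) {f : MvPolynomial σ R}
    (hf : f ∈ Ideal.span T) (s : ℕ) : homogeneousComponent s f ∈ Ideal.span T := by
  letI := MvPolynomial.gradedAlgebra (σ := σ) (R := R)
  have hh : (Ideal.span T).IsHomogeneous (homogeneousSubmodule σ R) := by
    refine Ideal.homogeneous_span _ _ ?_
    intro x hx
    exact hT x hx
  have := hh s hf
  rw [← decomposition.decompose'_apply]
  exact this

lemma comp_mem {U : Submodule (ZMod p) (Fin d → ZMod p)} {f : MvPolynomial (Fin d) (ZMod p)}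
    (hf : f ∈ J A U) (s : ℕ) : homogeneousComponent s f ∈ J A U := by
  refine comp_mem_gen _ ?_ hf s
  rintro x (hx | ⟨h, -, rfl⟩)
  · rw [Set.mem_singleton_iff.1 hx]
    exact ⟨2, quad_hom⟩
  · exact ⟨1, linPoly_hom h⟩

lemma elim (hA : Good A) {ι : Type*} {U : Submodule (ZMod p) (Fin d → ZMod p)}
    (hU : Module.finrank (ZMod p) U ≤ 5) (t : ι → Fin d → ZMod p) (S : Finset ι)
    (ht : ∀ i ∈ S, ∀ j ∈ S, i ≠ j → t j ∉ U ⊔ Submodule.span (ZMod p) {t i})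
    {s : ℕ} (hS : s + 1 ≤ S.card)
    {f : MvPolynomial (Fin d) (ZMod p)} (hfs : f.IsHomogeneous s)
    (hf : ∀ i ∈ S, f ∈ J A (U ⊔ Submodule.span (ZMod p) {t i})) : f ∈ J A U := by
  obtain ⟨j, hj, y, hy, rfl⟩ := Submodule.mem_sup.1 (div_lemma hA hU t S ht f hf)
  obtain ⟨c, rfl⟩ := Ideal.mem_span_singleton'.1 hy
  have h1 : homogeneousComponent s (c * ∏ i ∈ S, linPoly p d A (t i)) = 0 := by
    have hP : (∏ i ∈ S, linPoly p d A (t i)).IsHomogeneous S.card := by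
      have := MvPolynomial.IsHomogeneous.prod S (fun i => linPoly p d A (t i)) (fun _ => 1)
        (fun i _ => linPoly_hom (t i))
      simpa using this
    have hc : c * ∏ i ∈ S, linPoly p d A (t i) =
        ∑ m ∈ Finset.range (c.totalDegree + 1),
          homogeneousComponent m c * ∏ i ∈ S, linPoly p d A (t i) := by
      rw [← Finset.sum_mul, sum_homogeneousComponent]
    rw [hc, map_sum]
    refine Finset.sum_eq_zero fun m _ => ?_
    rw [homogeneousComponent_of_mem ((homogeneousComponent_isHomogeneous m c).mul hP)]
    rw [if_neg (by omega)]
  have h2 : homogeneousComponent s (j + c * ∏ i ∈ S, linPoly p d A (t i)) =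
      j + c * ∏ i ∈ S, linPoly p d A (t i) := by
    rw [homogeneousComponent_of_mem hfs, if_pos rfl]
  rw [← h2, map_add, h1, add_zero]
  exact comp_mem hj s

end alg
end BSG

namespace BSG

section alg2
variable {p d : ℕ} [Fact p.Prime] {A : Matrix (Fin d) (Fin d) (ZMod p)}

lemma extract {ι : Type*} [Finite ι] (t : ι → Fin d → ZMod p)
    (U : Submodule (ZMod p) (Fin d → ZMod p)) (n : ℕ)
    (h : Module.finrank (ZMod p) U + n ≤
      Module.finrank (ZMod p) (Submodule.span (ZMod p) (Set.range t))) :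
    ∃ S : Finset ι, n ≤ S.card ∧
      n ≤ Module.finrank (ZMod p) (Submodule.span (ZMod p) (Set.range fun i : S => t i)) ∧
      ∀ T : Set ι, T ⊆ S → ∀ j ∈ S, j ∉ T → t j ∉ U ⊔ Submodule.span (ZMod p) (t '' T) := by
  classical
  have := Fintype.ofFinite ι
  obtain ⟨κ, a, ha, hsp, hli⟩ := exists_linearIndependent' (ZMod p) (fun i => U.mkQ (t i))
  have : Finite κ := Finite.of_injective a ha
  have := Fintype.ofFinite κ
  have hcard : n ≤ Fintype.card κ := by
    have h1 := finrank_span_eq_card hli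
    rw [hsp] at h1
    have h2 : Submodule.span (ZMod p) (Set.range fun i => U.mkQ (t i)) =
        (Submodule.span (ZMod p) (Set.range t)).map U.mkQ := by
      rw [Submodule.map_span, ← Set.range_comp]; rfl
    set W := Submodule.span (ZMod p) (Set.range t) with hW
    have h3 := LinearMap.finrank_range_add_finrank_ker (U.mkQ.domRestrict W)
    rw [LinearMap.range_domRestrict] at h3
    have h4 : Module.finrank (ZMod p) (LinearMap.ker (U.mkQ.domRestrict W)) ≤
        Module.finrank (ZMod p) U := by
      refine LinearMap.finrank_le_finrank_of_injective
        (f := LinearMap.codRestrict U (W.subtype ∘ₗ (LinearMap.ker (U.mkQ.domRestrict W)).subtype)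
          (fun x => by
            have := x.2
            rw [LinearMap.mem_ker, LinearMap.domRestrict_apply, Submodule.mkQ_apply,
              Submodule.Quotient.mk_eq_zero] at this
            exact this)) ?_
      intro x y hxy
      have := congrArg Subtype.val hxy
      exact Subtype.ext (Subtype.ext this)
    rw [h2] at h1
    omega
  refine ⟨Finset.univ.image a, ?_, ?_, ?_⟩
  · rw [Finset.card_image_of_injective _ ha]; simpa using hcard
  · have hli' : LinearIndependent (ZMod p) (t ∘ a) :=
      LinearIndependent.of_comp U.mkQ hli
    have h1 := finrank_span_eq_card hli'
    refine hcard.trans (h1.symm.le.trans (Submodule.finrank_mono (Submodule.span_mono ?_)))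
    rintro _ ⟨x, rfl⟩
    exact ⟨⟨a x, by simp⟩, rfl⟩
  · intro T hT j hj hjT hmem
    obtain ⟨x, -, rfl⟩ := Finset.mem_image.1 hj
    refine hli.notMem_span_image (s := a ⁻¹' T) (x := x) hjT ?_
    obtain ⟨u, hu, w, hw, hs⟩ := Submodule.mem_sup.1 hmem
    have e : U.mkQ (t (a x)) = U.mkQ w := by
      rw [← hs, map_add]
      simp [hu]
    show U.mkQ (t (a x)) ∈ _
    rw [e]
    have := Submodule.mem_map_of_mem (f := U.mkQ) hw
    rw [Submodule.map_span] at this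
    refine Submodule.span_mono ?_ this
    rintro _ ⟨_, ⟨i, hi, rfl⟩, rfl⟩
    obtain ⟨y, -, rfl⟩ := Finset.mem_image.1 (hT hi)
    exact ⟨y, hi, rfl⟩

lemma elim_gen (hA : Good A) {ι : Type*} [Finite ι] {U : Submodule (ZMod p) (Fin d → ZMod p)}
    (hU : Module.finrank (ZMod p) U ≤ 5) (t : ι → Fin d → ZMod p) {s : ℕ}
    (ht : Module.finrank (ZMod p) U + (s + 1) ≤
      Module.finrank (ZMod p) (Submodule.span (ZMod p) (Set.range t)))
    {f : MvPolynomial (Fin d) (ZMod p)} (hfs : f.IsHomogeneous s)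
    (hf : ∀ i, f ∈ J A (U ⊔ Submodule.span (ZMod p) {t i})) : f ∈ J A U := by
  obtain ⟨S, hS, -, hind⟩ := extract t U (s + 1) ht
  refine elim hA hU t S ?_ hS hfs (fun i _ => hf i)
  intro i hi j hj hij
  have := hind {i} (by simpa using hi) j hj (by simpa using hij.symm)
  simpa using this

lemma elim_li (hA : Good A) {U : Submodule (ZMod p) (Fin d → ZMod p)}
    (hU : Module.finrank (ZMod p) U ≤ 5) {s : ℕ} {t : Fin (s + 6) → Fin d → ZMod p}
    (ht : LinearIndependent (ZMod p) t)
    {f : MvPolynomial (Fin d) (ZMod p)} (hfs : f.IsHomogeneous s)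
    (hf : ∀ i, f ∈ J A (U ⊔ Submodule.span (ZMod p) {t i})) : f ∈ J A U := by
  refine elim_gen hA hU t ?_ hfs hf
  rw [finrank_span_eq_card ht, Fintype.card_fin]
  omega

lemma glue (hA : Good A) {s : ℕ} (hds : 2 * s + 15 ≤ d) (k : Fin d → ZMod p)
    (S : Set (Fin d → ZMod p)) (hS : Submodule.span (ZMod p) S = ⊤)
    (g : (Fin d → ZMod p) → MvPolynomial (Fin d) (ZMod p))
    (hg : ∀ a ∈ S, (g a).IsHomogeneous s)
    (hcl : ∀ a ∈ S, ∀ b ∈ S, g a - g b ∈ J A (Submodule.span (ZMod p) {k} ⊔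
      Submodule.span (ZMod p) {a} ⊔ Submodule.span (ZMod p) {b})) :
    ∃ Φ : MvPolynomial (Fin d) (ZMod p), ∀ a ∈ S,
      g a - Φ ∈ J A (Submodule.span (ZMod p) {k} ⊔ Submodule.span (ZMod p) {a}) := by
  classical
  have hk1 : Module.finrank (ZMod p) (Submodule.span (ZMod p) {k}) ≤ 1 :=
    (finrank_span_le_card _).trans (by simp)
  obtain ⟨T, hT, hTr, hind⟩ := extract (fun x : S => (x : Fin d → ZMod p))
    (Submodule.span (ZMod p) {k}) (s + 3) (by
      rw [Subtype.range_coe, hS, finrank_top, Module.finrank_fin_fun]; omega)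
  have key : ∀ T' ⊆ T, ∃ F, ∀ i ∈ T', g i - F ∈
      J A (Submodule.span (ZMod p) {k} ⊔ Submodule.span (ZMod p) {(i : Fin d → ZMod p)}) := by
    intro T'
    induction T' using Finset.induction_on with
    | empty => intro _; exact ⟨0, by simp⟩
    | insert a T' ha ih =>
      intro hsub
      have haT := hsub (Finset.mem_insert_self _ _)
      have hT'T : ∀ i ∈ T', i ∈ T := fun i hi => hsub (Finset.mem_insert_of_mem hi)
      obtain ⟨F, hF⟩ := ih hT'T
      have hU := finrank_sup_span_le (Submodule.span (ZMod p) {k}) (a : Fin d → ZMod p)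
      have h1 := div_lemma hA (U := Submodule.span (ZMod p) {k} ⊔
        Submodule.span (ZMod p) {(a : Fin d → ZMod p)}) (by omega)
        (fun x : S => (x : Fin d → ZMod p)) T' ?_ (g a - F) ?_
      · obtain ⟨x, hx, y, hy, he⟩ := Submodule.mem_sup.1 h1
        obtain ⟨c, rfl⟩ := Ideal.mem_span_singleton'.1 hy
        refine ⟨F + c * ∏ i ∈ T', linPoly p d A i, ?_⟩
        intro i hi
        rcases Finset.mem_insert.1 hi with rfl | hi
        · have : g i - (F + c * ∏ i ∈ T', linPoly p d A i) = x := by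
            linear_combination -he
          rw [this]; exact hx
        · rw [← sub_sub]
          refine sub_mem (hF i hi) ?_
          rw [J_sup_span]
          refine Ideal.mem_sup_right ?_
          rw [Ideal.mem_span_singleton]
          exact (Finset.dvd_prod_of_mem (fun i : S => linPoly p d A i) hi).mul_left c
      · intro i hi j hj hij
        have := hind {a, i} (by
          intro x hx
          rcases hx with rfl | hx
          · exact haT
          · rw [hx]; exact hT'T i hi) j (hT'T j hj) (by
            rintro (h | h)
            · exact ha (h ▸ hj)
            · exact hij (by rw [h]))
        rw [Set.image_pair, Submodule.span_insert, ← sup_assoc] at this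
        exact this
      · intro i hi
        have e : g a - F = (g a - g i) + (g i - F) := by ring
        rw [e]
        refine add_mem (hcl a a.2 i i.2) (J_mono ?_ (hF i hi))
        exact sup_le_sup_right le_sup_left _
  obtain ⟨F, hF⟩ := key T subset_rfl
  refine ⟨homogeneousComponent s F, ?_⟩
  have hF' : ∀ i ∈ T, g i - homogeneousComponent s F ∈
      J A (Submodule.span (ZMod p) {k} ⊔ Submodule.span (ZMod p) {(i : Fin d → ZMod p)}) := by
    intro i hi
    have := comp_mem (hF i hi) s
    rwa [map_sub, homogeneousComponent_of_mem (hg i i.2), if_pos rfl] at this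
  intro a ha
  have hU := finrank_sup_span_le (Submodule.span (ZMod p) {k}) (a : Fin d → ZMod p)
  refine elim_gen hA (by omega) (fun i : T => ((i : S) : Fin d → ZMod p)) (s := s) (by omega)
    ((hg a ha).sub (homogeneousComponent_isHomogeneous s F)) ?_
  intro i
  have e : g a - homogeneousComponent s F = (g a - g i) + (g i - homogeneousComponent s F) := by ring
  rw [e]
  refine add_mem (hcl a ha i i.1.2) (J_mono ?_ (hF' i i.2))
  exact sup_le_sup_right le_sup_left _

end alg2
end BSG

namespace BSG

section counting

open Classical in
/-- number of elements satisfying `P` -/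
def cnt {α : Type*} [Fintype α] (P : α → Prop) : ℝ := ∑ x, if P x then (1 : ℝ) else 0

variable {α β γ : Type*} [Fintype α] [Fintype β] [Fintype γ]

lemma cnt_nonneg (P : α → Prop) : 0 ≤ cnt P := by
  classical
  exact Finset.sum_nonneg fun x _ => by split_ifs <;> norm_num

lemma cnt_mono {P Q : α → Prop} (h : ∀ x, P x → Q x) : cnt P ≤ cnt Q := by
  classical
  refine Finset.sum_le_sum fun x _ => ?_
  by_cases hp : P x
  · simp [hp, h x hp]
  · simp only [hp, if_false]; split_ifs <;> norm_num

lemma cnt_true : cnt (fun _ : α => True) = Fintype.card α := by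
  simp [cnt]

lemma cnt_le (P : α → Prop) : cnt P ≤ Fintype.card α := by
  rw [← cnt_true]; exact cnt_mono (fun _ _ => trivial)

lemma cnt_eq_card (P : α → Prop) [DecidablePred P] :
    cnt P = ((Finset.univ.filter P).card : ℝ) := by
  classical
  rw [Finset.card_filter]
  push_cast
  unfold cnt
  refine Finset.sum_congr rfl fun x _ => ?_
  by_cases hp : P x <;> simp [hp]

lemma cnt_eq_ncard (P : α → Prop) : cnt P = (Set.ncard {x | P x} : ℝ) := by
  classical
  rw [cnt_eq_card, Set.ncard_eq_toFinset_card']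
  congr 2
  ext; simp

lemma cnt_or (P Q : α → Prop) : cnt (fun x => P x ∨ Q x) ≤ cnt P + cnt Q := by
  classical
  unfold cnt
  rw [← Finset.sum_add_distrib]
  refine Finset.sum_le_sum fun x _ => ?_
  by_cases hp : P x <;> by_cases hq : Q x <;> simp [hp, hq]

lemma cnt_prod (P : α × β → Prop) : cnt P = ∑ x, cnt (fun y => P (x, y)) := by
  classical
  unfold cnt
  rw [Fintype.sum_prod_type]

lemma cnt_prod_right (P : α × β → Prop) : cnt P = ∑ y, cnt (fun x => P (x, y)) := by
  classical
  unfold cnt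
  rw [Fintype.sum_prod_type_right]

lemma cnt_equiv (e : α ≃ β) (P : β → Prop) : cnt (fun x => P (e x)) = cnt P := by
  classical
  unfold cnt
  exact Fintype.sum_equiv e _ _ (fun _ => rfl)

lemma cnt_inj {P : α → Prop} {Q : β → Prop} (f : α → β) (hf : ∀ x, P x → Q (f x))
    (hinj : ∀ x y, P x → P y → f x = f y → x = y) : cnt P ≤ cnt Q := by
  classical
  rw [cnt_eq_card, cnt_eq_card]
  exact_mod_cast Finset.card_le_card_of_injOn f (by intro x hx; simpa using hf x (by simpa using hx))
    (by intro x hx y hy h; exact hinj x y (by simpa using hx) (by simpa using hy) h)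

lemma cnt_and (P : α → Prop) (Q : β → Prop) :
    cnt (fun q : α × β => P q.1 ∧ Q q.2) = cnt P * cnt Q := by
  classical
  unfold cnt
  rw [Fintype.sum_prod_type, Finset.sum_mul_sum]
  refine Finset.sum_congr rfl fun x _ => Finset.sum_congr rfl fun y _ => ?_
  by_cases hp : P x <;> by_cases hq : Q y <;> simp [hp, hq]

lemma cnt_pi (N : ℕ) (P : α → Prop) : cnt (fun x : Fin N → α => ∀ i, P (x i)) = cnt P ^ N := by
  classical
  rw [cnt_eq_card, cnt_eq_card]
  have : (Finset.univ.filter fun x : Fin N → α => ∀ i, P (x i)) =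
      Fintype.piFinset (fun _ : Fin N => Finset.univ.filter P) := by
    ext x; simp
  rw [this, Fintype.card_piFinset]
  simp

lemma exists_le_of_sum {f : α → ℝ} {c : ℝ} [Nonempty α] (h : c * Fintype.card α ≤ ∑ x, f x) :
    ∃ x, c ≤ f x := by
  by_contra! hc
  have := Finset.sum_lt_sum_of_nonempty (s := Finset.univ) (Finset.univ_nonempty (α := α))
    (fun x _ => hc x)
  simp at this
  nlinarith

lemma cauchy (f : α → ℝ) : (∑ x, f x) ^ 2 ≤ Fintype.card α * ∑ x, f x ^ 2 := by
  have := sq_sum_le_card_mul_sum_sq (s := (Finset.univ : Finset α)) (f := f)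
  simpa using this

lemma cnt_fst (P : α → Prop) : cnt (fun q : α × β => P q.1) = cnt P * Fintype.card β := by
  have := cnt_and (β := β) P (fun _ => True)
  rw [cnt_true] at this
  simpa using this

lemma cnt_snd (P : β → Prop) : cnt (fun q : α × β => P q.2) = Fintype.card α * cnt P := by
  have := cnt_and (α := α) (fun _ => True) P
  rw [cnt_true] at this
  simpa using this

lemma cnt_not (P : α → Prop) : cnt (fun x => ¬ P x) = Fintype.card α - cnt P := by
  classical
  rw [eq_sub_iff_add_eq, ← cnt_true]
  unfold cnt
  rw [← Finset.sum_add_distrib]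
  refine Finset.sum_congr rfl fun x _ => ?_
  by_cases hp : P x <;> simp [hp]

lemma cnt_diff (P Q : α → Prop) : cnt P - cnt (fun x => ¬ Q x) ≤ cnt (fun x => Q x ∧ P x) := by
  have := cnt_or (fun x => Q x ∧ P x) (fun x => ¬ Q x)
  have h2 : cnt P ≤ cnt (fun x => (Q x ∧ P x) ∨ ¬ Q x) := cnt_mono (fun x hx => by tauto)
  linarith

lemma grid1 (N : ℕ) (E : α × β → Prop) {ε : ℝ} (hε : 0 ≤ ε)
    (h : ε * Fintype.card (α × β) ≤ cnt E) :
    ε ^ (N + 1) * Fintype.card ((Fin (N + 1) → α) × β) ≤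
      cnt (fun q : (Fin (N + 1) → α) × β => ∀ i, E (q.1 i, q.2)) := by
  rw [cnt_prod_right]
  have h0 : ∀ y : β, cnt (fun x : Fin (N + 1) → α => ∀ i, E (x i, y)) =
      cnt (fun a => E (a, y)) ^ (N + 1) := fun y => cnt_pi (N + 1) (fun a => E (a, y))
  simp only [h0]
  rw [cnt_prod_right] at h
  rcases isEmpty_or_nonempty β with hb | hb
  · simp
  have h1 := pow_sum_div_card_le_sum_pow (s := (Finset.univ : Finset β))
    (f := fun y => cnt (fun a => E (a, y))) (fun y _ => cnt_nonneg _) N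
  refine le_trans ?_ h1
  have hc : (0 : ℝ) < Fintype.card β := by exact_mod_cast Fintype.card_pos
  rw [le_div_iff₀ (by simpa using pow_pos hc N)]
  have h2 := pow_le_pow_left₀ (by positivity) h (N + 1)
  refine le_trans (le_of_eq ?_) h2
  simp only [Fintype.card_prod, Fintype.card_pi, Finset.prod_const, Finset.card_univ,
    Fintype.card_fin]
  push_cast
  ring

end counting

section dep
variable {p d : ℕ} [Fact p.Prime]

lemma card_V : Fintype.card (Fin d → ZMod p) = p ^ d := by
  simp [ZMod.card]

lemma cnt_dep {N : ℕ} (hN : N + 1 ≤ d) :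
    cnt (fun t : Fin N → Fin d → ZMod p => ¬ LinearIndependent (ZMod p) t) ≤
      N / p * Fintype.card (Fin N → Fin d → ZMod p) := by
  have hp : (0 : ℝ) < p := by exact_mod_cast (Fact.out : p.Prime).pos
  have hp1 : (1 : ℝ) ≤ p := by exact_mod_cast (Fact.out : p.Prime).one_le
  have h := card_linearIndependent (K := ZMod p) (V := Fin d → ZMod p) (k := N)
    (by simp; omega)
  rw [cnt_not, cnt_eq_ncard, ← Nat.card_coe_set_eq]
  change _ - ((Nat.card {t : Fin N → Fin d → ZMod p // LinearIndependent (ZMod p) t} : ℕ) : ℝ) ≤ _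
  rw [h]
  simp only [Module.finrank_fin_fun, ZMod.card]
  rw [Nat.cast_prod]
  have h1 : ∀ i : Fin N, (p : ℝ) ^ d * (1 - 1 / p) ≤ ((p ^ d - p ^ (i : ℕ) : ℕ) : ℝ) := by
    intro i
    have hi : p ^ (i : ℕ) ≤ p ^ d := Nat.pow_le_pow_right (Fact.out : p.Prime).pos (by omega)
    rw [Nat.cast_sub hi]
    push_cast
    have : (p : ℝ) ^ (i : ℕ) ≤ p ^ (d - 1) := pow_le_pow_right₀ hp1 (by omega)
    have h2 : (p : ℝ) ^ d = p ^ (d - 1) * p := by rw [← pow_succ]; congr 1; omega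
    have : (p : ℝ) ^ d * (1 - 1 / p) = p ^ d - p ^ (d - 1) := by
      rw [h2]; field_simp
    linarith
  have hnn : (0 : ℝ) ≤ 1 - 1 / p := by
    rw [sub_nonneg, div_le_one hp]; exact hp1
  have h3 := Finset.prod_le_prod (s := (Finset.univ : Finset (Fin N)))
    (fun i _ => by positivity) (fun i _ => h1 i)
  rw [Finset.prod_const, Finset.card_univ, Fintype.card_fin, mul_pow] at h3
  have h4 := one_add_mul_le_pow (a := -(1 / (p : ℝ))) (by linarith) N
  rw [Fintype.card_pi, Finset.prod_const, Finset.card_univ, Fintype.card_fin, card_V]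
  push_cast at h3 ⊢
  have h5 : (0 : ℝ) ≤ ((p : ℝ) ^ d) ^ N := by positivity
  have h6 : ((p : ℝ) ^ d) ^ N * (1 + N * (-(1 / (p : ℝ)))) ≤ ((p : ℝ) ^ d) ^ N * (1 - 1 / p) ^ N := by
    refine mul_le_mul_of_nonneg_left ?_ h5
    rwa [sub_eq_add_neg]
  have h7 : ((p : ℝ) ^ d) ^ N * (1 + N * (-(1 / (p : ℝ)))) =
     ((p : ℝ) ^ d) ^ N - N / p * ((p : ℝ) ^ d) ^ N := by ring
  linarith

end dep
end BSG

namespace BSG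

section grid
variable {p d : ℕ} [Fact p.Prime] {A : Matrix (Fin d) (Fin d) (ZMod p)}

/-- parameter space of grids -/
abbrev YY (p d N : ℕ) (I : Type) : Type :=
  (Fin N → Fin d → ZMod p) × (Fin N → Fin d → ZMod p) × (Fin N → Fin d → ZMod p) × I

/-- the grid relation -/
def Grid {N : ℕ} {I : Type}
    (E : (Fin d → ZMod p) × (Fin d → ZMod p) × (Fin d → ZMod p) × I → Prop)
    (y : YY p d N I) : Prop :=
  (LinearIndependent (ZMod p) y.1 ∧ LinearIndependent (ZMod p) y.2.1 ∧
    LinearIndependent (ZMod p) y.2.2.1) ∧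
    ∀ l j i, E (y.1 i, y.2.1 j, y.2.2.1 l, y.2.2.2)

/-- swap first two coordinates -/
def sw (α β γ : Type) : α × β × γ ≃ β × α × γ where
  toFun q := (q.2.1, q.1, q.2.2)
  invFun q := (q.2.1, q.1, q.2.2)
  left_inv _ := rfl
  right_inv _ := rfl

/-- move third coordinate first -/
def sw3 (α β γ δ : Type) : α × β × γ × δ ≃ γ × α × β × δ where
  toFun q := (q.2.2.1, q.1, q.2.1, q.2.2.2)
  invFun q := (q.2.1, q.2.2.1, q.1, q.2.2.2)
  left_inv _ := rfl
  right_inv _ := rfl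

/-- reverse coordinates -/
def rev (α β γ δ : Type) : α × β × γ × δ ≃ γ × β × α × δ where
  toFun q := (q.2.2.1, q.2.1, q.1, q.2.2.2)
  invFun q := (q.2.2.1, q.2.1, q.1, q.2.2.2)
  left_inv _ := rfl
  right_inv _ := rfl

lemma grid3 (N : ℕ) {V I : Type} [Fintype V] [Fintype I] (E : V × V × V × I → Prop)
    {ε : ℝ} (hε : 0 ≤ ε) (h : ε * Fintype.card (V × V × V × I) ≤ cnt E) :
    ((ε ^ (N + 1)) ^ (N + 1)) ^ (N + 1) * Fintype.card ((Fin (N + 1) → V) × (Fin (N + 1) → V) ×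
      (Fin (N + 1) → V) × I) ≤ cnt (fun q : (Fin (N + 1) → V) × (Fin (N + 1) → V) ×
      (Fin (N + 1) → V) × I => ∀ l j i, E (q.1 i, q.2.1 j, q.2.2.1 l, q.2.2.2)) := by
  have h1 := grid1 N E hε h
  have h1' : ε ^ (N + 1) * Fintype.card (V × (Fin (N + 1) → V) × V × I) ≤
      cnt (fun q : V × (Fin (N + 1) → V) × V × I => ∀ i, E (q.2.1 i, q.1, q.2.2)) := by
    rw [← Fintype.card_congr (sw (Fin (N + 1) → V) V (V × I))]
    exact h1.trans_eq (cnt_equiv (sw V (Fin (N + 1) → V) (V × I))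
      (fun q => ∀ i, E (q.1 i, q.2))).symm
  have h2 := grid1 N _ (by positivity) h1'
  have h2' : (ε ^ (N + 1)) ^ (N + 1) * Fintype.card (V × (Fin (N + 1) → V) × (Fin (N + 1) → V) × I)
      ≤ cnt (fun q : V × (Fin (N + 1) → V) × (Fin (N + 1) → V) × I =>
        ∀ j i, E (q.2.2.1 i, q.2.1 j, q.1, q.2.2.2)) := by
    rw [← Fintype.card_congr (sw3 (Fin (N + 1) → V) (Fin (N + 1) → V) V I)]
    exact h2.trans_eq (cnt_equiv (sw3 (Fin (N + 1) → V) (Fin (N + 1) → V) V I).symm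
      (fun q => ∀ j i, E (q.2.1 i, q.1 j, q.2.2))).symm
  have h3 := grid1 N _ (by positivity) h2'
  exact h3.trans_eq (cnt_equiv (rev (Fin (N + 1) → V) (Fin (N + 1) → V) (Fin (N + 1) → V) I)
    (fun q => ∀ l j i, E (q.2.2.1 i, q.2.1 j, q.1 l, q.2.2.2))).symm

lemma grid_count {N : ℕ} (hN : N + 2 ≤ d) {I : Type} [Fintype I]
    (E : (Fin d → ZMod p) × (Fin d → ZMod p) × (Fin d → ZMod p) × I → Prop) {ε : ℝ} (hε : 0 ≤ ε)
    (h : ε * Fintype.card ((Fin d → ZMod p) × (Fin d → ZMod p) × (Fin d → ZMod p) × I) ≤ cnt E)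
    (hp : 6 * (N + 1 : ℝ) ≤ ε ^ ((N + 1) ^ 3) * p) :
    ε ^ ((N + 1) ^ 3) / 2 * Fintype.card (YY p d (N + 1) I) ≤
      cnt (Grid (N := N + 1) E) := by
  have hp0 : (0 : ℝ) < p := by exact_mod_cast (Fact.out : p.Prime).pos
  have h3' := grid3 N E hε h
  let T := Fin (N + 1) → Fin d → ZMod p
  have e : ((ε ^ (N + 1)) ^ (N + 1)) ^ (N + 1) = ε ^ ((N + 1) ^ 3) := by
    rw [← pow_mul, ← pow_mul]; congr 1; ring
  rw [e] at h3'
  have hd := cnt_diff (fun q : T × T × T × I => ∀ l j i, E (q.1 i, q.2.1 j, q.2.2.1 l, q.2.2.2))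
    (fun y => LinearIndependent (ZMod p) y.1 ∧ LinearIndependent (ZMod p) y.2.1 ∧
    LinearIndependent (ZMod p) y.2.2.1)
  refine le_trans ?_ hd
  have hdep := cnt_dep (p := p) (d := d) (N := N + 1) (by omega)
  have hb : cnt (fun y : T × T × T × I => ¬ (LinearIndependent (ZMod p) y.1 ∧
      LinearIndependent (ZMod p) y.2.1 ∧ LinearIndependent (ZMod p) y.2.2.1)) ≤
      3 * ((N + 1 : ℕ) / p * Fintype.card (T × T × T × I)) := by
    have a1 : cnt (fun y : T × T × T × I => ¬ LinearIndependent (ZMod p) y.1) ≤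
      ((N + 1 : ℕ) / p * Fintype.card (T × T × T × I)) := by
      rw [cnt_fst (α := T) (β := T × T × I) (fun t => ¬ LinearIndependent (ZMod p) t),
        Fintype.card_prod T (T × T × I), Nat.cast_mul, ← mul_assoc]
      exact mul_le_mul_of_nonneg_right hdep (Nat.cast_nonneg _)
    have a2 : cnt (fun y : T × T × T × I => ¬ LinearIndependent (ZMod p) y.2.1) ≤
      ((N + 1 : ℕ) / p * Fintype.card (T × T × T × I)) := by
      rw [← cnt_equiv (sw T T (T × I))]
      exact a1
    have a3 : cnt (fun y : T × T × T × I => ¬ LinearIndependent (ZMod p) y.2.2.1) ≤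
      ((N + 1 : ℕ) / p * Fintype.card (T × T × T × I)) := by
      rw [← cnt_equiv (sw3 T T T I).symm]
      exact a1
    have b1 := cnt_or (fun y : T × T × T × I => ¬ LinearIndependent (ZMod p) y.1)
      (fun y => ¬ LinearIndependent (ZMod p) y.2.1 ∨ ¬ LinearIndependent (ZMod p) y.2.2.1)
    have b2 := cnt_or (fun y : T × T × T × I => ¬ LinearIndependent (ZMod p) y.2.1)
      (fun y => ¬ LinearIndependent (ZMod p) y.2.2.1)
    have b3 := cnt_mono (α := T × T × T × I) (P := fun y => ¬ (LinearIndependent (ZMod p) y.1 ∧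
      LinearIndependent (ZMod p) y.2.1 ∧ LinearIndependent (ZMod p) y.2.2.1))
      (Q := fun y => ¬ LinearIndependent (ZMod p) y.1 ∨
      (¬ LinearIndependent (ZMod p) y.2.1 ∨ ¬ LinearIndependent (ZMod p) y.2.2.1))
      (fun y hy => by tauto)
    linarith
  have hq : 3 * ((N + 1 : ℕ) / (p : ℝ)) ≤ ε ^ ((N + 1) ^ 3) / 2 := by
    rw [← mul_div_assoc, div_le_iff₀ hp0]
    push_cast
    linarith
  have hq' := mul_le_mul_of_nonneg_right hq (Nat.cast_nonneg (α := ℝ) (Fintype.card (T × T × T × I)))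
  have hg : (Fintype.card (YY p d (N + 1) I) : ℝ) = Fintype.card (T × T × T × I) := rfl
  rw [hg]
  linarith

lemma dd (hA : Good A) {s : ℕ} {I : Type}
    {E E' : (Fin d → ZMod p) × (Fin d → ZMod p) × (Fin d → ZMod p) × I → Prop}
    {U : Submodule (ZMod p) (Fin d → ZMod p)} (hU : Module.finrank (ZMod p) U ≤ 3)
    {f : MvPolynomial (Fin d) (ZMod p)} (hf : f.IsHomogeneous s)
    (hE : ∀ y1 y2 y3 i, E (y1, y2, y3, i) → E' (y1, y2, y3, i) → f ∈ J A (U ⊔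
      Submodule.span (ZMod p) {y1} ⊔ Submodule.span (ZMod p) {y2} ⊔ Submodule.span (ZMod p) {y3}))
    {y : YY p d (s + 6) I} (hy : Grid E y) (hy' : Grid E' y) : f ∈ J A U := by
  obtain ⟨⟨l1, l2, l3⟩, h⟩ := hy
  obtain ⟨-, h'⟩ := hy'
  refine elim_li hA (by omega) l1 hf fun i => ?_
  have f1 := finrank_sup_span_le U (y.1 i)
  refine elim_li hA (by omega) l2 hf fun j => ?_
  have f2 := finrank_sup_span_le (U ⊔ Submodule.span (ZMod p) {y.1 i}) (y.2.1 j)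
  refine elim_li hA (by omega) l3 hf fun l => ?_
  exact hE _ _ _ _ (h l j i) (h' l j i)

end grid
end BSG

namespace BSG

section gen
variable {α β : Type*} [Fintype α] [Fintype β]

lemma exists_p0 (κ M : ℝ) (hκ : 0 < κ) : ∃ p0 : ℕ, ∀ p : ℕ, p0 ≤ p → M ≤ κ * p := by
  refine ⟨⌈M / κ⌉₊, fun p hp => ?_⟩
  have h1 := Nat.le_ceil (M / κ)
  have h2 : ((⌈M / κ⌉₊ : ℕ) : ℝ) ≤ p := by exact_mod_cast hp
  have h3 := h1.trans h2
  rw [div_le_iff₀ hκ] at h3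
  linarith

lemma heavy {f : α → ℝ} {ε M : ℝ} (hε : 0 ≤ ε) (hM : 0 < M) (hf : ∀ a, f a ≤ M)
    (h : ε * (Fintype.card α * M) ≤ ∑ a, f a) :
    ε / 2 * Fintype.card α ≤ cnt (fun a => ε / 2 * M ≤ f a) := by
  classical
  have h1 : ∑ a, f a ≤ ∑ a, ((if ε / 2 * M ≤ f a then (1 : ℝ) else 0) * M + ε / 2 * M) := by
    refine Finset.sum_le_sum fun a _ => ?_
    split_ifs with hc
    · have := hf a
      nlinarith
    · linarith
  rw [Finset.sum_add_distrib, ← Finset.sum_mul] at h1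
  simp only [Finset.sum_const, Finset.card_univ, nsmul_eq_mul] at h1
  have h2 : cnt (fun a => ε / 2 * M ≤ f a) = ∑ a, if ε / 2 * M ≤ f a then (1 : ℝ) else 0 := by
    unfold cnt
    exact Finset.sum_congr rfl fun x _ => by congr
  rw [h2]
  by_contra! hc
  have := mul_lt_mul_of_pos_right hc hM
  linarith

lemma cnt_swap (P : α × β → Prop) : cnt P = cnt (fun q : β × α => P (q.2, q.1)) := by
  rw [cnt_prod, cnt_prod_right]

lemma cnt_sum_ge {D : α → Prop} {G : α → β → Prop} {η : ℝ}
    (h : ∀ a, D a → η ≤ cnt (G a)) : cnt D * η ≤ cnt (fun q : α × β => D q.1 ∧ G q.1 q.2) := by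
  classical
  rw [cnt_prod]
  unfold cnt at *
  rw [Finset.sum_mul]
  refine Finset.sum_le_sum fun a _ => ?_
  by_cases hD : D a
  · simpa [hD] using h a hD
  · simp [hD]

lemma pick [Nonempty β] {D : α → Prop} {G : α → β → Prop} {η : ℝ}
    (h : ∀ a, D a → η * Fintype.card β ≤ cnt (G a)) :
    ∃ y, η * cnt D ≤ cnt (fun a => D a ∧ G a y) := by
  have h1 := cnt_sum_ge h
  rw [cnt_prod_right] at h1
  exact exists_le_of_sum (by linarith)

end gen

section alg
variable {p d : ℕ} [Fact p.Prime] {A : Matrix (Fin d) (Fin d) (ZMod p)}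

lemma span_top {S : (Fin d → ZMod p) → Prop}
    (h : (Fintype.card (Fin d → ZMod p) : ℝ) < cnt S * p) :
    Submodule.span (ZMod p) {a | S a} = ⊤ := by
  by_contra hne
  set W := Submodule.span (ZMod p) {a | S a} with hW
  have hp0 : (1 : ℝ) ≤ p := by exact_mod_cast (Fact.out : p.Prime).one_le
  have hlt := Submodule.finrank_lt hne
  rw [Module.finrank_fin_fun] at hlt
  have h1 : cnt S ≤ (p : ℝ) ^ (Module.finrank (ZMod p) W) := by
    have h2 : cnt S ≤ cnt (fun a => a ∈ W) := cnt_mono fun a ha => Submodule.subset_span ha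
    refine h2.trans ?_
    rw [cnt_eq_ncard]
    have h3 : Set.ncard {x | x ∈ W} = Nat.card W := rfl
    rw [h3, Module.natCard_eq_pow_finrank (K := ZMod p)]
    simp
  have h4 : cnt S * p ≤ (p : ℝ) ^ d := by
    calc cnt S * p ≤ (p : ℝ) ^ (Module.finrank (ZMod p) W) * p :=
          mul_le_mul_of_nonneg_right h1 (by linarith)
      _ = (p : ℝ) ^ (Module.finrank (ZMod p) W + 1) := by rw [pow_succ]
      _ ≤ _ := pow_le_pow_right₀ hp0 (by omega)
  rw [card_V] at h
  push_cast at h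
  linarith

lemma span_pair_le (k a b : Fin d → ZMod p) : Module.finrank (ZMod p)
    (Submodule.span (ZMod p) {k} ⊔ Submodule.span (ZMod p) {a} ⊔ Submodule.span (ZMod p) {b} :
      Submodule (ZMod p) (Fin d → ZMod p)) ≤ 3 := by
  have h0 := finrank_sup_span_le ⊥ k
  have h1 := finrank_sup_span_le (Submodule.span (ZMod p) {k}) a
  have h2 := finrank_sup_span_le (Submodule.span (ZMod p) {k} ⊔ Submodule.span (ZMod p) {a}) b
  rw [bot_sup_eq, finrank_bot] at h0
  omega

/-- constant -/
def gc (s : ℕ) (ε : ℝ) : ℝ := ε ^ ((s + 6) ^ 3) / 2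

lemma gc_pos (s : ℕ) {ε : ℝ} (h : 0 < ε) : 0 < gc s ε := by unfold gc; positivity

lemma grid_count' {s : ℕ} (hds : 2 * s + 15 ≤ d) {I : Type} [Fintype I]
    (E : (Fin d → ZMod p) × (Fin d → ZMod p) × (Fin d → ZMod p) × I → Prop) {ε : ℝ} (hε : 0 ≤ ε)
    (h : ε * Fintype.card ((Fin d → ZMod p) × (Fin d → ZMod p) × (Fin d → ZMod p) × I) ≤ cnt E)
    (hp : 3 * (s + 6 : ℝ) ≤ gc s ε * p) :
    gc s ε * Fintype.card (YY p d (s + 6) I) ≤ cnt (Grid (N := s + 6) E) := by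
  refine grid_count (N := s + 5) (by omega) E hε h ?_
  unfold gc at hp
  push_cast
  have e : (s : ℝ) + 5 + 1 = s + 6 := by ring
  rw [e]
  change _ ≤ ε ^ (s + 6) ^ 3 * p
  linarith

lemma clique (hA : Good A) {s : ℕ} (hds : 2 * s + 15 ≤ d) {ε : ℝ} (hε : 0 < ε)
    (hp1 : 3 * (s + 6 : ℝ) ≤ gc s (ε / 2) * p) (hp2 : 2 ≤ gc s (ε / 2) * (ε / 2) * p)
    (k : Fin d → ZMod p) (P : (Fin d → ZMod p) → Prop)
    (g : (Fin d → ZMod p) → MvPolynomial (Fin d) (ZMod p))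
    (hg : ∀ a, P a → (g a).IsHomogeneous s)
    (h : ε * (Fintype.card (Fin d → ZMod p) : ℝ) ^ 2 ≤ cnt (fun q : (Fin d → ZMod p) × (Fin d → ZMod p) =>
      P q.1 ∧ P q.2 ∧ g q.1 - g q.2 ∈ J A (Submodule.span (ZMod p) {k} ⊔
        Submodule.span (ZMod p) {q.1} ⊔ Submodule.span (ZMod p) {q.2}))) :
    ∃ Φ, gc s (ε / 2) * (ε / 2) * Fintype.card (Fin d → ZMod p) ≤
      cnt (fun a => P a ∧ g a - Φ ∈ J A (Submodule.span (ZMod p) {k} ⊔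
        Submodule.span (ZMod p) {a})) := by
  set n : ℝ := (Fintype.card (Fin d → ZMod p) : ℝ) with hn
  have hn0 : 0 < n := by rw [hn]; exact_mod_cast Fintype.card_pos
  set R : (Fin d → ZMod p) → (Fin d → ZMod p) → Prop := fun a b =>
    P a ∧ P b ∧ g a - g b ∈ J A (Submodule.span (ZMod p) {k} ⊔
        Submodule.span (ZMod p) {a} ⊔ Submodule.span (ZMod p) {b}) with hR
  have hgp := gc_pos s (half_pos hε)
  have h1 := heavy (f := fun a => cnt (R a)) hε.le hn0 (fun a => cnt_le _)
    (by
      rw [cnt_prod] at h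
      refine le_trans (le_of_eq ?_) h
      rw [← hn]; ring)
  set D : (Fin d → ZMod p) → Prop := fun a => ε / 2 * n ≤ cnt (R a) with hD
  have h2 : ∀ a, D a → gc s (ε / 2) * Fintype.card (YY p d (s + 6) Unit) ≤
      cnt (Grid (N := s + 6) (I := Unit) (fun q => R a q.1)) := by
    intro a ha
    refine grid_count' hds _ (by positivity) ?_ hp1
    rw [cnt_fst, Fintype.card_prod, Nat.cast_mul, ← mul_assoc]
    exact mul_le_mul_of_nonneg_right ha (Nat.cast_nonneg _)
  obtain ⟨y, hy⟩ := pick h2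
  set S : (Fin d → ZMod p) → Prop := fun a => D a ∧
    Grid (N := s + 6) (I := Unit) (fun q => R a q.1) y with hS
  have hSP : ∀ a, S a → P a := fun a ha => (ha.2.2 0 0 0).1
  have hcard : gc s (ε / 2) * (ε / 2) * n ≤ cnt S := by
    refine le_trans ?_ hy
    rw [mul_assoc]
    exact mul_le_mul_of_nonneg_left h1 hgp.le
  have hspan : Submodule.span (ZMod p) {a | S a} = ⊤ := by
    refine span_top ?_
    have hp0 : (0 : ℝ) < p := by exact_mod_cast (Fact.out : p.Prime).pos
    have := mul_le_mul_of_nonneg_right hcard hp0.le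
    rw [← hn]
    nlinarith
  obtain ⟨Φ, hΦ⟩ := glue hA hds k {a | S a} hspan g (fun a ha => hg a (hSP a ha)) (by
    intro a ha b hb
    refine dd hA (span_pair_le k a b) ((hg a (hSP a ha)).sub (hg b (hSP b hb))) ?_ ha.2 hb.2
    intro y1 y2 y3 i h1 h2
    rw [show g a - g b = (g a - g y1) - (g b - g y1) by ring]
    refine Ideal.sub_mem _ (J_mono ?_ h1.2.2) (J_mono ?_ h2.2.2)
    · order
    · order)
  exact ⟨Φ, hcard.trans (cnt_mono fun a ha => ⟨hSP a ha, hΦ a ha⟩)⟩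

/-- dense graph from energy: statement -/
def hasF (A : Matrix (Fin d) (Fin d) (ZMod p)) (H : (Fin d → ZMod p) → Prop)
    (ξ F : (Fin d → ZMod p) → MvPolynomial (Fin d) (ZMod p)) (a b : Fin d → ZMod p) : Prop :=
  H a ∧ H b ∧ ξ a + ξ b - F (a + b) ∈ J A (Submodule.span (ZMod p) {a} ⊔ Submodule.span (ZMod p) {b})

lemma hasF_symm {H : (Fin d → ZMod p) → Prop}
    {ξ F : (Fin d → ZMod p) → MvPolynomial (Fin d) (ZMod p)} {a b : Fin d → ZMod p}
    (h : hasF A H ξ F a b) : hasF A H ξ F b a := by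
  refine ⟨h.2.1, h.1, ?_⟩
  rw [add_comm b a, add_comm (ξ b), sup_comm]
  exact h.2.2

/-- energy predicate -/
def En (A : Matrix (Fin d) (Fin d) (ZMod p)) (H : (Fin d → ZMod p) → Prop)
    (ξ : (Fin d → ZMod p) → MvPolynomial (Fin d) (ZMod p)) (k a b : Fin d → ZMod p) : Prop :=
  (H a ∧ H (k - a)) ∧ (H b ∧ H (k - b)) ∧ (ξ a + ξ (k - a)) - (ξ b + ξ (k - b)) ∈
    J A (Submodule.span (ZMod p) {k} ⊔
        Submodule.span (ZMod p) {a} ⊔ Submodule.span (ZMod p) {b})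

/-- map (k,a) to (a,k-a) -/
def kaEquiv (V : Type) [AddCommGroup V] : V × V ≃ V × V where
  toFun q := (q.2, q.1 - q.2)
  invFun q := (q.1 + q.2, q.1)
  left_inv q := by ext <;> simp
  right_inv q := by ext <;> simp

lemma span_ka (k a : Fin d → ZMod p) :
    Submodule.span (ZMod p) {k} ⊔ Submodule.span (ZMod p) {a} =
    Submodule.span (ZMod p) {a} ⊔ Submodule.span (ZMod p) {k - a} := by
  apply le_antisymm
  · refine sup_le ?_ le_sup_left
    rw [Submodule.span_singleton_le_iff_mem]
    have h1 : a ∈ Submodule.span (ZMod p) {a} ⊔ Submodule.span (ZMod p) {k - a} :=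
      Submodule.mem_sup_left (Submodule.mem_span_singleton_self _)
    have h2 : k - a ∈ Submodule.span (ZMod p) {a} ⊔ Submodule.span (ZMod p) {k - a} :=
      Submodule.mem_sup_right (Submodule.mem_span_singleton_self _)
    simpa using add_mem h1 h2
  · refine sup_le le_sup_right ?_
    rw [Submodule.span_singleton_le_iff_mem]
    have h1 : a ∈ Submodule.span (ZMod p) {k} ⊔ Submodule.span (ZMod p) {a} :=
      Submodule.mem_sup_right (Submodule.mem_span_singleton_self _)
    have h2 : k ∈ Submodule.span (ZMod p) {k} ⊔ Submodule.span (ZMod p) {a} :=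
      Submodule.mem_sup_left (Submodule.mem_span_singleton_self _)
    exact sub_mem h2 h1

lemma lemma1 (hA : Good A) {s : ℕ} (hds : 2 * s + 15 ≤ d) {δ : ℝ} (hδ : 0 < δ)
    (hp1 : 3 * (s + 6 : ℝ) ≤ gc s (δ / 2 / 2) * p)
    (hp2 : 2 ≤ gc s (δ / 2 / 2) * (δ / 2 / 2) * p)
    (H : (Fin d → ZMod p) → Prop) (ξ : (Fin d → ZMod p) → MvPolynomial (Fin d) (ZMod p))
    (hξ : ∀ a, H a → (ξ a).IsHomogeneous s)
    (h : δ * (Fintype.card (Fin d → ZMod p) : ℝ) ^ 3 ≤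
      cnt (fun q : (Fin d → ZMod p) × (Fin d → ZMod p) × (Fin d → ZMod p) =>
        En A H ξ q.1 q.2.1 q.2.2)) :
    ∃ F : (Fin d → ZMod p) → MvPolynomial (Fin d) (ZMod p),
      δ / 2 * (gc s (δ / 2 / 2) * (δ / 2 / 2)) * (Fintype.card (Fin d → ZMod p) : ℝ) ^ 2 ≤
      cnt (fun q : (Fin d → ZMod p) × (Fin d → ZMod p) => hasF A H ξ F q.1 q.2) := by
  set n : ℝ := (Fintype.card (Fin d → ZMod p) : ℝ) with hn
  have hn0 : 0 < n := by rw [hn]; exact_mod_cast Fintype.card_pos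
  have hgp := gc_pos s (half_pos (half_pos hδ))
  have h1 := heavy (f := fun k => cnt (fun q : (Fin d → ZMod p) × (Fin d → ZMod p) =>
      En A H ξ k q.1 q.2)) (M := n ^ 2) hδ.le (by positivity)
    (fun a => by
      refine (cnt_le _).trans (le_of_eq ?_)
      rw [Fintype.card_prod, Nat.cast_mul, ← hn]; ring)
    (by
      rw [cnt_prod] at h
      refine le_trans (le_of_eq ?_) h
      rw [← hn]; ring)
  have h2 : ∀ k, ∃ Φ, (δ / 2 * n ^ 2 ≤ cnt (fun q : (Fin d → ZMod p) × (Fin d → ZMod p) =>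
      En A H ξ k q.1 q.2)) → gc s (δ / 2 / 2) * (δ / 2 / 2) * n ≤
      cnt (fun a => (H a ∧ H (k - a)) ∧ ξ a + ξ (k - a) - Φ ∈ J A (Submodule.span (ZMod p) {k} ⊔
        Submodule.span (ZMod p) {a})) := by
    intro k
    by_cases hk : δ / 2 * n ^ 2 ≤ cnt (fun q : (Fin d → ZMod p) × (Fin d → ZMod p) =>
      En A H ξ k q.1 q.2)
    · obtain ⟨Φ, hΦ⟩ := clique hA hds (half_pos hδ) hp1 hp2 k (fun a => H a ∧ H (k - a))
        (fun a => ξ a + ξ (k - a)) (fun a ha => (hξ _ ha.1).add (hξ _ ha.2)) hk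
      exact ⟨Φ, fun _ => hΦ⟩
    · exact ⟨0, fun h => absurd h hk⟩
  choose F hF using h2
  refine ⟨F, ?_⟩
  rw [← cnt_equiv (kaEquiv (Fin d → ZMod p))]
  have h3 := cnt_sum_ge hF
  have h4 := mul_le_mul_of_nonneg_right h1
    (show 0 ≤ gc s (δ / 2 / 2) * (δ / 2 / 2) * n by positivity)
  refine le_trans (le_of_eq ?_) (h4.trans (h3.trans (cnt_mono ?_)))
  · rw [← hn]; ring
  · rintro ⟨k, a⟩ ⟨-, h5, h6⟩
    refine ⟨h5.1, h5.2, ?_⟩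
    simp only [kaEquiv, Equiv.coe_fn_mk, add_sub_cancel]
    rw [← span_ka]
    exact h6

end alg
end BSG

namespace BSG

section graph
variable {α : Type} [Fintype α] [Nonempty α]

lemma graph (G : α → α → Prop) (hG : ∀ a b, G a b → G b a) {γ : ℝ} (hγ : 0 < γ)
    (h : γ * (Fintype.card α : ℝ) ^ 2 ≤ cnt (fun q : α × α => G q.1 q.2)) :
    ∃ S : α → Prop, (∀ a, S a → ∃ b, G a b) ∧ γ / 4 * Fintype.card α ≤ cnt S ∧
      ∀ a e, S a → S e → γ / 4 * (γ ^ 2 / 16) ^ 2 * (Fintype.card α : ℝ) ^ 3 ≤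
        cnt (fun q : α × α × α => G a q.1 ∧ G q.1 q.2.1 ∧ G q.2.1 q.2.2 ∧ G q.2.2 e) := by
  set n : ℝ := (Fintype.card α : ℝ) with hn
  have hn0 : 0 < n := by rw [hn]; exact_mod_cast Fintype.card_pos
  set η : ℝ := γ ^ 2 / 16 with hη
  let bad : α → α → Prop := fun a a' => cnt (fun b => G a b ∧ G b a') < η * n
  -- sums
  have h1 : γ ^ 2 * n ^ 3 ≤ ∑ b, cnt (fun a => G a b) ^ 2 := by
    have h2 := cauchy (fun b => cnt (fun a => G a b))
    rw [cnt_prod_right] at h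
    have h3 := pow_le_pow_left₀ (by positivity) h 2
    have h4 := h3.trans h2
    rw [← hn] at h4
    have : n * (γ ^ 2 * n ^ 3) ≤ n * ∑ b, cnt (fun a => G a b) ^ 2 := by
      refine le_trans (le_of_eq ?_) h4; ring
    exact le_of_mul_le_mul_left this hn0
  have h2 : ∑ b, cnt (fun q : α × α => (G q.1 b ∧ G b q.2) ∧ bad q.1 q.2) ≤ η * n ^ 3 := by
    rw [← cnt_prod_right (fun q : (α × α) × α => (G q.1.1 q.2 ∧ G q.2 q.1.2) ∧ bad q.1.1 q.1.2),
      cnt_prod]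
    have : ∀ q : α × α, cnt (fun b => (G q.1 b ∧ G b q.2) ∧ bad q.1 q.2) ≤ η * n := by
      intro q
      by_cases hb : bad q.1 q.2
      · exact (cnt_mono fun b hb => hb.1).trans hb.le
      · refine le_trans (le_of_eq ?_) (show 0 ≤ η * n by positivity)
        simp [cnt, hb]
    refine (Finset.sum_le_sum fun q _ => this q).trans (le_of_eq ?_)
    simp only [Finset.sum_const, Finset.card_univ, nsmul_eq_mul, Fintype.card_prod]
    push_cast
    rw [← hn]; ring
  obtain ⟨b, hb⟩ := exists_le_of_sum (α := α) (c := γ ^ 2 / 2 * n ^ 2)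
    (f := fun b => cnt (fun a => G a b) ^ 2 -
      8 * cnt (fun q : α × α => (G q.1 b ∧ G b q.2) ∧ bad q.1 q.2)) (by
      rw [Finset.sum_sub_distrib, ← Finset.mul_sum, ← hn]
      have : γ ^ 2 / 2 * n ^ 2 * n = γ ^ 2 * n ^ 3 - 8 * (η * n ^ 3) := by rw [hη]; ring
      linarith)
  set m := cnt (fun a => G a b) with hm
  have hm0 : 0 ≤ m := cnt_nonneg _
  have hbn := cnt_nonneg (fun q : α × α => (G q.1 b ∧ G b q.2) ∧ bad q.1 q.2)
  have hmn : γ / 2 * n ≤ m := by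
    refine (sq_le_sq₀ (by positivity) hm0).1 ?_
    have : (γ / 2 * n) ^ 2 ≤ γ ^ 2 / 2 * n ^ 2 := by nlinarith [sq_nonneg (γ * n)]
    linarith
  have hmpos : 0 < m := lt_of_lt_of_le (by positivity) hmn
  have hbad8 : cnt (fun q : α × α => (G q.1 b ∧ G b q.2) ∧ bad q.1 q.2) ≤ m ^ 2 / 8 := by
    have : 0 ≤ γ ^ 2 / 2 * n ^ 2 := by positivity
    linarith
  let S : α → Prop := fun a => G a b ∧ cnt (fun a1 => G a1 b ∧ bad a a1) ≤ m / 4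
  refine ⟨S, fun a ha => ⟨b, ha.1⟩, ?_, ?_⟩
  · have h3 := cnt_sum_ge (α := α) (β := α) (D := fun a => G a b ∧ ¬ S a)
      (G := fun a a1 => G a1 b ∧ bad a a1) (η := m / 4) (by
        rintro a ⟨ha, hs⟩
        by_contra! hc
        exact hs ⟨ha, hc.le⟩)
    have h4 : cnt (fun q : α × α => (G q.1 b ∧ ¬ S q.1) ∧ G q.2 b ∧ bad q.1 q.2) ≤ m ^ 2 / 8 :=
      (cnt_mono fun q hq => ⟨⟨hq.1.1, hG _ _ hq.2.1⟩, hq.2.2⟩).trans hbad8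
    have h5 : cnt (fun a => G a b ∧ ¬ S a) ≤ m / 2 := by
      have := h3.trans h4
      have h6 : cnt (fun a => G a b ∧ ¬ S a) * (m / 4) ≤ m / 2 * (m / 4) := by
        refine this.trans (le_of_eq ?_); ring
      exact le_of_mul_le_mul_right h6 (by positivity)
    have h6 := cnt_or S (fun a => G a b ∧ ¬ S a)
    have h7 : m ≤ cnt (fun a => S a ∨ (G a b ∧ ¬ S a)) := cnt_mono fun a ha => by
      by_cases hs : S a
      · exact Or.inl hs
      · exact Or.inr ⟨ha, hs⟩
    linarith
  · intro a e ha he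
    let T : α → Prop := fun a1 => ¬ bad a a1 ∧ ¬ bad e a1
    have h3 : m / 2 ≤ cnt T := by
      have h4 := cnt_or T (fun a1 => (G a1 b ∧ bad a a1) ∨ (G a1 b ∧ bad e a1))
      have h5 := cnt_or (fun a1 => G a1 b ∧ bad a a1) (fun a1 => G a1 b ∧ bad e a1)
      have h6 : m ≤ cnt (fun a1 => T a1 ∨ ((G a1 b ∧ bad a a1) ∨ (G a1 b ∧ bad e a1))) :=
        cnt_mono fun a1 h1 => by
          by_cases x : bad a a1 <;> by_cases y : bad e a1 <;> simp [T, x, y, h1]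
      have := ha.2
      have := he.2
      linarith
    have h4 := cnt_sum_ge (α := α) (β := α × α) (D := T)
      (G := fun a1 q => (G a q.1 ∧ G q.1 a1) ∧ (G e q.2 ∧ G q.2 a1)) (η := (η * n) * (η * n)) (by
        rintro a1 ⟨h1, h2⟩
        rw [cnt_and (fun x => G a x ∧ G x a1) (fun x => G e x ∧ G x a1)]
        have h1' := not_lt.1 h1
        have h2' := not_lt.1 h2
        exact mul_le_mul h1' h2' (by positivity) (cnt_nonneg _))
    rw [← cnt_equiv (sw α α α)] at h4
    have h5 : γ / 4 * η ^ 2 * n ^ 3 ≤ cnt T * (η * n * (η * n)) := by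
      have h6 : γ / 4 * n ≤ cnt T := by linarith
      have := mul_le_mul_of_nonneg_right h6 (show 0 ≤ η * n * (η * n) by positivity)
      refine le_trans (le_of_eq ?_) this
      ring
    refine h5.trans (h4.trans (cnt_mono ?_))
    rintro ⟨b1, a1, b2⟩ ⟨-, ⟨h1, h2⟩, h3, h4⟩
    exact ⟨h1, h2, hG _ _ h4, hG _ _ h3⟩

end graph
end BSG

namespace BSG

/-- vector space -/
abbrev VV (p d : ℕ) : Type := Fin d → ZMod p

/-- polynomial ring -/
abbrev RR (p d : ℕ) : Type := MvPolynomial (Fin d) (ZMod p)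

section main
variable {p d : ℕ} [Fact p.Prime] {A : Matrix (Fin d) (Fin d) (ZMod p)}

/-- line -/
abbrev sp (x : VV p d) : Submodule (ZMod p) (VV p d) := Submodule.span (ZMod p) {x}

lemma sp_le {x : VV p d} {W : Submodule (ZMod p) (VV p d)} (h : x ∈ W) : sp x ≤ W :=
  (Submodule.span_singleton_le_iff_mem _ _).2 h

lemma mem_of_sp {x : VV p d} {W : Submodule (ZMod p) (VV p d)} (h : sp x ≤ W) : x ∈ W :=
  (Submodule.span_singleton_le_iff_mem _ _).1 h

/-- walk relation -/
def WalkE (G : VV p d → VV p d → Prop) (k a : VV p d) (q : VV p d × VV p d × VV p d × Unit) : Prop :=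
  G a (q.1 - a) ∧ G (q.1 - a) (q.2.1 - (q.1 - a)) ∧
    G (q.2.1 - (q.1 - a)) (q.2.2.1 - (q.2.1 - (q.1 - a))) ∧
    G (q.2.2.1 - (q.2.1 - (q.1 - a))) (a - k)

lemma walk_cnt (G : VV p d → VV p d → Prop) (k a : VV p d) :
    cnt (fun q : VV p d × VV p d × VV p d => G a q.1 ∧ G q.1 q.2.1 ∧ G q.2.1 q.2.2 ∧ G q.2.2 (a - k))
      ≤ cnt (WalkE G k a) := by
  refine cnt_inj (fun q => (a + q.1, q.1 + q.2.1, q.2.1 + q.2.2, ())) ?_ ?_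
  · rintro ⟨b1, a1, b2⟩ h
    simpa [WalkE] using h
  · rintro ⟨b1, a1, b2⟩ ⟨b1', a1', b2'⟩ - - h
    simp only [Prod.mk.injEq, add_right_inj, and_true] at h
    obtain ⟨rfl, h2, h3⟩ := h
    obtain rfl := add_left_cancel h2
    obtain rfl := add_left_cancel h3
    rfl

lemma walk_J {H : VV p d → Prop} {ξ F : VV p d → RR p d} {k a u1 u2 u3 : VV p d} {i : Unit}
    (h : WalkE (hasF A H ξ F) k a (u1, u2, u3, i)) {W : Submodule (ZMod p) (VV p d)}
    (hk : k ∈ W) (ha : a ∈ W) (h1 : u1 ∈ W) (h2 : u2 ∈ W) (h3 : u3 ∈ W) :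
    ξ a - ξ (a - k) - (F u1 - F u2 + F u3 - F (u1 - u2 + u3 - k)) ∈ J A W := by
  obtain ⟨⟨-, -, w1⟩, ⟨-, -, w2⟩, ⟨-, -, w3⟩, -, -, w4⟩ := h
  dsimp only at w1 w2 w3 w4
  have m1 : u1 - a ∈ W := sub_mem h1 ha
  have m2 : u2 - (u1 - a) ∈ W := sub_mem h2 m1
  have m3 : u3 - (u2 - (u1 - a)) ∈ W := sub_mem h3 m2
  have m4 : a - k ∈ W := sub_mem ha hk
  replace w1 := J_mono (sup_le (sp_le ha) (sp_le m1)) w1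
  replace w2 := J_mono (sup_le (sp_le m1) (sp_le m2)) w2
  replace w3 := J_mono (sup_le (sp_le m2) (sp_le m3)) w3
  replace w4 := J_mono (sup_le (sp_le m3) (sp_le m4)) w4
  rw [show a + (u1 - a) = u1 by abel] at w1
  rw [show u1 - a + (u2 - (u1 - a)) = u2 by abel] at w2
  rw [show u2 - (u1 - a) + (u3 - (u2 - (u1 - a))) = u3 by abel] at w3
  rw [show u3 - (u2 - (u1 - a)) + (a - k) = u1 - u2 + u3 - k by abel] at w4
  have := Ideal.sub_mem _ (Ideal.add_mem _ (Ideal.sub_mem _ w1 w2) w3) w4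
  convert this using 1
  ring

/-- outcome of the popular difference step -/
structure PD (A : Matrix (Fin d) (Fin d) (ZMod p)) (s : ℕ) (ξ : VV p d → RR p d)
    (S : VV p d → Prop) (ε : ℝ)
    (Rel : VV p d → VV p d → YY p d (s + 6) Unit → Prop) : Prop where
  mem : ∀ k a y, Rel k a y → S a ∧ S (a - k)
  count : ∀ k a, S a → S (a - k) → ε * Fintype.card (YY p d (s + 6) Unit) ≤ cnt (Rel k a)
  cl : ∀ k a b y, Rel k a y → Rel k b y →
    (ξ a - ξ (a - k)) - (ξ b - ξ (b - k)) ∈ J A (sp k ⊔ sp a ⊔ sp b)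

lemma card_YI {I : Type} [Fintype I] : (Fintype.card (VV p d × VV p d × VV p d × I) : ℝ) =
    (Fintype.card (VV p d) : ℝ) ^ 3 * Fintype.card I := by
  rw [Fintype.card_prod, Fintype.card_prod, Fintype.card_prod]
  push_cast
  ring

lemma stepE (hA : Good A) {s : ℕ} (hds : 2 * s + 15 ≤ d) {κ : ℝ} (hκ : 0 < κ)
    (hp1 : 3 * (s + 6 : ℝ) ≤ gc s κ * p)
    (H S : VV p d → Prop) (ξ F : VV p d → RR p d) (hξ : ∀ a, H a → (ξ a).IsHomogeneous s)
    (hSH : ∀ a, S a → H a)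
    (hw : ∀ a e, S a → S e → κ * (Fintype.card (VV p d) : ℝ) ^ 3 ≤
        cnt (fun q : VV p d × VV p d × VV p d => hasF A H ξ F a q.1 ∧ hasF A H ξ F q.1 q.2.1 ∧
          hasF A H ξ F q.2.1 q.2.2 ∧ hasF A H ξ F q.2.2 e)) :
    PD A s ξ S (gc s κ) (fun k a y => (S a ∧ S (a - k)) ∧ Grid (WalkE (hasF A H ξ F) k a) y) where
  mem k a y h := h.1
  count k a h1 h2 := by
    have h3 := (hw a (a - k) h1 h2).trans (walk_cnt (hasF A H ξ F) k a)
    have := grid_count' hds (WalkE (hasF A H ξ F) k a) hκ.le (by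
      rw [card_YI]; simpa using h3) hp1
    exact this.trans (cnt_mono fun y hy => ⟨⟨h1, h2⟩, hy⟩)
  cl k a b y h1 h2 := by
    have ho : ((ξ a - ξ (a - k)) - (ξ b - ξ (b - k))).IsHomogeneous s :=
      ((hξ _ (hSH _ h1.1.1)).sub (hξ _ (hSH _ h1.1.2))).sub
        ((hξ _ (hSH _ h2.1.1)).sub (hξ _ (hSH _ h2.1.2)))
    refine dd hA (span_pair_le k a b) ho ?_ h1.2 h2.2
    intro u1 u2 u3 i e1 e2
    have m1 : k ∈ sp k ⊔ sp a ⊔ sp b ⊔ sp u1 ⊔ sp u2 ⊔ sp u3 := mem_of_sp (by order)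
    have m2 : a ∈ sp k ⊔ sp a ⊔ sp b ⊔ sp u1 ⊔ sp u2 ⊔ sp u3 := mem_of_sp (by order)
    have m3 : b ∈ sp k ⊔ sp a ⊔ sp b ⊔ sp u1 ⊔ sp u2 ⊔ sp u3 := mem_of_sp (by order)
    have m4 : u1 ∈ sp k ⊔ sp a ⊔ sp b ⊔ sp u1 ⊔ sp u2 ⊔ sp u3 := mem_of_sp (by order)
    have m5 : u2 ∈ sp k ⊔ sp a ⊔ sp b ⊔ sp u1 ⊔ sp u2 ⊔ sp u3 := mem_of_sp (by order)
    have m6 : u3 ∈ sp k ⊔ sp a ⊔ sp b ⊔ sp u1 ⊔ sp u2 ⊔ sp u3 := mem_of_sp (by order)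
    have := Ideal.sub_mem _ (walk_J e1 m1 m2 m4 m5 m6) (walk_J e2 m1 m3 m4 m5 m6)
    convert this using 1
    ring

lemma stepF {s : ℕ} {ξ : VV p d → RR p d} {S : VV p d → Prop} {ε σ : ℝ}
    {Rel : VV p d → VV p d → YY p d (s + 6) Unit → Prop} (hε : 0 < ε) (hσ : 0 < σ)
    (h : PD A s ξ S ε Rel) (hS : σ * Fintype.card (VV p d) ≤ cnt S) :
    (ε * σ ^ 2) ^ 2 * (Fintype.card (VV p d) : ℝ) ^ 3 ≤
      cnt (fun q : VV p d × VV p d × VV p d => En A S ξ q.1 q.2.1 q.2.2) := by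
  set n : ℝ := (Fintype.card (VV p d) : ℝ) with hn
  have hn0 : 0 < n := by rw [hn]; exact_mod_cast Fintype.card_pos
  have h1 : σ ^ 2 * n ^ 2 ≤ cnt (fun q : VV p d × VV p d => S q.2 ∧ S (q.2 - q.1)) := by
    have h2 := cnt_and S S
    have h3 : σ * n * (σ * n) ≤ cnt S * cnt S := mul_le_mul hS hS (by positivity) (cnt_nonneg _)
    rw [← h2] at h3
    refine le_trans (le_of_eq (by ring)) (h3.trans ?_)
    refine cnt_inj (fun q => (q.1 - q.2, q.1)) (fun q hq => ⟨hq.1, by simpa using hq.2⟩) ?_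
    rintro ⟨a, b⟩ ⟨a', b'⟩ - - h
    simp only [Prod.mk.injEq] at h
    obtain ⟨h1, rfl⟩ := h
    simpa using h1
  obtain ⟨y, hy⟩ := pick (fun q (hq : (fun q : VV p d × VV p d => S q.2 ∧ S (q.2 - q.1)) q) =>
    h.count q.1 q.2 hq.1 hq.2)
  have h2 : ε * (σ ^ 2 * n ^ 2) ≤ cnt (fun q : VV p d × VV p d => Rel q.1 q.2 y) :=
    (mul_le_mul_of_nonneg_left h1 hε.le).trans (hy.trans (cnt_mono fun q hq => hq.2))
  rw [cnt_prod] at h2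
  have h3 := cauchy (fun k => cnt (fun a => Rel k a y))
  have h4 := (pow_le_pow_left₀ (by positivity) h2 2).trans h3
  rw [← hn] at h4
  have h5 : (ε * σ ^ 2) ^ 2 * n ^ 3 ≤ ∑ k, cnt (fun a => Rel k a y) ^ 2 := by
    refine le_of_mul_le_mul_left (le_trans (le_of_eq ?_) h4) hn0
    ring
  have h6 : ∑ k, cnt (fun a => Rel k a y) ^ 2 =
      cnt (fun q : VV p d × VV p d × VV p d => Rel q.1 q.2.1 y ∧ Rel q.1 q.2.2 y) := by
    rw [cnt_prod]
    refine Finset.sum_congr rfl fun k _ => ?_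
    rw [sq, ← cnt_and]
  rw [h6] at h5
  refine h5.trans (cnt_inj (fun q => (q.2.1 + q.2.2 - q.1, q.2.1, q.2.2)) ?_ ?_)
  · rintro ⟨k, a, b⟩ ⟨h1, h2⟩
    have h3 := h.cl k a b y h1 h2
    have ma := h.mem _ _ _ h1
    have mb := h.mem _ _ _ h2
    have e1 : a + b - k - a = b - k := by abel
    have e2 : a + b - k - b = a - k := by abel
    refine ⟨⟨ma.1, by simpa only [e1] using mb.2⟩, ⟨mb.1, by simpa only [e2] using ma.2⟩, ?_⟩
    dsimp only at h3 ⊢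
    rw [e1, e2]
    have m1 : a + b - k ∈ sp (a + b - k) ⊔ sp a ⊔ sp b := mem_of_sp (by order)
    have m2 : a ∈ sp (a + b - k) ⊔ sp a ⊔ sp b := mem_of_sp (by order)
    have m3 : b ∈ sp (a + b - k) ⊔ sp a ⊔ sp b := mem_of_sp (by order)
    have m4 : k ∈ sp (a + b - k) ⊔ sp a ⊔ sp b := by
      have := sub_mem (add_mem m2 m3) m1
      simpa using this
    have := J_mono (sup_le (sup_le (sp_le m4) (sp_le m2)) (sp_le m3)) h3
    convert this using 1
    ring
  · rintro ⟨k, a, b⟩ ⟨k', a', b'⟩ - - h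
    simp only [Prod.mk.injEq] at h
    obtain ⟨h1, rfl, rfl⟩ := h
    simpa using h1

end main
end BSG

namespace BSG

section fin
variable {p d : ℕ} [Fact p.Prime] {A : Matrix (Fin d) (Fin d) (ZMod p)}

/-- outcome of the cleaning step -/
structure CL (A : Matrix (Fin d) (Fin d) (ZMod p)) (s : ℕ) (ξ : VV p d → RR p d)
    (S H' : VV p d → Prop) (ε τ : ℝ)
    (Q : VV p d → VV p d → YY p d (s + 6) Unit → Prop)
    (Φ : VV p d → YY p d (s + 6) Unit → RR p d) : Prop where
  sub : ∀ a, H' a → S a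
  repr : ∀ k a y, Q k a y → ξ a - ξ (a - k) - Φ k y ∈ J A (sp k ⊔ sp a)
  few : ∀ a, H' a → cnt (fun k => S (a - k) ∧
    ¬ (ε / 2 * Fintype.card (YY p d (s + 6) Unit) ≤ cnt (Q k a))) ≤ τ * Fintype.card (VV p d)

lemma stepH (hA : Good A) {s : ℕ} (hds : 2 * s + 15 ≤ d) {ξ : VV p d → RR p d}
    {S : VV p d → Prop} {ε σ τ : ℝ}
    (hξ : ∀ a, S a → (ξ a).IsHomogeneous s)
    {Rel : VV p d → VV p d → YY p d (s + 6) Unit → Prop} (hε : 0 < ε) (hτ : 0 < τ)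
    (h : PD A s ξ S ε Rel) (hS : σ * Fintype.card (VV p d) ≤ cnt S)
    (hp : 4 ≤ ε * τ * σ * p) :
    ∃ H' Q Φ, CL A s ξ S H' ε τ Q Φ ∧ σ / 2 * Fintype.card (VV p d) ≤ cnt H' := by
  set n : ℝ := (Fintype.card (VV p d) : ℝ) with hn
  have hn0 : 0 < n := by rw [hn]; exact_mod_cast Fintype.card_pos
  set m : ℝ := (Fintype.card (YY p d (s + 6) Unit) : ℝ) with hm
  have hm0 : 0 < m := by rw [hm]; exact_mod_cast Fintype.card_pos
  have hp0 : (0 : ℝ) < p := by exact_mod_cast (Fact.out : p.Prime).pos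
  let Sp : VV p d → YY p d (s + 6) Unit → Prop := fun k y =>
    Submodule.span (ZMod p) {a | Rel k a y} = ⊤
  have hΦ : ∀ k y, ∃ Φ, Sp k y → ∀ a, Rel k a y → ξ a - ξ (a - k) - Φ ∈ J A (sp k ⊔ sp a) := by
    intro k y
    by_cases hs : Sp k y
    · obtain ⟨Φ, hΦ⟩ := glue hA hds k {a | Rel k a y} hs (fun a => ξ a - ξ (a - k))
        (fun a ha => (hξ _ (h.mem _ _ _ ha).1).sub (hξ _ (h.mem _ _ _ ha).2))
        (fun a ha b hb => h.cl k a b y ha hb)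
      exact ⟨Φ, fun _ => hΦ⟩
    · exact ⟨0, fun h => absurd h hs⟩
  choose Φ hΦ using hΦ
  let Q : VV p d → VV p d → YY p d (s + 6) Unit → Prop := fun k a y => Rel k a y ∧ Sp k y
  let bad : VV p d → VV p d → Prop := fun a k => ε / 2 * m ≤ cnt (fun y => Rel k a y ∧ ¬ Sp k y)
  have hbad : cnt (fun q : VV p d × VV p d => bad q.1 q.2) * (ε / 2 * m) ≤ n ^ 2 * m / p := by
    have h1 := cnt_sum_ge (D := fun q : VV p d × VV p d => bad q.1 q.2)
      (G := fun q y => Rel q.2 q.1 y ∧ ¬ Sp q.2 y) (η := ε / 2 * m) (fun q hq => hq)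
    refine h1.trans ?_
    have h2 : cnt (fun q : (VV p d × VV p d) × YY p d (s + 6) Unit => bad q.1.1 q.1.2 ∧
        Rel q.1.2 q.1.1 q.2 ∧ ¬ Sp q.1.2 q.2) ≤
        cnt (fun q : (VV p d × YY p d (s + 6) Unit) × VV p d => Rel q.1.1 q.2 q.1.2 ∧
          ¬ Sp q.1.1 q.1.2) := by
      refine cnt_inj (fun q => ((q.1.2, q.2), q.1.1)) (fun q hq => hq.2) ?_
      rintro ⟨⟨a, b⟩, c⟩ ⟨⟨a', b'⟩, c'⟩ - - h
      simp only [Prod.mk.injEq] at h ⊢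
      tauto
    refine h2.trans ?_
    rw [cnt_prod]
    have h3 : ∀ x : VV p d × YY p d (s + 6) Unit,
        cnt (fun a => Rel x.1 a x.2 ∧ ¬ Sp x.1 x.2) ≤ n / p := by
      rintro ⟨k, y⟩
      by_cases hs : Sp k y
      · refine le_trans (le_of_eq ?_) (show 0 ≤ n / p by positivity)
        simp [cnt, hs]
      · rw [le_div_iff₀ hp0]
        by_contra! hc
        refine hs (span_top (lt_of_lt_of_le hc ?_))
        exact mul_le_mul_of_nonneg_right (cnt_mono fun a ha => ha.1) hp0.le
    refine (Finset.sum_le_sum fun x _ => h3 x).trans (le_of_eq ?_)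
    simp only [Finset.sum_const, Finset.card_univ, nsmul_eq_mul]
    rw [Fintype.card_prod, Nat.cast_mul, ← hn, ← hm]
    ring
  let H' : VV p d → Prop := fun a => S a ∧ cnt (bad a) ≤ τ * n
  refine ⟨H', Q, Φ, ⟨fun a ha => ha.1, fun k a y hq => hΦ k y hq.2 a hq.1, ?_⟩, ?_⟩
  · intro a ha
    refine le_trans (cnt_mono ?_) ha.2
    rintro k ⟨h1, h2⟩
    by_contra hb
    have hb' := not_le.1 hb
    rw [← hm, not_le] at h2
    have h3 := h.count k a ha.1 h1
    have h4 := cnt_or (Q k a) (fun y => Rel k a y ∧ ¬ Sp k y)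
    have h5 : cnt (Rel k a) ≤ cnt (fun y => Q k a y ∨ (Rel k a y ∧ ¬ Sp k y)) :=
      cnt_mono fun y hy => by
        by_cases hs : Sp k y
        · exact Or.inl ⟨hy, hs⟩
        · exact Or.inr ⟨hy, hs⟩
    rw [← hm] at h3
    linarith
  · have h1 := cnt_sum_ge (D := fun a => S a ∧ ¬ H' a) (G := bad) (η := τ * n) (by
      rintro a ⟨h1, h2⟩
      by_contra! hc
      exact h2 ⟨h1, hc.le⟩)
    have h2 : cnt (fun a => S a ∧ ¬ H' a) * (τ * n) ≤ cnt (fun q : VV p d × VV p d => bad q.1 q.2) :=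
      h1.trans (cnt_mono fun q hq => hq.2)
    have h3 : cnt (fun a => S a ∧ ¬ H' a) ≤ σ / 2 * n := by
      have h4 := (mul_le_mul_of_nonneg_right h2 (show 0 ≤ ε / 2 * m by positivity)).trans hbad
      rw [le_div_iff₀ hp0] at h4
      by_contra! hc
      have h5 : σ / 2 * n * (τ * n * (ε / 2 * m) * p) <
        cnt (fun a => S a ∧ ¬ H' a) * (τ * n * (ε / 2 * m) * p) :=
        mul_lt_mul_of_pos_right hc (by positivity)
      have h6 := mul_le_mul_of_nonneg_right hp (show 0 ≤ n ^ 2 * m / 4 by positivity)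
      nlinarith
    have h4 := cnt_or H' (fun a => S a ∧ ¬ H' a)
    have h5 : cnt S ≤ cnt (fun a => H' a ∨ (S a ∧ ¬ H' a)) := cnt_mono fun a ha => by
      by_cases hs : H' a
      · exact Or.inl hs
      · exact Or.inr ⟨ha, hs⟩
    linarith

/-- final relation -/
def FE {s : ℕ} (A : Matrix (Fin d) (Fin d) (ZMod p)) (S : VV p d → Prop) (ξ F : VV p d → RR p d)
    (Q : VV p d → VV p d → YY p d (s + 6) Unit → Prop) (a a' : VV p d)
    (q : VV p d × VV p d × VV p d × (YY p d (s + 6) Unit × YY p d (s + 6) Unit)) : Prop :=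
  Q q.1 a q.2.2.2.1 ∧ Q q.2.1 a' q.2.2.2.2 ∧ hasF A S ξ F (a - q.1) (a' - q.2.1)

set_option synthInstance.maxHeartbeats 400000 in
set_option synthInstance.maxSize 1000 in
lemma stepI_count {s : ℕ} (hds : 2 * s + 15 ≤ d) {ξ F : VV p d → RR p d}
    {S H' : VV p d → Prop} {ε c : ℝ} (hε : 0 < ε) (hc : 0 < c)
    {Q : VV p d → VV p d → YY p d (s + 6) Unit → Prop} {Φ : VV p d → YY p d (s + 6) Unit → RR p d}
    (h : CL A s ξ S H' ε (c / 4) Q Φ)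
    (hG : c * (Fintype.card (VV p d) : ℝ) ^ 2 ≤
      cnt (fun q : VV p d × VV p d => hasF A S ξ F q.1 q.2))
    (hp1 : 3 * (s + 6 : ℝ) ≤ gc s (c / 2 * (ε / 2) ^ 2) * p)
    (a a' : VV p d) (ha : H' a) (ha' : H' a') :
    gc s (c / 2 * (ε / 2) ^ 2) *
      Fintype.card (YY p d (s + 6) (YY p d (s + 6) Unit × YY p d (s + 6) Unit)) ≤
      cnt (Grid (N := s + 6) (FE A S ξ F Q a a')) := by
  refine grid_count' hds _ (by positivity) ?_ hp1
  rw [card_YI, Fintype.card_prod, Nat.cast_mul]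
  set n : ℝ := (Fintype.card (VV p d) : ℝ) with hn
  have hn0 : 0 < n := by rw [hn]; exact_mod_cast Fintype.card_pos
  set m : ℝ := (Fintype.card (YY p d (s + 6) Unit) : ℝ) with hm
  let bad : VV p d → VV p d → Prop := fun a k => S (a - k) ∧ ¬ (ε / 2 * m ≤ cnt (Q k a))
  let D : VV p d × VV p d → Prop := fun q => hasF A S ξ F (a - q.1) (a' - q.2) ∧
    ε / 2 * m ≤ cnt (Q q.1 a) ∧ ε / 2 * m ≤ cnt (Q q.2 a')
  have h1 : c / 2 * n ^ 2 ≤ cnt D := by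
    have h2 : cnt (fun q : VV p d × VV p d => hasF A S ξ F q.1 q.2) ≤
        cnt (fun q : VV p d × VV p d => D q ∨ (bad a q.1 ∨ bad a' q.2)) := by
      refine cnt_inj (fun q => (a - q.1, a' - q.2)) ?_ ?_
      · rintro ⟨b, b'⟩ hb
        have e1 : a - (a - b) = b := by abel
        have e2 : a' - (a' - b') = b' := by abel
        simp only [D, bad, e1, e2]
        have x1 : S b := hb.1
        have x2 : S b' := hb.2.1
        dsimp only at hb
        tauto
      · rintro ⟨b, b'⟩ ⟨b2, b2'⟩ - - h
        simpa using h
    have h3 := cnt_or D (fun q : VV p d × VV p d => bad a q.1 ∨ bad a' q.2)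
    have h4 := cnt_or (fun q : VV p d × VV p d => bad a q.1) (fun q => bad a' q.2)
    rw [cnt_fst (bad a), cnt_snd (bad a'), ← hn] at h4
    have h5 := mul_le_mul_of_nonneg_right (h.few a ha) hn0.le
    have h6 := mul_le_mul_of_nonneg_right (h.few a' ha') hn0.le
    have h5' : cnt (bad a) * n ≤ c / 4 * n * n := h5
    have h6' : cnt (bad a') * n ≤ c / 4 * n * n := h6
    nlinarith
  have h2 := cnt_sum_ge (D := D) (G := fun q (r : VV p d × (YY p d (s + 6) Unit × YY p d (s + 6) Unit))
    => Q q.1 a r.2.1 ∧ Q q.2 a' r.2.2) (η := n * ((ε / 2 * m) * (ε / 2 * m))) (by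
      rintro ⟨k, k'⟩ ⟨-, g1, g2⟩
      rw [cnt_snd (fun r : YY p d (s + 6) Unit × YY p d (s + 6) Unit => Q k a r.1 ∧ Q k' a' r.2),
        cnt_and (Q k a) (Q k' a')]
      refine mul_le_mul_of_nonneg_left ?_ hn0.le
      exact mul_le_mul g1 g2 (by positivity) (cnt_nonneg _))
  have h3 := mul_le_mul_of_nonneg_right h1
    (show 0 ≤ n * ((ε / 2 * m) * (ε / 2 * m)) by positivity)
  refine le_trans (le_of_eq ?_) (h3.trans (h2.trans ?_))
  · ring
  · refine cnt_inj (fun q => (q.1.1, q.1.2, q.2)) ?_ ?_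
    · rintro ⟨⟨k, k'⟩, u, y, y'⟩ ⟨h1, h2, h3⟩
      exact ⟨h2, h3, h1.1⟩
    · rintro ⟨⟨k, k'⟩, u⟩ ⟨⟨k2, k2'⟩, u2⟩ - - h
      simp only [Prod.mk.injEq] at h ⊢
      tauto

lemma FE_J {s : ℕ} {ξ F : VV p d → RR p d} {S H' : VV p d → Prop} {ε τ : ℝ}
    {Q : VV p d → VV p d → YY p d (s + 6) Unit → Prop} {Φ : VV p d → YY p d (s + 6) Unit → RR p d}
    (h : CL A s ξ S H' ε τ Q Φ) {a a' k k' u : VV p d} {y}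
    (he : FE A S ξ F Q a a' (k, k', u, y)) {W : Submodule (ZMod p) (VV p d)}
    (ha : a ∈ W) (ha' : a' ∈ W) (hk : k ∈ W) (hk' : k' ∈ W) :
    ξ a + ξ a' - (Φ k y.1 + Φ k' y.2 + F (a + a' - k - k')) ∈ J A W := by
  obtain ⟨h1, h2, -, -, h3⟩ := he
  dsimp only at h1 h2 h3
  have g1 := J_mono (sup_le (sp_le hk) (sp_le ha)) (h.repr _ _ _ h1)
  have g2 := J_mono (sup_le (sp_le hk') (sp_le ha')) (h.repr _ _ _ h2)
  have g3 := J_mono (sup_le (sp_le (sub_mem ha hk)) (sp_le (sub_mem ha' hk'))) h3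
  rw [show a - k + (a' - k') = a + a' - k - k' by abel] at g3
  have := Ideal.add_mem _ (Ideal.add_mem _ g1 g2) g3
  convert this using 1
  ring

lemma stepI_dd (hA : Good A) {s : ℕ} {ξ F : VV p d → RR p d} {S H' : VV p d → Prop} {ε τ : ℝ}
    (hξ : ∀ a, H' a → (ξ a).IsHomogeneous s)
    {Q : VV p d → VV p d → YY p d (s + 6) Unit → Prop} {Φ : VV p d → YY p d (s + 6) Unit → RR p d}
    (h : CL A s ξ S H' ε τ Q Φ) {a a' b b' : VV p d} (ha : H' a) (ha' : H' a') (hb : H' b)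
    (hb' : H' b') (hab : a + a' = b + b')
    {y : YY p d (s + 6) (YY p d (s + 6) Unit × YY p d (s + 6) Unit)}
    (h1 : Grid (FE A S ξ F Q a a') y) (h2 : Grid (FE A S ξ F Q b b') y) :
    ξ a + ξ a' - (ξ b + ξ b') ∈ J A (Submodule.span (ZMod p) {a, a'} ⊔ Submodule.span (ZMod p) {b, b'}) := by
  have ho : (ξ a + ξ a' - (ξ b + ξ b')).IsHomogeneous s :=
    ((hξ _ ha).add (hξ _ ha')).sub ((hξ _ hb).add (hξ _ hb'))
  set U := Submodule.span (ZMod p) {a, a'} ⊔ Submodule.span (ZMod p) {b, b'} with hU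
  have ma : a ∈ U := Submodule.mem_sup_left (Submodule.subset_span (by simp))
  have ma' : a' ∈ U := Submodule.mem_sup_left (Submodule.subset_span (by simp))
  have mb : b ∈ U := Submodule.mem_sup_right (Submodule.subset_span (by simp))
  have mb' : b' ∈ U := Submodule.mem_sup_right (Submodule.subset_span (by simp))
  have hU3 : Module.finrank (ZMod p) U ≤ 3 := by
    refine le_trans (Submodule.finrank_mono ?_) (span_pair_le a a' b)
    have n1 : a ∈ sp a ⊔ sp a' ⊔ sp b := mem_of_sp (by order)
    have n2 : a' ∈ sp a ⊔ sp a' ⊔ sp b := mem_of_sp (by order)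
    have n3 : b ∈ sp a ⊔ sp a' ⊔ sp b := mem_of_sp (by order)
    have n4 : b' ∈ sp a ⊔ sp a' ⊔ sp b := by
      have := sub_mem (add_mem n1 n2) n3
      rw [hab] at this
      simpa using this
    refine sup_le ?_ ?_ <;> rw [Submodule.span_le] <;> rintro x (rfl | rfl) <;> assumption
  refine dd hA hU3 ho ?_ h1 h2
  intro k k' u y e1 e2
  have i0 : U ≤ U ⊔ sp k ⊔ sp k' ⊔ sp u := by order
  have i1 : k ∈ U ⊔ sp k ⊔ sp k' ⊔ sp u := mem_of_sp (by order)
  have i2 : k' ∈ U ⊔ sp k ⊔ sp k' ⊔ sp u := mem_of_sp (by order)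
  have g1 := FE_J h e1 (i0 ma) (i0 ma') i1 i2
  have g2 := FE_J h e2 (i0 mb) (i0 mb') i1 i2
  rw [← hab] at g2
  have := Ideal.sub_mem _ g1 g2
  convert this using 1
  ring

end fin
end BSG

namespace BSG

section last
variable {p d : ℕ} [Fact p.Prime] {A : Matrix (Fin d) (Fin d) (ZMod p)}

lemma energy_conv (H : Finset (VV p d)) (ξ : VV p d → RR p d) {δ : ℝ}
    (h : δ * (p : ℝ) ^ (3 * d) ≤ (Menergy p d A H ξ ξ ξ ξ : ℝ)) :
    δ * (Fintype.card (VV p d) : ℝ) ^ 3 ≤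
      cnt (fun q : VV p d × VV p d × VV p d => En A (fun a => a ∈ H) ξ q.1 q.2.1 q.2.2) := by
  unfold Menergy at h
  rw [← cnt_eq_ncard] at h
  have e : (Fintype.card (VV p d) : ℝ) ^ 3 = (p : ℝ) ^ (3 * d) := by
    rw [card_V]; push_cast; rw [← pow_mul, mul_comm]
  rw [e]
  refine h.trans (cnt_inj (fun q => (q.1.1 + q.1.2, q.1.1, q.2.1)) ?_ ?_)
  · rintro ⟨⟨a, a'⟩, b, b'⟩ ⟨h1, h2, h3, h4, h5, h6⟩
    dsimp only at h1 h2 h3 h4 h5 h6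
    have e1 : a + a' - a = a' := by abel
    have e2 : a + a' - b = b' := by rw [h5]; abel
    refine ⟨⟨h1, by simpa only [e1] using h2⟩, ⟨h3, by simpa only [e2] using h4⟩, ?_⟩
    dsimp only
    rw [e1, e2]
    have n1 : a + a' ∈ sp (a + a') ⊔ sp a ⊔ sp b := mem_of_sp (by order)
    have n2 : a ∈ sp (a + a') ⊔ sp a ⊔ sp b := mem_of_sp (by order)
    have n3 : b ∈ sp (a + a') ⊔ sp a ⊔ sp b := mem_of_sp (by order)
    have n4 : a' ∈ sp (a + a') ⊔ sp a ⊔ sp b := by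
      have := sub_mem n1 n2
      rwa [e1] at this
    have n5 : b' ∈ sp (a + a') ⊔ sp a ⊔ sp b := by
      have := sub_mem n1 n3
      rwa [e2] at this
    have hle : Submodule.span (ZMod p) {a, a', b, b'} ≤ sp (a + a') ⊔ sp a ⊔ sp b := by
      rw [Submodule.span_le]
      rintro x (rfl | rfl | rfl | rfl) <;> assumption
    have := J_mono (A := A) hle h6
    convert this using 1
    ring
  · rintro ⟨⟨a, a'⟩, b, b'⟩ ⟨⟨c, c'⟩, e, e'⟩ ⟨-, -, -, -, h1, -⟩ ⟨-, -, -, -, h2, -⟩ h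
    simp only [Prod.mk.injEq] at h h1 h2 ⊢
    obtain ⟨h3, rfl, rfl⟩ := h
    have h4 := add_left_cancel h3
    subst h4
    rw [h1] at h2
    exact ⟨⟨rfl, rfl⟩, rfl, add_left_cancel h2⟩

lemma ddle_of {Y : Type} [Fintype Y] [Nonempty Y] {H' : Finset (VV p d)} {ξ : VV p d → RR p d}
    {η : ℝ} {D' : ℕ} (hη : 0 < η) (hD : 1 / η ≤ D') (G : VV p d → VV p d → Y → Prop)
    (hc : ∀ a ∈ H', ∀ a' ∈ H', η * Fintype.card Y ≤ cnt (G a a'))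
    (hd : ∀ a ∈ H', ∀ a' ∈ H', ∀ b ∈ H', ∀ b' ∈ H', a + a' = b + b' → ∀ y, G a a' y → G b b' y →
      ξ a + ξ a' - (ξ b + ξ b') ∈
        J A (Submodule.span (ZMod p) {a, a'} ⊔ Submodule.span (ZMod p) {b, b'})) :
    DDle p d A {t : Trip p d | ∃ h ∈ H', ∃ h' ∈ H',
            t = (h + h', Submodule.span (ZMod p) {h, h'}, ξ h + ξ h')} D' := by
  classical
  intro h
  let e := Fintype.equivFin Y
  refine ⟨Finset.range (Fintype.card Y), fun t i => ∃ y : Y, (e y : ℕ) = i ∧ ∃ a ∈ H', ∃ a' ∈ H',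
    t = (a + a', Submodule.span (ZMod p) {a, a'}, ξ a + ξ a') ∧ G a a' y, ?_, ?_, ?_⟩
  · rw [Finset.nonempty_range_iff]
    exact Fintype.card_ne_zero
  · rintro x ⟨a, ha, a', ha', rfl⟩ -
    rw [Finset.card_range]
    have h1 : cnt (G a a') ≤ (Set.ncard {i : ℕ | i ∈ Finset.range (Fintype.card Y) ∧ ∃ y : Y,
        (e y : ℕ) = i ∧ ∃ b ∈ H', ∃ b' ∈ H', ((a + a', Submodule.span (ZMod p) {a, a'}, ξ a + ξ a') :
        Trip p d) = (b + b', Submodule.span (ZMod p) {b, b'}, ξ b + ξ b') ∧ G b b' y} : ℝ) := by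
      rw [cnt_eq_ncard]
      norm_cast
      refine Set.ncard_le_ncard_of_injOn (fun y => (e y : ℕ)) ?_ ?_ ?_
      · intro y hy
        exact ⟨by simp, y, rfl, a, ha, a', ha', rfl, hy⟩
      · intro y _ y' _ hyy
        exact e.injective (Fin.ext hyy)
      · exact (Finset.finite_toSet (Finset.range (Fintype.card Y))).subset fun i hi => by
          simpa using hi.1
    have h2 := (hc a ha a' ha').trans h1
    have h3 : (Fintype.card Y : ℝ) ≤ D' * (η * Fintype.card Y) := by
      rw [div_le_iff₀ hη] at hD
      have := mul_le_mul_of_nonneg_right hD (Nat.cast_nonneg (α := ℝ) (Fintype.card Y))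
      linarith
    have h4 := h3.trans (mul_le_mul_of_nonneg_left h2 (Nat.cast_nonneg D'))
    exact_mod_cast h4
  · rintro x - x' - hx hx' i - ⟨y, hy, a, ha, a', ha', rfl, hg⟩ ⟨y', hy', b, hb, b', hb', rfl, hg'⟩
    have : y = y' := e.injective (Fin.ext (hy.trans hy'.symm))
    subst this
    refine ⟨hx.trans hx'.symm, ?_⟩
    have := hd a ha a' ha' b hb b' hb' (hx.trans hx'.symm) y hg hg'
    rw [J_sup] at this
    exact this

end last

set_option synthInstance.maxHeartbeats 400000 in
set_option synthInstance.maxSize 1000 in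
lemma final {d s : ℕ} (hds : 2 * s + 15 ≤ d) {δ : ℝ} (hδ : 0 < δ) :
    ∃ (p0 D' : ℕ) (c : ℝ), 0 < c ∧
    ∀ p : ℕ, p.Prime → p0 ≤ p →
    ∀ (M : (Fin d → ZMod p) → ZMod p) (A : Matrix (Fin d) (Fin d) (ZMod p))
      (u : Fin d → ZMod p) (v : ZMod p),
      IsQuadFormWith p d M A u v → A.det ≠ 0 →
    ∀ H : Finset (Fin d → ZMod p),
    ∀ ξ : (Fin d → ZMod p) → MvPolynomial (Fin d) (ZMod p),
      (∀ h ∈ H, (ξ h).IsHomogeneous s) →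
      δ * (p : ℝ) ^ (3 * d) ≤ (Menergy p d A H ξ ξ ξ ξ : ℝ) →
      ∃ H' : Finset (Fin d → ZMod p), H' ⊆ H ∧ c * (p : ℝ) ^ d ≤ (H'.card : ℝ) ∧
        DDle p d A
          {t : Trip p d | ∃ h ∈ H', ∃ h' ∈ H',
            t = (h + h', Submodule.span (ZMod p) {h, h'}, ξ h + ξ h')} D' := by
  have g1 := gc_pos s (half_pos (half_pos hδ))
  obtain ⟨γ, hγe⟩ : ∃ γ, γ = δ / 2 * (gc s (δ / 2 / 2) * (δ / 2 / 2)) := ⟨_, rfl⟩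
  have hγ : 0 < γ := by rw [hγe]; positivity
  obtain ⟨κ, hκe⟩ : ∃ κ, κ = γ / 4 * (γ ^ 2 / 16) ^ 2 := ⟨_, rfl⟩
  have hκ : 0 < κ := by rw [hκe]; positivity
  obtain ⟨ε, hεe⟩ : ∃ ε, ε = gc s κ := ⟨_, rfl⟩
  have hε : 0 < ε := by rw [hεe]; exact gc_pos s hκ
  obtain ⟨σ, hσe⟩ : ∃ σ, σ = γ / 4 := ⟨_, rfl⟩
  have hσ : 0 < σ := by rw [hσe]; positivity
  obtain ⟨δ2, hδ2e⟩ : ∃ δ2, δ2 = (ε * σ ^ 2) ^ 2 := ⟨_, rfl⟩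
  have hδ2 : 0 < δ2 := by rw [hδ2e]; positivity
  have g2 := gc_pos s (half_pos (half_pos hδ2))
  obtain ⟨c, hce⟩ : ∃ c, c = δ2 / 2 * (gc s (δ2 / 2 / 2) * (δ2 / 2 / 2)) := ⟨_, rfl⟩
  have hc : 0 < c := by rw [hce]; positivity
  have g3 := gc_pos s (show 0 < c / 2 * (ε / 2) ^ 2 by positivity)
  obtain ⟨p1, hp1⟩ := exists_p0 (gc s (δ / 2 / 2)) (3 * (s + 6 : ℝ)) g1
  obtain ⟨p2, hp2⟩ := exists_p0 (gc s (δ / 2 / 2) * (δ / 2 / 2)) 2 (by positivity)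
  obtain ⟨p3, hp3⟩ := exists_p0 (gc s κ) (3 * (s + 6 : ℝ)) (gc_pos s hκ)
  obtain ⟨p4, hp4⟩ := exists_p0 (gc s (δ2 / 2 / 2)) (3 * (s + 6 : ℝ)) g2
  obtain ⟨p5, hp5⟩ := exists_p0 (gc s (δ2 / 2 / 2) * (δ2 / 2 / 2)) 2 (by positivity)
  obtain ⟨p6, hp6⟩ := exists_p0 (ε * (c / 4) * σ) 4 (by positivity)
  obtain ⟨p7, hp7⟩ := exists_p0 (gc s (c / 2 * (ε / 2) ^ 2)) (3 * (s + 6 : ℝ)) g3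
  refine ⟨3 + p1 + p2 + p3 + p4 + p5 + p6 + p7, ⌈1 / gc s (c / 2 * (ε / 2) ^ 2)⌉₊, σ / 2,
    by positivity, ?_⟩
  intro p hp hpp M A u v hM hdet H ξ hξ hen
  haveI : Fact p.Prime := ⟨hp⟩
  have hA : Good A := ⟨hM.1, hdet, by omega, by omega⟩
  obtain ⟨F, hF⟩ := lemma1 hA hds hδ (hp1 p (by omega)) (hp2 p (by omega)) (fun a => a ∈ H) ξ hξ
    (energy_conv H ξ hen)
  rw [← hγe] at hF
  obtain ⟨S, hSH, hScard, hw⟩ := graph (hasF A (fun a => a ∈ H) ξ F) (fun a b h => hasF_symm h) hγ hF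
  have hSH' : ∀ a, S a → a ∈ H := fun a ha => by
    obtain ⟨b, hb⟩ := hSH a ha
    exact hb.1
  rw [← hκe] at hw
  rw [← hσe] at hScard
  have hPD := stepE hA hds hκ (hp3 p (by omega)) (fun a => a ∈ H) S ξ F hξ hSH' hw
  rw [← hεe] at hPD
  have hen2 := stepF hε hσ hPD hScard
  rw [← hδ2e] at hen2
  have hξS : ∀ a, S a → (ξ a).IsHomogeneous s := fun a ha => hξ a (hSH' a ha)
  obtain ⟨F', hF'⟩ := lemma1 hA hds hδ2 (hp4 p (by omega)) (hp5 p (by omega)) S ξ hξS hen2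
  rw [← hce] at hF'
  obtain ⟨H', Q, Φ, hCL, hH'⟩ := stepH hA hds hξS hε (show 0 < c / 4 by positivity) hPD hScard
    (hp6 p (by omega))
  classical
  refine ⟨Finset.univ.filter H', ?_, ?_, ?_⟩
  · intro a ha
    exact hSH' a (hCL.sub a (by simpa using ha))
  · rw [← cnt_eq_card]
    rw [card_V] at hH'
    exact_mod_cast hH'
  · refine ddle_of g3 (Nat.le_ceil _)
      (fun a a' => Grid (N := s + 6) (FE A S ξ F' Q a a')) ?_ ?_
    · intro a ha a' ha'
      exact stepI_count hds hε hc hCL hF' (hp7 p (by omega)) a a' (by simpa using ha)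
        (by simpa using ha')
    · intro a ha a' ha' b hb b' hb' hab y h1 h2
      exact stepI_dd hA (fun a ha => hξS a (hCL.sub a ha)) hCL (by simpa using ha)
        (by simpa using ha') (by simpa using hb) (by simpa using hb') hab h1 h2

end BSG

/-- **Balog–Gowers–Szemerédi theorem for `Γ^s(M)`.**  If the `M`-energy of `ξ` is large,
then there is a dense subset `H' ⊆ H` such that `ξ̃(H') ⊕ ξ̃(H')` has bounded density
dependence number. -/
theorem stmt16 (d s : ℕ) (hd : 1 ≤ d) (hds : 2 * s + 15 ≤ d) (δ : ℝ) (hδ : 0 < δ) :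
    ∃ (p0 D' : ℕ) (c : ℝ), 0 < c ∧
    ∀ p : ℕ, p.Prime → p0 ≤ p →
    ∀ (M : (Fin d → ZMod p) → ZMod p) (A : Matrix (Fin d) (Fin d) (ZMod p))
      (u : Fin d → ZMod p) (v : ZMod p),
      IsQuadFormWith p d M A u v → A.det ≠ 0 →
    ∀ H : Finset (Fin d → ZMod p),
    ∀ ξ : (Fin d → ZMod p) → MvPolynomial (Fin d) (ZMod p),
      (∀ h ∈ H, (ξ h).IsHomogeneous s) →
      δ * (p : ℝ) ^ (3 * d) ≤ (Menergy p d A H ξ ξ ξ ξ : ℝ) →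
      ∃ H' : Finset (Fin d → ZMod p), H' ⊆ H ∧ c * (p : ℝ) ^ d ≤ (H'.card : ℝ) ∧
        DDle p d A
          {t : Trip p d | ∃ h ∈ H', ∃ h' ∈ H',
            t = (h + h', Submodule.span (ZMod p) {h, h'}, ξ h + ξ h')} D' := by
  exact BSG.final hds hδ
end
end

section
/- Let d, D, k ≥ 1 be integers and s ∈ ℕ, and assume d ≥ 2(k−2)s + 6k − 1 in case k ≥ 2. There exist a threshold p_0 and integers C and N, all depending only on d and D, such that for every prime p ≥ p_0 the following holds. Let M : 𝔽_p^d → 𝔽_p be a non-degenerate quadratic form and let X ⊆ Γ^s_k(M) be a finite set with π(x) = 0 for all x ∈ X and #dd(X) ≤ D. Then there exist a set Y ⊆ 𝔽_p^d which is a union of at most N subspaces of 𝔽_p^d, each of dimension at most (s+2k−2)(k−1), and a partition X = X_b ⊔ X_g such that: every element (0, V, f) ∈ X_b satisfies V ∩ Y ≠ {0}, and #cc(X_g) ≤ C. -/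
noncomputable section

open MvPolynomial

lemma spanX_prime {κ F : Type*} [Field F] (Z : Set κ) :
    (Ideal.span (X '' Z : Set (MvPolynomial κ F))).IsPrime := by
  classical
  let φ : MvPolynomial κ F →ₐ[F] MvPolynomial κ F := aeval (fun k => if k ∈ Z then 0 else X k)
  have h : Ideal.span (X '' Z : Set (MvPolynomial κ F)) = RingHom.ker φ := by
    apply le_antisymm
    · rw [Ideal.span_le]
      rintro _ ⟨k, hk, rfl⟩
      simp [φ, RingHom.mem_ker, hk]
    · intro f hf
      have key : ∀ g : MvPolynomial κ F, g - φ g ∈ Ideal.span (X '' Z : Set (MvPolynomial κ F)) := by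
        intro g
        induction g using MvPolynomial.induction_on with
        | C a => simp [φ]
        | add p q hp hq =>
          rw [map_add, add_sub_add_comm]
          exact Ideal.add_mem _ hp hq
        | mul_X p k hp =>
          by_cases hk : k ∈ Z
          · have : φ (X k) = 0 := by simp [φ, hk]
            rw [map_mul, this, mul_zero, sub_zero]
            exact Ideal.mul_mem_left _ _ (Ideal.subset_span ⟨k, hk, rfl⟩)
          · have : φ (X k) = X k := by simp [φ, hk]
            rw [map_mul, this, ← sub_mul]
            exact Ideal.mul_mem_right _ _ hp
      have := key f
      rw [RingHom.mem_ker] at hf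
      rwa [show φ f = 0 from hf, sub_zero] at this
  rw [h]
  exact RingHom.ker_isPrime _

lemma glue {κ F ι : Type*} [Field F] (J : Finset ι) (Z : ι → Set κ) (c : ι → MvPolynomial κ F)
    (hc : ∀ i ∈ J, ∀ j ∈ J, i ≠ j → c i - c j ∈ Ideal.span (X '' (Z i ∪ Z j) : Set (MvPolynomial κ F))) :
    ∃ a : MvPolynomial κ F, ∀ i ∈ J, a - c i ∈ Ideal.span (X '' (Z i) : Set (MvPolynomial κ F)) := by
  classical
  induction J using Finset.induction_on with
  | empty => exact ⟨0, by simp⟩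
  | insert n J hn ih =>
    obtain ⟨a, ha⟩ := ih (fun i hi j hj => hc i (Finset.mem_insert_of_mem hi) j (Finset.mem_insert_of_mem hj))
    let g : MvPolynomial κ F := c n - a
    let S := g.support.filter (fun m => ∀ k ∈ Z n, m k = 0)
    let e : MvPolynomial κ F := ∑ m ∈ S, monomial m (coeff m g)
    have hcoef : ∀ m, coeff m e = if m ∈ S then coeff m g else 0 := by
      intro m
      simp only [e, coeff_sum, coeff_monomial]
      rw [Finset.sum_ite_eq']
    have hS : ∀ m, coeff m g ≠ 0 → (m ∈ S ↔ ∀ k ∈ Z n, m k = 0) := by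
      intro m hm
      simp only [S, Finset.mem_filter, mem_support_iff]
      tauto
    refine ⟨a + e, ?_⟩
    intro i hi
    rw [Finset.mem_insert] at hi
    rcases hi with rfl | hi
    · rw [mem_ideal_span_X_image]
      intro m hm
      rw [mem_support_iff] at hm
      have h1 : coeff m (a + e - c i) = coeff m e - coeff m g := by
        simp only [g, coeff_sub, coeff_add]; ring
      rw [h1, hcoef] at hm
      split_ifs at hm with h2
      · simp at hm
      · have hm' : coeff m g ≠ 0 := by simpa using hm
        rw [hS m hm'] at h2
        push Not at h2
        exact h2
    · have hne : i ≠ n := by rintro rfl; exact hn hi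
      have h1 : g ∈ Ideal.span (X '' (Z i ∪ Z n) : Set (MvPolynomial κ F)) := by
        have h2 := hc i (Finset.mem_insert_of_mem hi) n (Finset.mem_insert_self _ _) hne
        have h3 := Ideal.span_mono (Set.image_mono (Set.subset_union_left (t := Z n))) (ha i hi)
        have := Ideal.add_mem _ h2 h3
        have h4 : c i - c n + (a - c i) = -g := by simp only [g]; ring
        rw [h4] at this
        simpa using this
      have h2 : e ∈ Ideal.span (X '' (Z i) : Set (MvPolynomial κ F)) := by
        rw [mem_ideal_span_X_image] at h1 ⊢
        intro m hm
        rw [mem_support_iff, hcoef] at hm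
        split_ifs at hm with h2
        · obtain ⟨k, hk, hk2⟩ := h1 m (by simpa using hm)
          rcases hk with hk | hk
          · exact ⟨k, hk, hk2⟩
          · exact absurd ((hS m hm).1 h2 k hk) hk2
        · simp at hm
      have := Ideal.add_mem _ (ha i hi) h2
      rwa [show a - c i + e = a + e - c i by ring] at this

attribute [local instance] MvPolynomial.gradedAlgebra in
lemma comp_mem {κ F : Type*} [Field F] (q a : MvPolynomial κ F) (hq : q.IsHomogeneous 2) (s : ℕ) :
    ∃ b, homogeneousComponent s (q * a) = q * b := by
  have h : (Ideal.span {q}).IsHomogeneous (homogeneousSubmodule κ F) := by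
    apply Ideal.homogeneous_span
    rintro x rfl
    exact ⟨2, hq⟩
  have := homogeneousComponent_mem_of_mem h (p := q * a) (Ideal.mul_mem_right _ _ (Ideal.subset_span rfl)) s
  rw [Ideal.mem_span_singleton] at this
  exact this

lemma core {κ F ι : Type*} [Field F] (s : ℕ) (q f : MvPolynomial κ F) (hq : q.IsHomogeneous 2)
    (hf : f.IsHomogeneous s) (J : Finset ι) (hJ : s < J.card) (Z : ι → Set κ) (ZU : Set κ)
    (hdisj : ∀ i ∈ J, ∀ j ∈ J, i ≠ j → Disjoint (Z i) (Z j))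
    (hqn : ∀ i ∈ J, ∀ j ∈ J, i ≠ j →
      q ∉ Ideal.span (X '' ((ZU ∪ Z i) ∪ (ZU ∪ Z j)) : Set (MvPolynomial κ F)))
    (hmem : ∀ i ∈ J, ∃ c, f - q * c ∈ Ideal.span (X '' (ZU ∪ Z i) : Set (MvPolynomial κ F))) :
    ∃ a, f - q * a ∈ Ideal.span (X '' ZU : Set (MvPolynomial κ F)) := by
  classical
  choose! c hc using hmem
  obtain ⟨a, ha⟩ := glue J (fun i => ZU ∪ Z i) c (by
    intro i hi j hj hij
    have h1 := Ideal.span_mono (Set.image_mono (Set.subset_union_left (t := ZU ∪ Z j))) (hc i hi)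
    have h2 := Ideal.span_mono (Set.image_mono (Set.subset_union_right (s := ZU ∪ Z i))) (hc j hj)
    have h3 := Ideal.sub_mem _ h2 h1
    rw [show f - q * c j - (f - q * c i) = q * (c i - c j) by ring] at h3
    exact ((spanX_prime _).mem_or_mem h3).resolve_left (hqn i hi j hj hij))
  have hD : ∀ i ∈ J, f - q * a ∈ Ideal.span (X '' (ZU ∪ Z i) : Set (MvPolynomial κ F)) := by
    intro i hi
    have := Ideal.sub_mem _ (hc i hi) (Ideal.mul_mem_left _ q (ha i hi))
    rwa [show f - q * c i - q * (a - c i) = f - q * a by ring] at this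
  obtain ⟨b, hb⟩ := comp_mem q a hq s
  refine ⟨b, ?_⟩
  have h1 : f - q * b = homogeneousComponent s (f - q * a) := by
    rw [map_sub, hb, homogeneousComponent_eq_self hf]
  rw [h1, mem_ideal_span_X_image]
  intro m hm
  rw [mem_support_iff, coeff_homogeneousComponent] at hm
  split_ifs at hm with hdeg
  · by_contra hcon
    push Not at hcon
    have h2 : ∀ i ∈ J, ∃ k ∈ Z i, m k ≠ 0 := by
      intro i hi
      obtain ⟨k, hk, hk2⟩ := mem_ideal_span_X_image.1 (hD i hi) m (by simpa using hm)
      rcases hk with hk | hk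
      · exact absurd (hcon k hk) hk2
      · exact ⟨k, hk, hk2⟩
    obtain ⟨i0, hi0⟩ : J.Nonempty := Finset.card_pos.1 (by omega)
    have : Nonempty κ := ⟨(h2 i0 hi0).choose⟩
    choose! k hk hk2 using h2
    have hinj : Set.InjOn k (J : Set ι) := by
      intro i hi j hj hij
      by_contra hne
      exact Set.disjoint_left.1 (hdisj i hi j hj hne) (hk i hi) (hij ▸ hk j hj)
    have h3 : J.card ≤ m.support.card := by
      apply Finset.card_le_card_of_injOn k _ hinj
      intro i hi
      simpa using hk2 i hi
    have h4 : m.support.card ≤ m.degree := by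
      rw [Finsupp.degree, Finset.card_eq_sum_ones]
      apply Finset.sum_le_sum
      intro i hi
      exact Nat.one_le_iff_ne_zero.2 (by simpa using hi)
    omega
  · simp at hm

lemma mem_span_insert_iff {R : Type*} [CommRing R] (q f : R) (S : Set R) :
    f ∈ Ideal.span ({q} ∪ S) ↔ ∃ c, f - q * c ∈ Ideal.span S := by
  rw [Ideal.span_union, Submodule.mem_sup]
  constructor
  · rintro ⟨y, hy, z, hz, rfl⟩
    obtain ⟨c, rfl⟩ := Ideal.mem_span_singleton.1 hy
    exact ⟨c, by simpa using hz⟩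
  · rintro ⟨c, hc⟩
    exact ⟨q * c, Ideal.mul_mem_right _ _ (Ideal.subset_span rfl), _, hc, by ring⟩

/-- linear forms -/
noncomputable def linM (F : Type*) [Field F] (d : ℕ) : (Fin d → F) →ₗ[F] MvPolynomial (Fin d) F :=
  (Pi.basisFun F (Fin d)).constr F X

lemma linM_single {F : Type*} [Field F] {d : ℕ} (j : Fin d) :
    linM F d (Pi.single j 1) = X j := by
  simp [linM]

lemma exists_basis_set {F E : Type*} [Field F] [AddCommGroup E] [Module F E] (V : Submodule F E) :
    ∃ B : Set E, LinearIndepOn F id B ∧ Submodule.span F B = V := by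
  obtain ⟨B, _, h2, h3⟩ := exists_linearIndependent F (V : Set E)
  exact ⟨B, h3, by rw [h2, Submodule.span_eq]⟩

lemma indep_union {F E : Type*} [Field F] [AddCommGroup E] [Module F E] (V : ℕ → Submodule F E)
    (B : ℕ → Set E) (hB : ∀ i, LinearIndepOn F id (B i)) (hBV : ∀ i, Submodule.span F (B i) = V i)
    (J : Finset ℕ) (hV : ∀ j ∈ J, Disjoint (V j) ((Finset.range j).sup V)) :
    LinearIndepOn F id (⋃ i ∈ J, B i) ∧ Submodule.span F (⋃ i ∈ J, B i) = J.sup V := by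
  induction J using Finset.induction_on_max with
  | empty => simp
  | insert n J hn ih =>
    obtain ⟨h1, h2⟩ := ih (fun j hj => hV j (Finset.mem_insert_of_mem hj))
    rw [Finset.set_biUnion_insert]
    refine ⟨LinearIndepOn.id_union (hB n) h1 ?_, ?_⟩
    · rw [h2, hBV]
      refine (hV n (Finset.mem_insert_self _ _)).mono_right (Finset.sup_mono ?_)
      intro j hj
      exact Finset.mem_range.2 (hn j hj)
    · rw [Submodule.span_union, h2, hBV, Finset.sup_insert]

lemma adapted {F : Type*} [Field F] (d s : ℕ) (Q f : MvPolynomial (Fin d) F)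
    (hQ : Q.IsHomogeneous 2) (hf : f.IsHomogeneous s) (V : ℕ → Submodule F (Fin d → F))
    (U : Submodule F (Fin d → F)) (J : Finset ℕ) (hJ : s < J.card)
    (hV : ∀ j ∈ J, Disjoint (V j) ((Finset.range j).sup V))
    (hU : Disjoint U (J.sup V))
    (hQn : ∀ i ∈ J, ∀ j ∈ J, i ≠ j →
      Q ∉ Ideal.span (linM F d '' ((U ⊔ V i ⊔ V j : Submodule F (Fin d → F)) : Set (Fin d → F))))
    (hmem : ∀ i ∈ J, f ∈ Ideal.span ({Q} ∪ linM F d '' ((U ⊔ V i : Submodule F (Fin d → F)) : Set (Fin d → F)))) :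
    f ∈ Ideal.span ({Q} ∪ linM F d '' (U : Set (Fin d → F))) := by
  classical
  choose B hB hBV using fun i => exists_basis_set (V i)
  obtain ⟨BU, hBU, hBUV⟩ := exists_basis_set U
  obtain ⟨h1, h2⟩ := indep_union V B hB hBV J hV
  have hind : LinearIndepOn F id (BU ∪ ⋃ i ∈ J, B i) := by
    apply LinearIndepOn.id_union hBU h1
    rwa [h2, hBUV]
  let b := Module.Basis.extend hind
  have hsub : BU ∪ ⋃ i ∈ J, B i ⊆ hind.extend (Set.subset_univ _) := hind.subset_extend _
  have hb : ∀ k, b k = (k : Fin d → F) := fun k => Module.Basis.extend_apply_self hind k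
  let κ := ↥(hind.extend (Set.subset_univ _))
  let Λ : (Fin d → F) →ₗ[F] MvPolynomial κ F := b.constr F X
  have hΛ : ∀ k, Λ (b k) = X k := fun k => b.constr_basis F _ k
  let Ψ : MvPolynomial (Fin d) F →ₐ[F] MvPolynomial κ F := aeval (fun j => Λ (Pi.single j 1))
  let Φ : MvPolynomial κ F →ₐ[F] MvPolynomial (Fin d) F := aeval (fun k => linM F d (b k))
  have hΨl : ∀ l, Ψ (linM F d l) = Λ l := by
    have : Ψ.toLinearMap ∘ₗ linM F d = Λ := by
      apply (Pi.basisFun F (Fin d)).ext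
      intro j
      simp [linM_single, Ψ]
    intro l
    exact LinearMap.congr_fun this l
  have hΦl : ∀ l, Φ (Λ l) = linM F d l := by
    have : Φ.toLinearMap ∘ₗ Λ = linM F d := by
      apply b.ext
      intro j
      simp [hΛ, Φ]
    intro l
    exact LinearMap.congr_fun this l
  have hΦΨ : ∀ g, Φ (Ψ g) = g := by
    have : Φ.comp Ψ = AlgHom.id F _ := by
      apply MvPolynomial.algHom_ext
      intro j
      simp only [AlgHom.comp_apply, Ψ, aeval_X, hΦl, linM_single, AlgHom.id_apply]
    intro g
    exact DFunLike.congr_fun this g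
  have hΛhom : ∀ l, (Λ l).IsHomogeneous 1 := by
    intro l
    have : Λ l ∈ homogeneousSubmodule κ F 1 := by
      have hr : LinearMap.range Λ ≤ homogeneousSubmodule κ F 1 := by
        rw [b.constr_range, Submodule.span_le]
        rintro _ ⟨k, rfl⟩
        exact isHomogeneous_X _ _
      exact hr ⟨l, rfl⟩
    exact this
  have hΨhom : ∀ (g : MvPolynomial (Fin d) F) n, g.IsHomogeneous n → (Ψ g).IsHomogeneous n := by
    intro g n hg
    have := hg.aeval (fun j => Λ (Pi.single j 1)) (n := 1) (fun j => hΛhom _)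
    rw [one_mul] at this
    exact this
  have hΛspan : ∀ (S : Set (Fin d → F)) l, S ⊆ hind.extend (Set.subset_univ _) → l ∈ Submodule.span F S →
      Λ l ∈ Ideal.span (X '' {k : κ | (k : Fin d → F) ∈ S} : Set (MvPolynomial κ F)) := by
    intro S l hS hl
    have hle : Submodule.span F S ≤ ((Ideal.span (X '' {k : κ | (k : Fin d → F) ∈ S} : Set (MvPolynomial κ F))).restrictScalars F).comap Λ := by
      rw [Submodule.span_le]
      intro v hv
      have := hΛ ⟨v, hS hv⟩
      rw [hb] at this
      simp only [SetLike.mem_coe, Submodule.mem_comap, Submodule.restrictScalars_mem]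
      rw [this]
      exact Ideal.subset_span ⟨_, hv, rfl⟩
    exact hle hl
  -- transfer forward
  have hfor : ∀ (S : Set (Fin d → F)) (W : Submodule F (Fin d → F)), S ⊆ hind.extend (Set.subset_univ _) →
      Submodule.span F S = W → ∀ g, g ∈ Ideal.span (linM F d '' (W : Set (Fin d → F))) →
      Ψ g ∈ Ideal.span (X '' {k : κ | (k : Fin d → F) ∈ S} : Set (MvPolynomial κ F)) := by
    intro S W hS hW g hg
    have hle : Ideal.span (linM F d '' (W : Set (Fin d → F))) ≤
        (Ideal.span (X '' {k : κ | (k : Fin d → F) ∈ S} : Set (MvPolynomial κ F))).comap Ψ := by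
      rw [Ideal.span_le]
      rintro _ ⟨l, hl, rfl⟩
      simp only [SetLike.mem_coe, Ideal.mem_comap]
      rw [hΨl]
      exact hΛspan S l hS (hW ▸ hl)
    exact hle hg
  have hback : ∀ (S : Set (Fin d → F)) (W : Submodule F (Fin d → F)), S ⊆ W →
      ∀ g, Ψ g ∈ Ideal.span (X '' {k : κ | (k : Fin d → F) ∈ S} : Set (MvPolynomial κ F)) →
      g ∈ Ideal.span (linM F d '' (W : Set (Fin d → F))) := by
    intro S W hS g hg
    have hle : (Ideal.span (X '' {k : κ | (k : Fin d → F) ∈ S} : Set (MvPolynomial κ F))) ≤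
       (Ideal.span (linM F d '' (W : Set (Fin d → F)))).comap Φ := by
      rw [Ideal.span_le]
      rintro _ ⟨k, hk, rfl⟩
      simp only [SetLike.mem_coe, Ideal.mem_comap]
      have : Φ (X k) = linM F d (b k) := by simp [Φ]
      rw [this, hb]
      exact Ideal.subset_span ⟨_, hS hk, rfl⟩
    have := hle hg
    rwa [Ideal.mem_comap, hΦΨ] at this
  have hBJ : ∀ i ∈ J, B i ⊆ hind.extend (Set.subset_univ _) := fun i hi =>
    (Set.subset_biUnion_of_mem (u := B) (s := (J : Set ℕ)) hi).trans (Set.subset_union_right.trans hsub)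
  have hBUs : BU ⊆ hind.extend (Set.subset_univ _) := Set.subset_union_left.trans hsub
  have hBV' : ∀ i, B i ⊆ V i := fun i => by rw [← hBV i]; exact Submodule.subset_span
  have hBUV' : BU ⊆ U := by rw [← hBUV]; exact Submodule.subset_span
  have hVd : ∀ i ∈ J, ∀ j ∈ J, i < j → Disjoint (V i) (V j) := by
    intro i hi j hj hij
    exact ((hV j hj).mono_right (Finset.le_sup (f := V) (Finset.mem_range.2 hij))).symm
  have hVd' : ∀ i ∈ J, ∀ j ∈ J, i ≠ j → Disjoint (V i) (V j) := by
    intro i hi j hj hij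
    rcases lt_or_gt_of_ne hij with h | h
    · exact hVd i hi j hj h
    · exact (hVd j hj i hi h).symm
  obtain ⟨a, ha⟩ := core s (Ψ Q) (Ψ f) (hΨhom _ _ hQ) (hΨhom _ _ hf) J hJ
    (fun i => {k : κ | (k : Fin d → F) ∈ B i}) {k : κ | (k : Fin d → F) ∈ BU}
    (by
      intro i hi j hj hij
      rw [Set.disjoint_left]
      intro k hk hk'
      have := (Submodule.disjoint_def.1 (hVd' i hi j hj hij)) _ (hBV' i hk) (hBV' j hk')
      have h0 := (hB i).ne_zero hk
      exact h0 this)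
    (by
      intro i hi j hj hij hcon
      apply hQn i hi j hj hij
      apply hback ((BU ∪ B i) ∪ (BU ∪ B j)) _ _ _ hcon
      have hu : U ≤ U ⊔ V i ⊔ V j := le_sup_left.trans le_sup_left
      have hi' : V i ≤ U ⊔ V i ⊔ V j := le_sup_right.trans le_sup_left
      have hj' : V j ≤ U ⊔ V i ⊔ V j := le_sup_right
      rintro x ((hx | hx) | (hx | hx))
      · exact hu (hBUV' hx)
      · exact hi' (hBV' i hx)
      · exact hu (hBUV' hx)
      · exact hj' (hBV' j hx))
    (by
      intro i hi
      obtain ⟨c, hc⟩ := (mem_span_insert_iff _ _ _).1 (hmem i hi)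
      refine ⟨Ψ c, ?_⟩
      have := hfor (BU ∪ B i) _ (Set.union_subset hBUs (hBJ i hi)) (by rw [Submodule.span_union, hBUV, hBV]) _ hc
      rw [map_sub, map_mul] at this
      exact this)
  rw [mem_span_insert_iff]
  refine ⟨Φ a, ?_⟩
  apply hback BU U hBUV'
  have hΨΦ : ∀ g, Ψ (Φ g) = g := by
    have : Ψ.comp Φ = AlgHom.id F _ := by
      apply MvPolynomial.algHom_ext
      intro j
      simp only [AlgHom.comp_apply, Φ, aeval_X, hΨl, hΛ, AlgHom.id_apply]
    intro g
    exact DFunLike.congr_fun this g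
  rw [map_sub, map_mul, hΨΦ]
  exact ha

lemma drop_lemma {F E : Type*} [Field F] [AddCommGroup E] [Module F E] [FiniteDimensional F E]
    (V : ℕ → Submodule F E) (U : Submodule F E) (n : ℕ)
    (hV : ∀ j < n, Disjoint (V j) ((Finset.range j).sup V)) :
    ∃ J : Finset ℕ, J ⊆ Finset.range n ∧
      n ≤ J.card + Module.finrank F (U ⊓ (Finset.range n).sup V : Submodule F E) ∧
      Disjoint U (J.sup V) := by
  induction n with
  | zero => exact ⟨∅, by simp⟩
  | succ n ih =>
    obtain ⟨J, hJ, hc, hd⟩ := ih (fun j hj => hV j (by omega))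
    set S := (Finset.range n).sup V with hS
    have hS1 : (Finset.range (n+1)).sup V = V n ⊔ S := by
      rw [Finset.range_add_one, Finset.sup_insert]
    rw [hS1]
    have hle : U ⊓ S ≤ U ⊓ (V n ⊔ S) := inf_le_inf_left _ le_sup_right
    have hJS : J.sup V ≤ S := Finset.sup_mono hJ
    rcases hle.eq_or_lt with h | h
    · refine ⟨insert n J, ?_, ?_, ?_⟩
      · rw [Finset.range_add_one]; exact Finset.insert_subset_insert _ hJ
      · rw [Finset.card_insert_of_notMem (fun hn => by simpa using hJ hn), ← h]
        omega
      · rw [Finset.sup_insert, disjoint_iff, eq_bot_iff]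
        have h1 : U ⊓ (V n ⊔ J.sup V) ≤ S := by
          calc U ⊓ (V n ⊔ J.sup V) ≤ U ⊓ (V n ⊔ S) := inf_le_inf_left _ (sup_le_sup_left hJS _)
            _ = U ⊓ S := h.symm
            _ ≤ S := inf_le_right
        have h2 : (J.sup V ⊔ V n) ⊓ S = J.sup V := by
          rw [sup_inf_assoc_of_le (V n) hJS, (disjoint_iff.1 (hV n (by omega))), sup_bot_eq]
        have h3 : U ⊓ (V n ⊔ J.sup V) ≤ J.sup V := by
          have h5 : U ⊓ (V n ⊔ J.sup V) ≤ (J.sup V ⊔ V n) ⊓ S := by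
            refine le_inf ?_ h1
            rw [sup_comm (J.sup V)]
            exact inf_le_right
          exact h5.trans h2.le
        calc U ⊓ (V n ⊔ J.sup V) ≤ U ⊓ J.sup V := le_inf inf_le_left h3
          _ ≤ ⊥ := by rw [disjoint_iff.1 hd]
    · have := Submodule.finrank_lt_finrank_of_lt h
      refine ⟨J, hJ.trans (Finset.range_subset_range.2 (by omega)), by omega, hd⟩

lemma eval_linM {F : Type*} [Field F] {d : ℕ} (l n : Fin d → F) :
    eval n (linM F d l) = l ⬝ᵥ n := by
  have : (aeval n : MvPolynomial (Fin d) F →ₐ[F] F).toLinearMap ∘ₗ linM F d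
      = (dotProductBilin F F).flip n := by
    apply (Pi.basisFun F (Fin d)).ext
    intro j
    simp [linM_single]
  have h := LinearMap.congr_fun this l
  simpa [aeval_eq_eval] using h

lemma isotropic {p d : ℕ} [Fact p.Prime] (hp : 3 ≤ p) (A : Matrix (Fin d) (Fin d) (ZMod p))
    (hA : A.IsSymm) (hdet : A.det ≠ 0) (S : Submodule (ZMod p) (Fin d → ZMod p))
    (hQ : quadPoly p d A ∈ Ideal.span (linM (ZMod p) d '' (S : Set (Fin d → ZMod p)))) :
    d ≤ 2 * Module.finrank (ZMod p) S := by
  let K : Submodule (ZMod p) (Fin d → ZMod p) :=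
    (S.map (dotProductEquiv (ZMod p) (Fin d)).toLinearMap).dualCoannihilator
  have hKmem : ∀ n ∈ K, ∀ l ∈ S, l ⬝ᵥ n = 0 := by
    intro n hn l hl
    rw [Submodule.mem_dualCoannihilator] at hn
    exact hn _ ⟨l, hl, rfl⟩
  have hK : Module.finrank (ZMod p) S + Module.finrank (ZMod p) K = d := by
    have := Subspace.finrank_add_finrank_dualCoannihilator_eq (S.map (dotProductEquiv (ZMod p) (Fin d)).toLinearMap)
    rw [LinearEquiv.finrank_map_eq, Module.finrank_fin_fun] at this
    exact this
  have hev : ∀ n, eval n (quadPoly p d A) = n ⬝ᵥ (A.mulVec n) := by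
    intro n
    simp only [quadPoly, map_sum, map_mul, eval_C, eval_X, dotProduct, Matrix.mulVec, Finset.mul_sum]
    refine Finset.sum_congr rfl fun i _ => Finset.sum_congr rfl fun j _ => by ring
  have hz : ∀ n ∈ K, n ⬝ᵥ (A.mulVec n) = 0 := by
    intro n hn
    rw [← hev]
    have hle : Ideal.span (linM (ZMod p) d '' (S : Set (Fin d → ZMod p))) ≤ RingHom.ker (eval n) := by
      rw [Ideal.span_le]
      rintro _ ⟨l, hl, rfl⟩
      simp only [SetLike.mem_coe, RingHom.mem_ker, eval_linM]
      exact hKmem n hn l hl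
    exact hle hQ
  have h2 : (2 : ZMod p) ≠ 0 := by
    intro h
    have : ((2 : ℕ) : ZMod p) = 0 := by exact_mod_cast h
    rw [ZMod.natCast_eq_zero_iff] at this
    have := Nat.le_of_dvd (by norm_num) this
    omega
  have hbil : ∀ n ∈ K, ∀ m ∈ K, m ⬝ᵥ (A.mulVec n) = 0 := by
    intro n hn m hm
    have h := hz (n + m) (K.add_mem hn hm)
    rw [Matrix.mulVec_add, add_dotProduct, dotProduct_add, dotProduct_add, hz n hn, hz m hm] at h
    have hs : n ⬝ᵥ (A.mulVec m) = m ⬝ᵥ (A.mulVec n) := by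
      rw [Matrix.dotProduct_mulVec, ← Matrix.mulVec_transpose, hA.eq, dotProduct_comm]
    rw [hs] at h
    have : 2 * (m ⬝ᵥ (A.mulVec n)) = 0 := by linear_combination h
    exact (mul_eq_zero.1 this).resolve_left h2
  have hinj : Function.Injective (A.mulVecLin) := by
    rw [Matrix.coe_mulVecLin]
    exact Matrix.mulVec_injective_of_isUnit ((Matrix.isUnit_iff_isUnit_det A).2 (isUnit_iff_ne_zero.2 hdet))
  have hle : (K.map A.mulVecLin).map (dotProductEquiv (ZMod p) (Fin d)).toLinearMap ≤ K.dualAnnihilator := by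
    rintro _ ⟨_, ⟨n, hn, rfl⟩, rfl⟩
    rw [Submodule.mem_dualAnnihilator]
    intro m hm
    have := hbil n hn m hm
    simpa [dotProduct_comm] using this
  have h3 := Submodule.finrank_mono hle
  rw [LinearEquiv.finrank_map_eq, ← (Submodule.equivMapOfInjective _ hinj K).finrank_eq] at h3
  have h4 := Subspace.finrank_add_finrank_dualAnnihilator_eq K
  rw [Module.finrank_fin_fun] at h4
  omega

lemma linM_apply {F : Type*} [Field F] {d : ℕ} (l : Fin d → F) :
    linM F d l = ∑ j, C (l j) * X j := by
  simp [linM, Module.Basis.constr_apply_fintype, MvPolynomial.smul_eq_C_mul]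

lemma linPoly_eq {p d : ℕ} [Fact p.Prime] (A : Matrix (Fin d) (Fin d) (ZMod p)) (h : Fin d → ZMod p) :
    linPoly p d A h = linM (ZMod p) d (A.vecMulLinear h) := by
  rw [linM_apply]
  rfl

lemma JM_eq {p d : ℕ} [Fact p.Prime] (A : Matrix (Fin d) (Fin d) (ZMod p))
    (V : Submodule (ZMod p) (Fin d → ZMod p)) :
    JM p d A (V : Set (Fin d → ZMod p)) = Ideal.span ({quadPoly p d A} ∪
      linM (ZMod p) d '' ((V.map A.vecMulLinear : Submodule _ _) : Set (Fin d → ZMod p))) := by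
  rw [JM, Submodule.map_coe, Set.image_image]
  congr 2
  apply Set.image_congr
  intro h _
  exact linPoly_eq A h

lemma JM_mono {p d : ℕ} (A : Matrix (Fin d) (Fin d) (ZMod p))
    {V W : Set (Fin d → ZMod p)} (h : V ⊆ W) : JM p d A V ≤ JM p d A W :=
  Ideal.span_mono (Set.union_subset_union_right _ (Set.image_mono h))

lemma JM_add {p d : ℕ} [Fact p.Prime] (A : Matrix (Fin d) (Fin d) (ZMod p))
    (V W : Submodule (ZMod p) (Fin d → ZMod p)) :
    JM p d A (V : Set (Fin d → ZMod p)) + JM p d A (W : Set (Fin d → ZMod p)) =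
      JM p d A ((V ⊔ W : Submodule _ _) : Set (Fin d → ZMod p)) := by
  apply le_antisymm
  · rw [Ideal.add_eq_sup]
    exact sup_le (JM_mono A (SetLike.coe_subset_coe.2 le_sup_left))
      (JM_mono A (SetLike.coe_subset_coe.2 le_sup_right))
  · conv_lhs => rw [JM]
    rw [Ideal.span_le]
    rintro g (hg | ⟨h, hh, rfl⟩)
    · have h1 : g ∈ JM p d A (V : Set (Fin d → ZMod p)) := Ideal.subset_span (Or.inl hg)
      exact (le_sup_left : JM p d A (V : Set (Fin d → ZMod p)) ≤ _) h1
    · obtain ⟨v, hv, w, hw, rfl⟩ := Submodule.mem_sup.1 hh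
      rw [linPoly_eq, map_add, map_add, ← linPoly_eq, ← linPoly_eq]
      exact Submodule.add_mem_sup (Ideal.subset_span (Or.inr ⟨v, hv, rfl⟩))
        (Ideal.subset_span (Or.inr ⟨w, hw, rfl⟩))

lemma TripRel_symm {p d : ℕ} (A : Matrix (Fin d) (Fin d) (ZMod p)) {x y : Trip p d}
    (h : TripRel p d A x y) : TripRel p d A y x := by
  refine ⟨h.1.symm, ?_⟩
  rw [add_comm, ← neg_sub]
  exact Ideal.neg_mem_iff _ |>.2 h.2

lemma quadPoly_hom {p d : ℕ} (A : Matrix (Fin d) (Fin d) (ZMod p)) :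
    (quadPoly p d A).IsHomogeneous 2 := by
  apply IsHomogeneous.sum
  intro i _
  apply IsHomogeneous.sum
  intro j _
  apply IsHomogeneous.C_mul
  exact (isHomogeneous_X _ i).mul (isHomogeneous_X _ j)

lemma trans_key {p d k s : ℕ} [Fact p.Prime] (hp : 3 ≤ p) (hd1 : 1 ≤ d) (hk : 1 ≤ k)
    (hdim : 2 ≤ k → 2 * (k - 2) * s + 6 * k - 1 ≤ d)
    (A : Matrix (Fin d) (Fin d) (ZMod p))
    (hA : A.IsSymm) (hdet : A.det ≠ 0) (x x' : Trip p d) (z : ℕ → Trip p d)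
    (hx : memGamma p d s k x) (hx' : memGamma p d s k x') (hx0 : x.1 = 0) (hx0' : x'.1 = 0)
    (hz : ∀ j < s + 2 * k - 1, memGamma p d s k (z j) ∧ (z j).1 = 0 ∧ TripRel p d A x (z j) ∧
      TripRel p d A x' (z j) ∧ Disjoint (z j).2.1 ((Finset.range j).sup (fun i => (z i).2.1))) :
    TripRel p d A x x' := by
  classical
  refine ⟨hx0.trans hx0'.symm, ?_⟩
  have hinj : Function.Injective A.vecMulLinear := by
    have := Matrix.vecMul_injective_of_isUnit ((Matrix.isUnit_iff_isUnit_det A).2 (isUnit_iff_ne_zero.2 hdet))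
    exact this
  let U0 := x.2.1 ⊔ x'.2.1
  let U := U0.map A.vecMulLinear
  let V : ℕ → Submodule (ZMod p) (Fin d → ZMod p) := fun j => (z j).2.1.map A.vecMulLinear
  have hsup : ∀ j : ℕ, (Finset.range j).sup V =
      ((Finset.range j).sup (fun i => (z i).2.1)).map A.vecMulLinear := by
    intro j
    induction j with
    | zero => simp
    | succ j ih => rw [Finset.range_add_one, Finset.sup_insert, Finset.sup_insert, Submodule.map_sup, ih]
  have hV : ∀ j < s + 2 * k - 1, Disjoint (V j) ((Finset.range j).sup V) := by
    intro j hj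
    rw [hsup]
    exact Submodule.disjoint_map hinj (hz j hj).2.2.2.2
  have hmapr : ∀ W : Submodule (ZMod p) (Fin d → ZMod p),
      Module.finrank (ZMod p) (W.map A.vecMulLinear) = Module.finrank (ZMod p) W := fun W =>
    (Submodule.equivMapOfInjective _ hinj W).finrank_eq.symm
  have hU0 : Module.finrank (ZMod p) U0 ≤ 2 * (k - 1) := by
    have h1 := hx.2.2.2 hx0
    have h2 := hx'.2.2.2 hx0'
    have h3 := Submodule.finrank_add_le_finrank_add_finrank x.2.1 x'.2.1
    show Module.finrank (ZMod p) ↥(x.2.1 ⊔ x'.2.1) ≤ _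
    omega
  have hUr : Module.finrank (ZMod p) U ≤ 2 * (k - 1) := (hmapr U0).trans_le hU0
  have hVr : ∀ j < s + 2 * k - 1, Module.finrank (ZMod p) (V j) ≤ k - 1 := fun j hj =>
    (hmapr _).trans_le ((hz j hj).1.2.2.2 (hz j hj).2.1)
  obtain ⟨J0, hJ0, hc, hdis⟩ := drop_lemma V U _ hV
  have hc' : s + 1 ≤ J0.card := by
    have := Submodule.finrank_mono (inf_le_left : U ⊓ (Finset.range (s + 2 * k - 1)).sup V ≤ U)
    omega
  obtain ⟨J, hJJ, hJc⟩ := Finset.exists_subset_card_eq hc'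
  have hJlt : ∀ j ∈ J, j < s + 2 * k - 1 := fun j hj => Finset.mem_range.1 (hJ0 (hJJ hj))
  rw [JM_add, JM_eq]
  refine adapted d s (quadPoly p d A) (x.2.2 - x'.2.2) (quadPoly_hom A) (hx.2.1.sub hx'.2.1) V U J
    (by omega) (fun j hj => hV j (hJlt j hj)) (hdis.mono_right (Finset.sup_mono hJJ)) ?_ ?_
  · intro i hi j hj hij hcon
    have h1 := isotropic hp A hA hdet _ hcon
    have h2 := Submodule.finrank_add_le_finrank_add_finrank (U ⊔ V i) (V j)
    have h3 := Submodule.finrank_add_le_finrank_add_finrank U (V i)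
    have h4 := hVr i (hJlt i hi)
    have h5 := hVr j (hJlt j hj)
    have hs : 1 ≤ s := by
      by_contra h0
      have : J.card ≤ 1 := by omega
      exact hij (Finset.card_le_one.1 this i hi j hj)
    rcases Nat.lt_or_ge k 2 with hk2 | hk2
    · omega
    · have h6 := hdim hk2
      have h7 : 2 * (k - 2) * 1 ≤ 2 * (k - 2) * s := Nat.mul_le_mul_left _ hs
      omega
  · intro i hi
    obtain ⟨_, _, h1, h2, _⟩ := hz i (hJlt i hi)
    have h3 := h1.2
    have h4 := h2.2
    rw [JM_add] at h3 h4
    have e1 : JM p d A ((x.2.1 ⊔ (z i).2.1 : Submodule _ _) : Set (Fin d → ZMod p)) ≤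
        JM p d A ((U0 ⊔ (z i).2.1 : Submodule _ _) : Set (Fin d → ZMod p)) :=
      JM_mono A (SetLike.coe_subset_coe.2 (sup_le_sup_right le_sup_left _))
    have e2 : JM p d A ((x'.2.1 ⊔ (z i).2.1 : Submodule _ _) : Set (Fin d → ZMod p)) ≤
        JM p d A ((U0 ⊔ (z i).2.1 : Submodule _ _) : Set (Fin d → ZMod p)) :=
      JM_mono A (SetLike.coe_subset_coe.2 (sup_le_sup_right le_sup_right _))
    have h5 := Ideal.sub_mem _ (e1 h3) (e2 h4)
    rw [sub_sub_sub_cancel_right, JM_eq, Submodule.map_sup] at h5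
    exact h5

lemma count_lemma {ι Yt : Type*} [DecidableEq ι] [DecidableEq Yt] (M : ℕ) (Y : Finset Yt) (hY : Y.Nonempty) (I : Finset ι)
    (A : ι → Finset Yt) (hA : ∀ i ∈ I, A i ⊆ Y) (hM : ∀ i ∈ I, Y.card ≤ M * (A i).card)
    (hp : ∀ i ∈ I, ∀ j ∈ I, i ≠ j → 4 * M ^ 2 * (A i ∩ A j).card ≤ Y.card) : I.card ≤ 2 * M := by
  by_contra hcon
  push Not at hcon
  have hYp := hY.card_pos
  have hMp : 0 < M := by
    obtain ⟨i, hi⟩ : I.Nonempty := Finset.card_pos.1 (by omega)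
    have := hM i hi
    rcases Nat.eq_zero_or_pos M with h | h
    · subst h; omega
    · exact h
  obtain ⟨I', hI', hc⟩ := Finset.exists_subset_card_eq hcon.le
  have key : ∀ y ∈ Y, 2 * (I'.filter (fun i => y ∈ A i)).card ≤
      2 + (I'.offDiag.filter (fun ij => y ∈ A ij.1 ∩ A ij.2)).card := by
    intro y _
    have : I'.offDiag.filter (fun ij => y ∈ A ij.1 ∩ A ij.2) = (I'.filter (fun i => y ∈ A i)).offDiag := by
      ext ⟨a, b⟩
      simp only [Finset.mem_filter, Finset.mem_offDiag, Finset.mem_inter]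
      tauto
    rw [this, Finset.offDiag_card]
    generalize (I'.filter (fun i => y ∈ A i)).card = c
    rcases c with _ | _ | c
    · simp
    · simp
    · have : (c + 1 + 1) * (c + 1 + 1) - (c+1+1) = (c+2) * (c+1) := by
        rw [Nat.sub_eq_iff_eq_add (by nlinarith)]; ring
      rw [this]; nlinarith
  have hsum := Finset.sum_le_sum key
  have h1 : ∑ y ∈ Y, (I'.filter (fun i => y ∈ A i)).card = ∑ i ∈ I', (A i).card := by
    have := Finset.sum_card_bipartiteAbove_eq_sum_card_bipartiteBelow (s := Y) (t := I') (fun y i => y ∈ A i)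
    simp only [Finset.bipartiteAbove, Finset.bipartiteBelow] at this
    rw [this]
    refine Finset.sum_congr rfl fun i hi => ?_
    congr 1
    ext y
    simp only [Finset.mem_filter]
    exact ⟨fun h => h.2, fun h => ⟨hA i (hI' hi) h, h⟩⟩
  have h2 : ∑ y ∈ Y, (I'.offDiag.filter (fun ij => y ∈ A ij.1 ∩ A ij.2)).card
      = ∑ ij ∈ I'.offDiag, (A ij.1 ∩ A ij.2).card := by
    have := Finset.sum_card_bipartiteAbove_eq_sum_card_bipartiteBelow (s := Y) (t := I'.offDiag)
      (fun y ij => y ∈ A ij.1 ∩ A ij.2)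
    simp only [Finset.bipartiteAbove, Finset.bipartiteBelow] at this
    rw [this]
    refine Finset.sum_congr rfl fun ij hi => ?_
    congr 1
    ext y
    simp only [Finset.mem_filter]
    refine ⟨fun h => h.2, fun h => ⟨hA ij.1 (hI' (Finset.mem_offDiag.1 hi).1) (Finset.mem_inter.1 h).1, h⟩⟩
  rw [Finset.sum_add_distrib, ← Finset.mul_sum, h1, h2] at hsum
  simp only [Finset.sum_const, smul_eq_mul] at hsum
  have h3 : 2 * M * Y.card ≤ M * ∑ i ∈ I', (A i).card := by
    rw [Finset.mul_sum, ← hc, ← smul_eq_mul, ← Finset.sum_const]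
    exact Finset.sum_le_sum fun i hi => hM i (hI' hi)
  have h4 : 4 * M ^ 2 * ∑ ij ∈ I'.offDiag, (A ij.1 ∩ A ij.2).card ≤ 4 * M ^ 2 * Y.card := by
    rw [Finset.mul_sum]
    calc _ ≤ ∑ ij ∈ I'.offDiag, Y.card := Finset.sum_le_sum fun ij hij => by
            obtain ⟨a, b, c⟩ := Finset.mem_offDiag.1 hij
            exact hp _ (hI' a) _ (hI' b) c
      _ = I'.offDiag.card * Y.card := by rw [Finset.sum_const, smul_eq_mul]
      _ ≤ _ := by
          apply Nat.mul_le_mul_right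
          rw [Finset.offDiag_card, hc]
          refine (Nat.sub_le _ _).trans (le_of_eq (by ring))
  have h5 := Nat.le_of_mul_le_mul_left h4 (by positivity)
  have h6 : 2 * Y.card ≤ ∑ i ∈ I', (A i).card := by
    apply Nat.le_of_mul_le_mul_left _ hMp
    linarith
  omega

lemma net (n : ℕ) : ∀ M : ℕ, ∃ N : ℕ, ∀ (F E Yt : Type) [Field F] [AddCommGroup E] [Module F E]
    [FiniteDimensional F E] (Y : Finset Yt) (_ : Y.Nonempty) (w : Yt → E),
    ∃ T ⊆ Y, T.card ≤ N ∧ ∀ H : Submodule F E, Module.finrank F H ≤ n →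
      Y.card ≤ M * Set.ncard {y | y ∈ Y ∧ w y ∈ H} → ∃ y ∈ T, w y ∈ H := by
  classical
  induction n with
  | zero =>
    intro M
    refine ⟨1, ?_⟩
    intro F E Yt _ _ _ _ Y hY w
    by_cases h : ∃ y ∈ Y, w y = 0
    · obtain ⟨y, hy, hy0⟩ := h
      refine ⟨{y}, by simpa using hy, by simp, ?_⟩
      intro H _ _
      exact ⟨y, by simp, by rw [hy0]; exact H.zero_mem⟩
    · refine ⟨∅, by simp, by simp, ?_⟩
      intro H hH hc
      exfalso
      have hb : H = ⊥ := Submodule.finrank_eq_zero.1 (by omega)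
      subst hb
      have : {y | y ∈ Y ∧ w y ∈ (⊥ : Submodule F E)} = ∅ := by
        ext y
        simp only [Set.mem_setOf_eq, Submodule.mem_bot, Set.mem_empty_iff_false, iff_false]
        exact fun hh => h ⟨y, hh.1, hh.2⟩
      rw [this] at hc
      have := hY.card_pos
      simp at hc
      simp [hc] at hY
  | succ n ih =>
    intro M
    obtain ⟨N', hN'⟩ := ih (4 * M ^ 2)
    refine ⟨N' + 2 * M, ?_⟩
    intro F E Yt _ _ _ _ Y hY w
    obtain ⟨T', hT'Y, hT'c, hT'⟩ := hN' F E Yt Y hY w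
    let A : Submodule F E → Finset Yt := fun H => Y.filter (fun y => w y ∈ H)
    have hAc : ∀ H, Set.ncard {y | y ∈ Y ∧ w y ∈ H} = (A H).card := by
      intro H
      rw [← Set.ncard_coe_finset]
      congr 1
      ext y
      simp [A]
    simp only [hAc] at hT' ⊢
    let 𝓗 : Set (Submodule F E) := {H | Module.finrank F H ≤ n + 1 ∧ Y.card ≤ M * (A H).card ∧
      ∀ y ∈ T', w y ∉ H}
    have hfin : ∀ I : Finset (Submodule F E), (I : Set (Submodule F E)) ⊆ 𝓗 → I.card ≤ 2 * M := by
      intro I hI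
      apply count_lemma M Y hY I A (fun i _ => Finset.filter_subset _ _) (fun i hi => (hI hi).2.1)
      intro H hH H' hH' hne
      have hAA : A H ∩ A H' = A (H ⊓ H') := by
        ext y
        simp only [A, Finset.mem_inter, Finset.mem_filter, Submodule.mem_inf]
        tauto
      rw [hAA]
      by_contra hcon
      push Not at hcon
      have hr : Module.finrank F (H ⊓ H' : Submodule F E) ≤ n := by
        rcases (inf_le_left : H ⊓ H' ≤ H).eq_or_lt with h1 | h1
        · rcases (inf_le_right : H ⊓ H' ≤ H').eq_or_lt with h2 | h2
          · exact absurd (h1.symm.trans h2) hne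
          · have := Submodule.finrank_lt_finrank_of_lt h2
            have := (hI hH').1
            omega
        · have := Submodule.finrank_lt_finrank_of_lt h1
          have := (hI hH).1
          omega
      obtain ⟨y, hy, hy2⟩ := hT' _ hr hcon.le
      exact (hI hH).2.2 y hy hy2.1
    have h𝓗 : 𝓗.Finite := by
      by_contra hinf
      obtain ⟨I, hI, hIc⟩ := Set.Infinite.exists_subset_card_eq hinf (2 * M + 1)
      have := hfin I hI
      omega
    have hex : ∀ H ∈ 𝓗, ∃ y ∈ Y, w y ∈ H := by
      intro H hH
      have h1 := hH.2.1
      have h2 := hY.card_pos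
      have h3 : 0 < (A H).card := by
        rcases Nat.eq_zero_or_pos (A H).card with h | h
        · rw [h] at h1; omega
        · exact h
      obtain ⟨y, hy⟩ := Finset.card_pos.1 h3
      exact ⟨y, (Finset.mem_filter.1 hy).1, (Finset.mem_filter.1 hy).2⟩
    have : Nonempty Yt := ⟨hY.choose⟩
    choose! g hg hg2 using hex
    refine ⟨T' ∪ h𝓗.toFinset.image g, ?_, ?_, ?_⟩
    · apply Finset.union_subset hT'Y
      intro y hy
      obtain ⟨H, hH, rfl⟩ := Finset.mem_image.1 hy
      exact hg H (h𝓗.mem_toFinset.1 hH)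
    · refine (Finset.card_union_le _ _).trans (Nat.add_le_add hT'c (Finset.card_image_le.trans ?_))
      exact hfin _ (by simp)
    · intro H hH hc
      by_cases hh : ∃ y ∈ T', w y ∈ H
      · obtain ⟨y, hy, hy2⟩ := hh
        exact ⟨y, Finset.mem_union_left _ hy, hy2⟩
      · push Not at hh
        have hHm : H ∈ 𝓗 := ⟨hH, hc, hh⟩
        exact ⟨g H, Finset.mem_union_right _ (Finset.mem_image_of_mem _ (h𝓗.mem_toFinset.2 hHm)), hg2 H hHm⟩

lemma wedge_ne_zero {F E : Type} [Field F] [AddCommGroup E] [Module F E] {n : ℕ} (v : Fin n → E)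
    (hv : LinearIndependent F v) : ExteriorAlgebra.ιMulti F n v ≠ 0 := by
  intro h0
  have h := exteriorPower.ιMulti_family_linearIndependent_field (n := n) hv
  have h1 := h.ne_zero (⟨Finset.univ, by simp [Set.powersetCard]⟩ : Set.powersetCard (Fin n) n)
  apply h1
  rw [exteriorPower.ιMulti_family]
  have h2 : ∀ e : Fin n ↪ Fin n, exteriorPower.ιMulti F n (v ∘ e) = 0 := by
    intro e
    have hb : Function.Bijective e := Finite.injective_iff_bijective.1 e.injective
    have := (exteriorPower.ιMulti F n (M := E)).map_perm v (Equiv.ofBijective e hb)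
    have h3 : exteriorPower.ιMulti F n v = 0 := by
      apply Subtype.ext
      simpa using h0
    rw [h3, smul_zero] at this
    exact this
  exact h2 _

lemma subspace_net (d M : ℕ) : ∃ N : ℕ, ∀ (F Yt : Type) [Field F] (Y : Finset Yt) (_ : Y.Nonempty)
    (W : Yt → Submodule F (Fin d → F)),
    ∃ T ⊆ Y, T.card ≤ N ∧ ∀ V : Submodule F (Fin d → F),
      Y.card ≤ M * Set.ncard {y | y ∈ Y ∧ ¬ Disjoint V (W y)} → ∃ y ∈ T, ¬ Disjoint V (W y) := by
  obtain ⟨N, hN⟩ := net (2 ^ d) M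
  refine ⟨N, ?_⟩
  intro F Yt _ Y hY W
  let bE := (Pi.basisFun F (Fin d)).ExteriorAlgebra
  have : FiniteDimensional F (ExteriorAlgebra F (Fin d → F)) := Module.Finite.of_basis bE
  have hfr : Module.finrank F (ExteriorAlgebra F (Fin d → F)) = 2 ^ d := by
    rw [Module.finrank_eq_card_basis bE]; simp
  let v : ∀ y, Fin (Module.finrank F (W y)) → (Fin d → F) := fun y i => (Module.finBasis F (W y) i : Fin d → F)
  have hv : ∀ y, LinearIndependent F (v y) := fun y =>
    (Module.finBasis F (W y)).linearIndependent.map' (W y).subtype (Submodule.ker_subtype _)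
  have hvs : ∀ y, Submodule.span F (Set.range (v y)) = W y := by
    intro y
    have : Set.range (v y) = (W y).subtype '' Set.range (Module.finBasis F (W y)) := by
      rw [← Set.range_comp]; rfl
    rw [this, ← Submodule.map_span, (Module.finBasis F (W y)).span_eq, Submodule.map_top, Submodule.range_subtype]
  let w : Yt → ExteriorAlgebra F (Fin d → F) := fun y => ExteriorAlgebra.ιMulti F _ (v y)
  let H : Submodule F (Fin d → F) → Submodule F (ExteriorAlgebra F (Fin d → F)) :=
    fun V => LinearMap.ker (ExteriorAlgebra.map V.mkQ).toLinearMap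
  have key : ∀ V y, w y ∈ H V ↔ ¬ Disjoint V (W y) := by
    intro V y
    have h1 : w y ∈ H V ↔ ExteriorAlgebra.ιMulti F _ (V.mkQ ∘ v y) = 0 := by
      simp only [w, H, LinearMap.mem_ker, AlgHom.toLinearMap_apply, ExteriorAlgebra.map_apply_ιMulti]
    rw [h1]
    constructor
    · intro h0 hd
      refine wedge_ne_zero (V.mkQ ∘ v y) ?_ h0
      apply (hv y).map
      rw [hvs, Submodule.ker_mkQ]
      exact hd.symm
    · intro hd
      apply AlternatingMap.map_linearDependent
      intro hli
      apply hd
      rw [Submodule.disjoint_def]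
      intro x hxV hxW
      rw [← hvs, Submodule.mem_span_range_iff_exists_fun] at hxW
      obtain ⟨c, rfl⟩ := hxW
      have h2 : V.mkQ (∑ i, c i • v y i) = 0 := by rw [Submodule.mkQ_apply]; exact (Submodule.Quotient.mk_eq_zero V).2 hxV
      rw [map_sum] at h2
      simp only [map_smul] at h2
      have h3 := Fintype.linearIndependent_iff.1 hli c h2
      simp [h3]
  obtain ⟨T, hT, hc, hh⟩ := hN F _ Yt Y hY w
  refine ⟨T, hT, hc, ?_⟩
  intro V hV
  have := hh (H V) ((Submodule.finrank_le _).trans hfr.le) (by simpa only [key] using hV)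
  simpa only [key] using this

lemma greedy {p d : ℕ} [Fact p.Prime] (P : Set (Trip p d)) (n m : ℕ)
    (hm : ∀ x ∈ P, Module.finrank (ZMod p) x.2.1 ≤ m)
    (h : ∀ W : Submodule (ZMod p) (Fin d → ZMod p), Module.finrank (ZMod p) W ≤ n * m →
      ∃ x ∈ P, Disjoint x.2.1 W) (t : ℕ) (ht : t ≤ n + 1) :
    ∃ z : ℕ → Trip p d, ∀ j < t, z j ∈ P ∧
      Disjoint (z j).2.1 ((Finset.range j).sup (fun i => (z i).2.1)) := by
  induction t with
  | zero => exact ⟨fun _ => 0, by simp⟩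
  | succ t ih =>
    obtain ⟨z, hz⟩ := ih (by omega)
    have hfr : ∀ r ≤ t, Module.finrank (ZMod p)
        ((Finset.range r).sup (fun i => (z i).2.1) : Submodule (ZMod p) (Fin d → ZMod p))
          ≤ r * m := by
      intro r
      induction r with
      | zero => intro _; rw [Finset.range_zero, Finset.sup_empty, finrank_bot]; omega
      | succ r ihr =>
        intro hr
        rw [Finset.range_add_one, Finset.sup_insert]
        have h1 := Submodule.finrank_add_le_finrank_add_finrank (z r).2.1
          ((Finset.range r).sup (fun i => (z i).2.1))
        have h2 := ihr (by omega)
        have h3 := hm _ (hz r (by omega)).1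
        calc _ ≤ _ := h1
          _ ≤ m + r * m := by omega
          _ = (r+1) * m := by ring
    obtain ⟨x, hxP, hx⟩ := h _ ((hfr t le_rfl).trans (Nat.mul_le_mul_right m (by omega)))
    refine ⟨Function.update z t x, fun j hj => ?_⟩
    have hs : ∀ j ≤ t, (Finset.range j).sup (fun i => (Function.update z t x i).2.1)
        = (Finset.range j).sup (fun i => (z i).2.1) := by
      intro j hj
      apply Finset.sup_congr rfl
      intro i hi
      have : i ≠ t := by have := Finset.mem_range.1 hi; omega
      rw [Function.update_of_ne this]
    rw [hs j (by omega)]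
    rcases Nat.lt_succ_iff_lt_or_eq.1 hj with h1 | rfl
    · rw [Function.update_of_ne (by omega)]
      exact hz j h1
    · rw [Function.update_self]
      exact ⟨hxP, hx⟩

open Classical in
lemma count_unl (Y N : Finset ℕ) (L : ℕ → ℕ → Prop) (c : ℕ → Finset ℕ) (D : ℕ) (hD1 : 1 ≤ D)
    (hD : Y.card ≤ D * N.card)
    (hL : ∀ y ∈ N, ∀ y' ∈ N, L y y' → y' ∈ c y)
    (hlight : ∀ y ∈ N, 2 * D * D * (c y).card < Y.card) :
    (Y ×ˢ Y).card ≤ 2 * D * D * ((N ×ˢ N).filter (fun q => ¬ L q.1 q.2)).card := by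
  have h1 : ((N ×ˢ N).filter (fun q => L q.1 q.2)).card ≤ ∑ y ∈ N, (c y).card := by
    rw [← Finset.card_sigma]
    apply Finset.card_le_card_of_injOn (fun q => (⟨q.1, q.2⟩ : Sigma fun _ : ℕ => ℕ))
    · intro q hq
      simp only [Finset.coe_filter, Finset.mem_product] at hq
      obtain ⟨⟨a, b⟩, e⟩ := hq
      simp only [Finset.coe_sigma]
      exact Set.mem_sigma_iff.2 ⟨a, hL _ a _ b e⟩
    · rintro ⟨a, b⟩ _ ⟨a', b'⟩ _ h
      simpa using h
  have h2 := Finset.card_filter_add_card_filter_not (s := N ×ˢ N) (fun q => L q.1 q.2)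
  rw [Finset.card_product] at h2 ⊢
  have h3 : 2 * D * D * ∑ y ∈ N, (c y).card ≤ N.card * Y.card := by
    rw [Finset.mul_sum]
    calc _ ≤ ∑ y ∈ N, Y.card := Finset.sum_le_sum (fun y hy => (hlight y hy).le)
      _ = _ := by simp
  have h4 := Nat.mul_le_mul_left (2 * D * D) h1
  have h5 : N.card * Y.card ≤ D * D * (N.card * N.card) := by
    calc N.card * Y.card ≤ N.card * (D * N.card) := Nat.mul_le_mul_left _ hD
      _ = D * (N.card * N.card) := by ring
      _ ≤ D * D * (N.card * N.card) := Nat.mul_le_mul_right _ (by nlinarith)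
  have h6 : Y.card * Y.card ≤ D * D * (N.card * N.card) := by
    calc _ ≤ (D * N.card) * (D * N.card) := Nat.mul_le_mul hD hD
      _ = _ := by ring
  have h7 : 2 * D * D * (N.card * N.card) = 2 * D * D * ((N ×ˢ N).filter (fun q => L q.1 q.2)).card
      + 2 * D * D * ((N ×ˢ N).filter (fun q => ¬ L q.1 q.2)).card := by
    rw [← h2]; ring
  have h8 : 2 * D * D * (N.card * N.card) = 2 * (D * D * (N.card * N.card)) := by ring
  omega

open Classical in
lemma heavy_count (Y : Finset ℕ) (hY : Y.Nonempty) (R : ℕ → ℕ → Prop) (hrefl : ∀ y, R y y)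
    (hsymm : ∀ y y', R y y' → R y' y) (htrans : ∀ a b c, R a b → R b c → R a c) (P : ℕ) :
    ∃ idx : ℕ → ℕ, ∀ y ∈ Y, Y.card ≤ P * (Y.filter (R y)).card → idx y < P ∧
      ∀ y' ∈ Y, Y.card ≤ P * (Y.filter (R y')).card → idx y = idx y' → R y y' := by
  set S := (Y.filter (fun y => Y.card ≤ P * (Y.filter (R y)).card)).image
    (fun y => Y.filter (R y)) with hS
  have hSc : S.card ≤ P := by
    have hdis : (S : Set (Finset ℕ)).PairwiseDisjoint id := by
      intro a ha b hb hab
      simp only [hS, Finset.coe_image] at ha hb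
      obtain ⟨y, _, rfl⟩ := ha
      obtain ⟨y', _, rfl⟩ := hb
      simp only [Function.onFun, id]
      rw [Finset.disjoint_left]
      intro w hw hw'
      rw [Finset.mem_filter] at hw hw'
      apply hab
      have hyy : R y y' := htrans _ _ _ hw.2 (hsymm _ _ hw'.2)
      ext t
      simp only [Finset.mem_filter]
      exact ⟨fun h => ⟨h.1, htrans _ _ _ (hsymm _ _ hyy) h.2⟩,
        fun h => ⟨h.1, htrans _ _ _ hyy h.2⟩⟩
    have h1 : ∑ c ∈ S, c.card ≤ Y.card := by
      have := Finset.card_biUnion hdis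
      simp only [id] at this
      rw [← this]
      apply Finset.card_le_card
      intro w hw
      rw [Finset.mem_biUnion] at hw
      obtain ⟨c, hc, hw⟩ := hw
      rw [hS, Finset.mem_image] at hc
      obtain ⟨y, _, rfl⟩ := hc
      exact (Finset.mem_filter.1 hw).1
    have h2 : S.card * Y.card ≤ P * Y.card := by
      calc S.card * Y.card = ∑ c ∈ S, Y.card := by simp
        _ ≤ ∑ c ∈ S, P * c.card := by
          apply Finset.sum_le_sum
          intro c hc
          rw [hS, Finset.mem_image] at hc
          obtain ⟨y, hy, rfl⟩ := hc
          exact (Finset.mem_filter.1 hy).2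
        _ = P * ∑ c ∈ S, c.card := by rw [Finset.mul_sum]
        _ ≤ _ := Nat.mul_le_mul_left _ h1
    exact Nat.le_of_mul_le_mul_right h2 hY.card_pos
  refine ⟨fun y => if h : Y.filter (R y) ∈ S then (S.equivFin ⟨_, h⟩ : ℕ) else 0, ?_⟩
  intro y hy hh
  have hmem : ∀ y ∈ Y, Y.card ≤ P * (Y.filter (R y)).card → Y.filter (R y) ∈ S :=
    fun y hy hh => Finset.mem_image.2 ⟨y, Finset.mem_filter.2 ⟨hy, hh⟩, rfl⟩
  constructor
  · simp only [dif_pos (hmem y hy hh)]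
    exact (Fin.is_lt _).trans_le hSc
  · intro y' hy' hh' he
    simp only [dif_pos (hmem y hy hh), dif_pos (hmem y' hy' hh')] at he
    have h1 := S.equivFin.injective (Fin.ext he)
    have h2 : Y.filter (R y) = Y.filter (R y') := congrArg Subtype.val h1
    have : y' ∈ Y.filter (R y') := Finset.mem_filter.2 ⟨hy', hrefl _⟩
    rw [← h2] at this
    exact (Finset.mem_filter.1 this).2

/-- **Weak decomposition result for relation graphs.**  A set `X ⊆ Γ^s_k(M)` lying over
`0` with `#dd(X) ≤ D` decomposes into a part `X_g` with bounded clique cover number and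
a part `X_b` whose subspaces meet a bounded union of low-dimensional subspaces
nontrivially. -/
theorem stmt19 (d D k s : ℕ) (hd1 : 1 ≤ d) (hD : 1 ≤ D) (hk : 1 ≤ k)
    (hdim : 2 ≤ k → 2 * (k - 2) * s + 6 * k - 1 ≤ d) :
    ∃ (p0 C N : ℕ),
    ∀ p : ℕ, p.Prime → p0 ≤ p →
    ∀ (M : (Fin d → ZMod p) → ZMod p) (Mat : Matrix (Fin d) (Fin d) (ZMod p))
      (u : Fin d → ZMod p) (v : ZMod p),
      IsQuadFormWith p d M Mat u v → Mat.det ≠ 0 →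
    ∀ X : Set (Trip p d), X.Finite →
      (∀ x ∈ X, memGamma p d s k x) →
      (∀ x ∈ X, x.1 = 0) →
      DDle p d Mat X D →
      ∃ (W : Fin N → Submodule (ZMod p) (Fin d → ZMod p)) (Xb Xg : Set (Trip p d)),
        (∀ i, Module.finrank (ZMod p) (W i) ≤ (s + 2 * k - 2) * (k - 1)) ∧
        Xb ∪ Xg = X ∧ Disjoint Xb Xg ∧
        (∀ x ∈ Xb, ∃ w : Fin d → ZMod p, w ≠ 0 ∧ w ∈ x.2.1 ∧ ∃ i, w ∈ W i) ∧
        CCle p d Mat Xg C := by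
  classical
  obtain ⟨N, hN⟩ := subspace_net d (2 * D * D)
  refine ⟨3, 2 * D * D, N, ?_⟩
  intro p hp hp3 M A u v hQ hdet X _ hG h0 hDD
  have : Fact p.Prime := ⟨hp⟩
  have hA : A.IsSymm := hQ.1
  obtain ⟨Y, E, hYne, hdens, hcl⟩ := hDD 0
  obtain ⟨L, hL⟩ : ∃ L : ℕ → ℕ → Prop, ∀ y y', L y y' ↔ (y ∈ Y ∧ y' ∈ Y ∧ ∃ z : ℕ → Trip p d,
    ∀ j < s + 2 * k - 1, (z j ∈ X ∧ E (z j) y ∧ E (z j) y') ∧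
      Disjoint (z j).2.1 ((Finset.range j).sup (fun i => (z i).2.1))) := ⟨_, fun _ _ => Iff.rfl⟩
  have Lsymm : ∀ y y', L y y' → L y' y := by
    intro y y' h
    obtain ⟨a, b, z, hz⟩ := (hL _ _).1 h
    exact (hL _ _).2 ⟨b, a, z, fun j hj => ⟨⟨(hz j hj).1.1, (hz j hj).1.2.2, (hz j hj).1.2.1⟩, (hz j hj).2⟩⟩
  set R : ℕ → ℕ → Prop := Relation.ReflTransGen L with hR
  have Rsymm : ∀ y y', R y y' → R y' y := by
    intro y y' h
    induction h with
    | refl => exact Relation.ReflTransGen.refl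
    | tail _ h2 ih => exact Relation.ReflTransGen.head (Lsymm _ _ h2) ih
  have clique : ∀ y y', R y y' → y' ∈ Y → ∀ x ∈ X, ∀ x' ∈ X, E x y → E x' y' →
      TripRel p d A x x' := by
    intro y y' h hy'
    induction h using Relation.ReflTransGen.head_induction_on with
    | refl =>
      intro x hx x' hx' h1 h2
      exact hcl x hx x' hx' (h0 x hx) (h0 x' hx') y' hy' h1 h2
    | head hab _ ih =>
      intro x hx x' hx' h1 h2
      obtain ⟨ha, hb, z, hz⟩ := (hL _ _).1 hab
      refine trans_key hp3 hd1 hk hdim A hA hdet x x' z (hG x hx) (hG x' hx') (h0 x hx)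
        (h0 x' hx') ?_
      intro j hj
      obtain ⟨⟨hzX, hza, hzb⟩, hdis⟩ := hz j hj
      exact ⟨hG _ hzX, h0 _ hzX, hcl x hx _ hzX (h0 x hx) (h0 _ hzX) _ ha h1 hza,
        TripRel_symm A (ih _ hzX x' hx' hzb h2), hdis⟩
  obtain ⟨idx, hidx⟩ := heavy_count Y hYne R (fun _ => Relation.ReflTransGen.refl) Rsymm
    (fun _ _ _ => Relation.ReflTransGen.trans) (2 * D * D)
  set Xg : Set (Trip p d) := {x | x ∈ X ∧ ∃ y ∈ Y, E x y ∧
    Y.card ≤ 2 * D * D * (Y.filter (R y)).card} with hXg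
  -- the subspaces
  have hWex : ∀ q : ℕ × ℕ, ∃ W : Submodule (ZMod p) (Fin d → ZMod p),
      Module.finrank (ZMod p) W ≤ (s + 2 * k - 2) * (k - 1) ∧
      (q.1 ∈ Y → q.2 ∈ Y → ¬ L q.1 q.2 → ∀ x ∈ X, E x q.1 → E x q.2 → ¬ Disjoint x.2.1 W) := by
    rintro ⟨y, y'⟩
    by_cases hc : y ∈ Y ∧ y' ∈ Y ∧ ¬ L y y'
    · obtain ⟨hy, hy', hl⟩ := hc
      by_contra hcon
      push Not at hcon
      apply hl
      refine (hL _ _).2 ⟨hy, hy', ?_⟩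
      have := greedy {x | x ∈ X ∧ E x y ∧ E x y'} (s + 2 * k - 2) (k - 1)
        (fun x hx => (hG x hx.1).2.2.2 (h0 x hx.1)) (fun W hW => by
          obtain ⟨_, _, _, x, a, b, c, e⟩ := hcon W hW
          exact ⟨x, ⟨a, b, c⟩, e⟩) (s + 2 * k - 1) (by omega)
      exact this
    · refine ⟨⊥, by simp, ?_⟩
      intro a b c
      exact absurd ⟨a, b, c⟩ hc
  choose W hW1 hW2 using hWex
  obtain ⟨T, hTY, hTN, hT⟩ := hN (ZMod p) (ℕ × ℕ) (Y ×ˢ Y) (hYne.product hYne) W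
  refine ⟨fun i => if h : (i : ℕ) < T.card then W (T.equivFin.symm ⟨i, h⟩ : ℕ × ℕ) else ⊥,
    X \ Xg, Xg, ?_, ?_, ?_, ?_, ?_⟩
  · intro i
    have key : ∀ V : Submodule (ZMod p) (Fin d → ZMod p), ((∃ q, V = W q) ∨ V = ⊥) →
        Module.finrank (ZMod p) V ≤ (s + 2 * k - 2) * (k - 1) := by
      rintro V (⟨q, rfl⟩ | rfl)
      · exact hW1 q
      · rw [finrank_bot]; exact Nat.zero_le _
    apply key
    by_cases h : (i : ℕ) < T.card
    · left; exact ⟨_, dif_pos h⟩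
    · right; exact dif_neg h
  · exact Set.sdiff_union_of_subset (fun x hx => hx.1)
  · exact Set.disjoint_sdiff_left
  · rintro x ⟨hx, hxg⟩
    have hlight : ∀ y ∈ Y, E x y → 2 * D * D * (Y.filter (R y)).card < Y.card := by
      intro y hy hE
      by_contra hcon
      exact hxg ⟨hx, y, hy, hE, not_lt.1 hcon⟩
    have hNc : Y.card ≤ D * (Y.filter (E x)).card := by
      have := hdens x hx (h0 x hx)
      have he : {y : ℕ | y ∈ Y ∧ E x y} = ((Y.filter (E x) : Finset ℕ) : Set ℕ) := by
        ext; simp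
      rwa [he, Set.ncard_coe_finset] at this
    have hcount := count_unl Y (Y.filter (E x)) L (fun y => Y.filter (R y)) D hD hNc
      (fun y hy y' hy' hl => Finset.mem_filter.2 ⟨(Finset.mem_filter.1 hy').1,
        Relation.ReflTransGen.single hl⟩)
      (fun y hy => hlight y (Finset.mem_filter.1 hy).1 (Finset.mem_filter.1 hy).2)
    obtain ⟨q, hqT, hq⟩ := hT x.2.1 (hcount.trans (Nat.mul_le_mul_left _ (by
      rw [← Set.ncard_coe_finset]
      apply Set.ncard_le_ncard
      · intro q hq
        have hq := Finset.mem_filter.1 (Finset.mem_coe.1 hq)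
        obtain ⟨hq1, hq2⟩ := hq
        rw [Finset.mem_product, Finset.mem_filter, Finset.mem_filter] at hq1
        exact ⟨Finset.mem_product.2 ⟨hq1.1.1, hq1.2.1⟩,
          hW2 q hq1.1.1 hq1.2.1 hq2 x hx hq1.1.2 hq1.2.2⟩
      · exact (Y ×ˢ Y).finite_toSet.subset (fun q hq => hq.1))))
    rw [Submodule.disjoint_def] at hq
    push Not at hq
    obtain ⟨w, hw1, hw2, hw0⟩ := hq
    refine ⟨w, hw0, hw1, ⟨(T.equivFin ⟨q, hqT⟩ : ℕ), (Fin.is_lt _).trans_le hTN⟩, ?_⟩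
    simpa using hw2
  · have hch : ∀ x : Trip p d, ∃ y, x ∈ Xg → y ∈ Y ∧ E x y ∧
        Y.card ≤ 2 * D * D * (Y.filter (R y)).card := by
      intro x
      by_cases hx : x ∈ Xg
      · obtain ⟨_, y, h⟩ := hx
        exact ⟨y, fun _ => h⟩
      · exact ⟨0, fun h => absurd h hx⟩
    choose g hg using hch
    refine ⟨fun x => idx (g x), ?_, ?_⟩
    · intro x hx
      exact (hidx _ (hg x hx).1 (hg x hx).2.2).1
    · intro x hx x' hx' he
      exact clique _ _ ((hidx _ (hg x hx).1 (hg x hx).2.2).2 _ (hg x' hx').1 (hg x' hx').2.2 he)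
        (hg x' hx').1 x hx.1 x' hx'.1 (hg x hx).2.1 (hg x' hx').2.1
end
end
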